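/- arXiv:2504.00700 — 2 statements merged into one kernel-verified Lean document; each statement's English description precedes it below -/
import Mathlib

section
/- liminf_{A→∞} #{a ∈ 𝕃^loc(A) : 𝔪(a)³ ≤ |a|·(log|a|)⁴·(log log|a|)} / #𝕃(A) > 0. -/
open Filter MeasureTheory Finset Topology
open scoped ENNReal

noncomputable section

/-- Euclidean norm of an integer quadruple. -/
def znorm (a : Fin 4 → ℤ) : ℝ := Real.sqrt (∑ i, ((a i : ℝ)) ^ 2)

/-- Euclidean norm of a natural-number quadruple. -/
def pnorm (x : Fin 4 → ℕ) : ℝ := Real.sqrt (∑ i, ((x i : ℝ)) ^ 2)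

/-- Sup-norm `|a| = maxᵢ |aᵢ|` of an integer quadruple. -/
def snorm (a : Fin 4 → ℤ) : ℕ := Finset.univ.sup fun i => (a i).natAbs

/-- Min of the absolute values of the coordinates. -/
def minAbs (a : Fin 4 → ℤ) : ℕ := Finset.univ.inf' Finset.univ_nonempty fun i => (a i).natAbs

/-- `a` is primitive: all coordinates nonzero and gcd of the coordinates is 1. -/
def IsPrimitive (a : Fin 4 → ℤ) : Prop := (∀ i, a i ≠ 0) ∧ Finset.univ.gcd a = 1

/-- `a` is locally solvable: it is primitive, its coordinates are not all of the same
sign, and for every prime `p` the congruence `⟨a,x⟩ ≡ 0 (mod p)` has a solution in the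
reduced residues mod `p`. -/
def IsLocSolv (a : Fin 4 → ℤ) : Prop :=
  IsPrimitive a ∧ ¬ ((∀ i, 0 < a i) ∨ (∀ i, a i < 0)) ∧
  ∀ p : ℕ, p.Prime → ∃ x : Fin 4 → (ZMod p)ˣ,
    ∑ i, (a i : ZMod p) * ((x i : (ZMod p)ˣ) : ZMod p) = 0

/-- The set `L(a)` of quadruples of primes solving `⟨a,p⟩ = 0`. -/
def Lsol (a : Fin 4 → ℤ) : Set (Fin 4 → ℕ) :=
  {p | (∀ i, (p i).Prime) ∧ ∑ i, a i * (p i : ℤ) = 0}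

/-- `𝔪(a)`: the minimum of `|p|` over prime solutions `p ∈ L(a)`, and `∞` if there is
no solution. -/
def mfrak (a : Fin 4 → ℤ) : ℝ≥0∞ :=
  ⨅ p ∈ Lsol a, ((Finset.univ.sup p : ℕ) : ℝ≥0∞)

/-- The condition `𝔪(a)³ ≤ |a|·(log |a|)⁴·(log log |a|)`. -/
def SmallSol (a : Fin 4 → ℤ) : Prop :=
  (mfrak a) ^ 3 ≤ ENNReal.ofReal ((snorm a : ℝ) * (Real.log (snorm a)) ^ 4 *
    Real.log (Real.log (snorm a)))

/-- `𝕃^loc(A)`. -/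
def LlocSet (A : ℝ) : Set (Fin 4 → ℤ) := {a | IsLocSolv a ∧ znorm a ≤ A}

/-- `𝕃(A)`. -/
def LSet (A : ℝ) : Set (Fin 4 → ℤ) := {a | IsPrimitive a ∧ znorm a ≤ A}

/-- `𝒫(B)`: quadruples of primes of sup-norm at most `B`. -/
def PP (B : ℝ) : Set (Fin 4 → ℕ) := {x | ∀ i, (x i).Prime ∧ (x i : ℝ) ≤ B}

/-- The counting function `N_a(B)`. -/
def NB (a : Fin 4 → ℤ) (B : ℝ) : ℝ :=
  (Real.log B) ^ 4 * (Set.ncard {x | x ∈ PP B ∧ ∑ i, a i * (x i : ℤ) = 0} : ℝ)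

/-- `w = log log B / log log log B`. -/
def wB (B : ℝ) : ℝ := Real.log (Real.log B) / Real.log (Real.log (Real.log B))

/-- `W = ∏_{p ≤ w} p^(⌈log w/log p⌉ + 1)`. -/
def WB (B : ℝ) : ℕ :=
  ∏ p ∈ Finset.filter Nat.Prime (Finset.range (⌊wB B⌋₊ + 1)),
    p ^ (⌈Real.log (wB B) / Real.log (p : ℝ)⌉₊ + 1)

/-- `rad(W) = ∏_{p ≤ w} p`. -/
def radWB (B : ℝ) : ℕ :=
  ∏ p ∈ Finset.filter Nat.Prime (Finset.range (⌊wB B⌋₊ + 1)), p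

/-- The local counting function `N_a^loc(B)`; the summation condition is
`a ∈ Λ_x^(W) ∩ 𝒞_x^(α)` with `α = log B`. -/
def NlocB (a : Fin 4 → ℤ) (B : ℝ) : ℝ :=
  (Real.log B) ^ 4 * (Real.log B * (WB B : ℝ) / znorm a) *
    ∑ᶠ x ∈ {x : Fin 4 → ℕ | x ∈ PP B ∧ ((WB B : ℤ) ∣ ∑ i, a i * (x i : ℤ)) ∧
      |∑ i, (x i : ℝ) * (a i : ℝ)| ≤ pnorm x * znorm a / (2 * Real.log B)},
      1 / pnorm x

/-- Gram determinant `‖u‖²‖v‖² − ⟨u,v⟩²` of a pair of real vectors. -/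
def gram2 (u v : Fin 4 → ℝ) : ℝ :=
  (∑ i, u i ^ 2) * (∑ i, v i ^ 2) - (∑ i, u i * v i) ^ 2

/-- Determinant of a rank-2 lattice `S ⊆ ℤ⁴`: for such a lattice it is the minimum of
`det(ℤu ⊕ ℤv) = √(‖u‖²‖v‖² − ⟨u,v⟩²)` over linearly independent pairs `u, v ∈ S`
(the minimum being attained precisely at bases of `S`). -/
def latDet2 (S : Set (Fin 4 → ℤ)) : ℝ :=
  sInf {d : ℝ | ∃ u ∈ S, ∃ v ∈ S,
    (∀ m n : ℤ, m • u + n • v = 0 → m = 0 ∧ n = 0) ∧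
    d = Real.sqrt (gram2 (fun i => (u i : ℝ)) (fun i => (v i : ℝ)))}

/-- `det(Λ_x ∩ Λ_y)` for quadruples of primes `x, y`. -/
def detXY (x y : Fin 4 → ℕ) : ℝ :=
  latDet2 {z | (∑ i, (x i : ℤ) * z i) = 0 ∧ (∑ i, (y i : ℤ) * z i) = 0}

/-- `Ω(B)`: pairs of distinct quadruples of primes of size at most `B`. -/
def OmegaB (B : ℝ) : Set ((Fin 4 → ℕ) × (Fin 4 → ℕ)) :=
  {p | p.1 ∈ PP B ∧ p.2 ∈ PP B ∧ p.1 ≠ p.2}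

/-- `E(B)`. -/
def EB (B : ℝ) : ℝ :=
  (Real.log B) ^ 8 * ∑ᶠ p ∈ OmegaB B, 1 / detXY p.1 p.2

/-- `𝒢(x,y)`: the gcd of the 2×2 minors of the matrix with columns `x, y`. -/
def Gcal (x y : Fin 4 → ℕ) : ℤ :=
  Finset.univ.gcd fun q : Fin 4 × Fin 4 =>
    (x q.1 : ℤ) * (y q.2 : ℤ) - (x q.2 : ℤ) * (y q.1 : ℤ)

/-- `Δ(x,y) = ‖x‖‖y‖/det(ℤx ⊕ ℤy)`. -/
def DeltaXY (x y : Fin 4 → ℕ) : ℝ :=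
  pnorm x * pnorm y / Real.sqrt (gram2 (fun i => (x i : ℝ)) (fun i => (y i : ℝ)))

/-- `ℰ_{x,y}(B) = min{1, Δ(x,y)²/α²} + 𝟏[𝒢(x,y) ∤ W/rad(W)]`. -/
def EcalXY (x y : Fin 4 → ℕ) (B : ℝ) : ℝ :=
  min 1 (DeltaXY x y ^ 2 / (Real.log B) ^ 2) +
  (if Gcal x y ∣ ((WB B / radWB B : ℕ) : ℤ) then 0 else 1)

/-- `F(B)`. -/
def FB (B : ℝ) : ℝ :=
  (Real.log B) ^ 8 * ∑ᶠ p ∈ OmegaB B, EcalXY p.1 p.2 B / detXY p.1 p.2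

/-- `ζ(2)`. -/
def zeta2 : ℝ := ∑' n : ℕ, (1 : ℝ) / (n + 1) ^ 2

/-- `{a ∈ ℤ⁴_prim : ‖a‖ ≤ A}` with `ℤ⁴_prim` the tuples of coprime coordinates. -/
def primA (A : ℝ) : Set (Fin 4 → ℤ) := {a | Finset.univ.gcd a = 1 ∧ znorm a ≤ A}

/-- `D(A,B)`. -/
def DAB (A B : ℝ) : ℝ :=
  (∑ᶠ a ∈ primA A, NB a B ^ 2) - (Real.log B) ^ 4 * ∑ᶠ a ∈ primA A, NB a B

/-- `Δ_a^mix(B)`. -/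
def DeltaMix (a : Fin 4 → ℤ) (B : ℝ) : ℝ :=
  (Real.log B) ^ 8 * (Real.log B * (WB B : ℝ) / znorm a) *
    ∑ᶠ x ∈ {x : Fin 4 → ℕ | x ∈ PP B ∧ ∑ i, a i * (x i : ℤ) = 0}, 1 / pnorm x

/-- `Δ_a^loc(B)`. -/
def DeltaLoc (a : Fin 4 → ℤ) (B : ℝ) : ℝ :=
  (Real.log B) ^ 8 * ((Real.log B) ^ 2 * (WB B : ℝ) ^ 2 / znorm a ^ 2) *
    ∑ᶠ x ∈ {x : Fin 4 → ℕ | x ∈ PP B ∧ ((WB B : ℤ) ∣ ∑ i, a i * (x i : ℤ)) ∧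
      |∑ i, (x i : ℝ) * (a i : ℝ)| ≤ pnorm x * znorm a / (2 * Real.log B)},
      1 / pnorm x ^ 2

/-- `D^mix(A,B)`. -/
def DmixAB (A B : ℝ) : ℝ :=
  (∑ᶠ a ∈ primA A, NB a B * NlocB a B) - ∑ᶠ a ∈ primA A, DeltaMix a B

/-- `D^loc(A,B)`. -/
def DlocAB (A B : ℝ) : ℝ :=
  (∑ᶠ a ∈ primA A, NlocB a B ^ 2) - ∑ᶠ a ∈ primA A, DeltaLoc a B

/-- `K(A,B)`. -/
def KAB (A B : ℝ) : ℝ :=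
  ∑ᶠ a ∈ primA A, ((Real.log B) ^ 4 * NB a B + DeltaMix a B + DeltaLoc a B)

/-- `τ(a,γ) = γ·vol({u ∈ 𝓑₄(1) ∩ ℝ⁴₊ : a ∈ 𝒞_u^(γ)})`. -/
def tauA (a : Fin 4 → ℤ) (γ : ℝ) : ℝ :=
  γ * (volume {u : Fin 4 → ℝ | Real.sqrt (∑ i, u i ^ 2) < 1 ∧ (∀ i, 0 < u i) ∧
      |∑ i, u i * (a i : ℝ)| ≤ Real.sqrt (∑ i, u i ^ 2) * znorm a / (2 * γ)}).toReal

/-- The singular integral `𝔍_a(B) = τ(a, log B)`. -/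
def Jfrak (a : Fin 4 → ℤ) (B : ℝ) : ℝ := tauA a (Real.log B)

/-- `σ(a,Q) = (Q/φ(Q)⁴)·#{b ∈ ((ℤ/Qℤ)^*)⁴ : ⟨a,b⟩ ≡ 0 mod Q}`. -/
def sigmaA (a : Fin 4 → ℤ) (Q : ℕ) : ℝ :=
  (Q : ℝ) / (Nat.totient Q : ℝ) ^ 4 *
    (Nat.card {b : Fin 4 → (ZMod Q)ˣ |
      ∑ i, (a i : ZMod Q) * ((b i : (ZMod Q)ˣ) : ZMod Q) = 0} : ℝ)

/-- The truncated singular series `𝔖_a(B) = σ(a, W)`. -/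
def Sfrak (a : Fin 4 → ℤ) (B : ℝ) : ℝ := sigmaA a (WB B)

end

theorem factorial_dvd_pow_mul_prod (n d c : ℕ) :
    n.factorial ∣ d ^ n * ∏ k ∈ Finset.range n, (c + d * k) := by
  by_cases hz : d ^ n * ∏ k ∈ Finset.range n, (c + d * k) = 0
  · rw [hz]; exact dvd_zero _
  rw [← Nat.factorization_prime_le_iff_dvd n.factorial_ne_zero hz]
  intro l hl
  rw [← hl.pow_dvd_iff_le_factorization hz]
  by_cases hd : l ∣ d
  · refine Dvd.dvd.mul_right ((pow_dvd_pow_of_dvd hd _).trans (pow_dvd_pow d ?_)) _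
    rcases Nat.eq_zero_or_pos n with rfl | hn
    · simp
    · have := Nat.factorization_factorial_le_div_pred hl n
      exact this.trans (Nat.div_le_self _ _)
  · set N := l ^ (n.factorial.factorization l) with hN
    have hcop : d.Coprime N := by
      apply Nat.Coprime.pow_right
      exact ((Nat.Prime.coprime_iff_not_dvd hl).2 hd).symm
    have hNn : N ∣ n.factorial := Nat.ordProj_dvd _ _
    have hNpos : 0 < N := pow_pos hl.pos _
    obtain ⟨e, he⟩ : ∃ e : ℕ, d * e ≡ 1 [MOD N] := by
      rcases Nat.lt_or_ge 1 N with h | h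
      · obtain ⟨e, _, he⟩ := Nat.exists_mul_mod_eq_one_of_coprime hcop h
        exact ⟨e, by rw [Nat.ModEq, he, Nat.mod_eq_of_lt h]⟩
      · have : N = 1 := by omega
        exact ⟨0, by rw [this]; exact Nat.modEq_one⟩
    have hce : Nat.Coprime N e := by
      have h1 : Nat.gcd (d * e) N = Nat.gcd 1 N := he.gcd_eq
      rw [Nat.gcd_one_left] at h1
      exact (Nat.Coprime.coprime_mul_left h1).symm
    have key : e ^ n * ∏ k ∈ Finset.range n, (c + d * k) ≡ (e * c).ascFactorial n [MOD N] := by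
      have hen : e ^ n = ∏ k ∈ Finset.range n, e := by simp
      rw [Nat.ascFactorial_eq_prod_range, hen, ← Finset.prod_mul_distrib]
      refine Nat.ModEq.prod fun k _ => ?_
      have : e * (c + d * k) = e * c + (d * e) * k := by ring
      rw [this]
      simpa using (he.mul_right k).add_left (e * c)
    have h2 : N ∣ e ^ n * ∏ k ∈ Finset.range n, (c + d * k) :=
      (key.dvd_iff dvd_rfl).2 (hNn.trans (Nat.factorial_dvd_ascFactorial _ _))
    exact ((Nat.Coprime.pow_right n hce).dvd_of_dvd_mul_left h2).mul_left _

theorem factorial_mul_pow_card_le {n d c X : ℕ} {T : Finset ℕ} (hd : 0 < d)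
    (hc : 0 < c) (hT : ∀ y ∈ T, y.Prime ∧ n < y ∧ X ≤ y ∧ ∃ k < n, y = c + d * k) :
    n.factorial * X ^ T.card ≤ d ^ n * (c + d * n) ^ n := by
  have hprod : ∏ y ∈ T, y ∣ ∏ k ∈ Finset.range n, (c + d * k) := by
    have hinj : Set.InjOn (fun k => c + d * k) (Finset.range n : Set ℕ) := by
      intro a _ b _ h
      have : d * a = d * b := by simpa using h
      exact Nat.eq_of_mul_eq_mul_left hd this
    rw [← Finset.prod_image (f := fun y => y) hinj]
    apply Finset.prod_dvd_prod_of_subset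
    intro y hy
    obtain ⟨_, _, _, k, hk, rfl⟩ := hT y hy
    exact Finset.mem_image.2 ⟨k, Finset.mem_range.2 hk, rfl⟩
  have hcop : Nat.Coprime n.factorial (∏ y ∈ T, y) := by
    refine Nat.Coprime.prod_right fun y hy => ?_
    obtain ⟨hp, hn, _⟩ := hT y hy
    rw [Nat.coprime_comm, hp.coprime_iff_not_dvd, hp.dvd_factorial]
    omega
  have hdvd := hcop.mul_dvd_of_dvd_of_dvd (factorial_dvd_pow_mul_prod n d c)
    (hprod.mul_left (d ^ n))
  have hpos : 0 < d ^ n * ∏ k ∈ Finset.range n, (c + d * k) :=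
    Nat.mul_pos (pow_pos hd n) (Finset.prod_pos fun k _ => by positivity)
  calc n.factorial * X ^ T.card ≤ n.factorial * ∏ y ∈ T, y := by
        gcongr
        exact Finset.pow_card_le_prod _ _ _ fun y hy => (hT y hy).2.2.1
    _ ≤ d ^ n * ∏ k ∈ Finset.range n, (c + d * k) := Nat.le_of_dvd hpos hdvd
    _ ≤ d ^ n * (c + d * n) ^ n := by
        gcongr
        calc ∏ k ∈ Finset.range n, (c + d * k) ≤ ∏ k ∈ Finset.range n, (c + d * n) := by
              apply Finset.prod_le_prod'
              intro k hk
              have := Finset.mem_range.1 hk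
              gcongr
          _ = _ := by simp

theorem card_primes_in_progression_mul_log_le {n d c X : ℕ} {T : Finset ℕ} (hd : 0 < d)
    (hc : 0 < c) (hn : 0 < n) (hX : 0 < X)
    (hT : ∀ y ∈ T, y.Prime ∧ n < y ∧ X ≤ y ∧ ∃ k < n, y = c + d * k) :
    (T.card : ℝ) * Real.log X ≤ n * Real.log (3 * d * (c + d * n) / n) := by
  have h := factorial_mul_pow_card_le hd hc hT
  have h' : (n.factorial : ℝ) * (X : ℝ) ^ T.card ≤ (d : ℝ) ^ n * (c + d * n) ^ n := by
    exact_mod_cast h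
  have hn' : (0 : ℝ) < n := by exact_mod_cast hn
  have hd' : (0 : ℝ) < d := by exact_mod_cast hd
  have hc' : (0 : ℝ) < c := by exact_mod_cast hc
  have hX' : (0 : ℝ) < X := by exact_mod_cast hX
  have hf : (0 : ℝ) < n.factorial := by exact_mod_cast n.factorial_pos
  have h3 : (n : ℝ) ^ n ≤ 3 ^ n * n.factorial := by
    have h1 := Real.pow_div_factorial_le_exp (n : ℝ) hn'.le n
    have h2 : Real.exp n ≤ 3 ^ n := by
      rw [← Real.exp_one_pow]
      gcongr
      exact Real.exp_one_lt_three.le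
    rw [div_le_iff₀ hf] at h1
    exact h1.trans (by gcongr)
  have h4 : (X : ℝ) ^ T.card ≤ (3 * d * (c + d * n) / n) ^ n := by
    rw [div_pow, mul_pow, mul_pow, le_div_iff₀ (by positivity)]
    calc (X : ℝ) ^ T.card * n ^ n ≤ X ^ T.card * (3 ^ n * n.factorial) := by gcongr
      _ = 3 ^ n * (n.factorial * X ^ T.card) := by ring
      _ ≤ 3 ^ n * (d ^ n * (c + d * n) ^ n) := by gcongr
      _ = _ := by ring
  have h5 := Real.log_le_log (by positivity) h4
  rwa [Real.log_pow, Real.log_pow] at h5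

/-- The primes in `(X, 4X]`. -/
def primesIn (X : ℕ) : Finset ℕ := (Finset.Ioc X (4 * X)).filter Nat.Prime

theorem mem_primesIn {X p : ℕ} : p ∈ primesIn X ↔ (X < p ∧ p ≤ 4 * X) ∧ p.Prime := by
  simp [primesIn]

theorem theta_sub_theta_eq (X : ℕ) :
    Chebyshev.theta ((4 * X : ℕ) : ℝ) - Chebyshev.theta (X : ℝ) =
      ∑ p ∈ primesIn X, Real.log p := by
  have h : (Finset.Ioc 0 (4 * X)).filter Nat.Prime =
      (Finset.Ioc 0 X).filter Nat.Prime ∪ primesIn X := by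
    rw [primesIn, ← Finset.filter_union, Finset.Ioc_union_Ioc_eq_Ioc (by omega) (by omega)]
  rw [Chebyshev.theta, Chebyshev.theta, Nat.floor_natCast, Nat.floor_natCast, h,
    Finset.sum_union]
  · ring
  · rw [Finset.disjoint_left]
    intro a ha hb
    have := (mem_primesIn.1 hb).1.1
    have := (Finset.mem_Ioc.1 (Finset.mem_filter.1 ha).1).2
    omega

theorem card_primesIn_mul_log_le {X : ℕ} (hX : 0 < X) :
    ((primesIn X).card : ℝ) * Real.log X ≤ 6 * X := by
  have hX' : (0 : ℝ) < X := by exact_mod_cast hX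
  have h1 : ((primesIn X).card : ℝ) * Real.log X ≤ ∑ p ∈ primesIn X, Real.log p := by
    rw [← nsmul_eq_mul]
    refine Finset.card_nsmul_le_sum _ _ _ fun p hp => Real.log_le_log hX' ?_
    exact_mod_cast (mem_primesIn.1 hp).1.1.le
  rw [← theta_sub_theta_eq] at h1
  have h2 := Chebyshev.theta_le_log4_mul_x (x := ((4 * X : ℕ) : ℝ)) (by positivity)
  have h3 := Chebyshev.theta_nonneg (X : ℝ)
  have h4 : Real.log 4 = 2 * Real.log 2 := by
    rw [show (4 : ℝ) = 2 ^ 2 by norm_num, Real.log_pow]; norm_num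
  have h5 := Real.log_two_lt_d9
  push_cast at h1 h2
  rw [h4] at h2
  nlinarith

theorem eventually_le_card_primesIn_mul_log :
    ∀ᶠ X : ℕ in atTop, (X : ℝ) ≤ 2 * ((primesIn X).card : ℝ) * Real.log X := by
  have hsmall : ∀ᶠ x : ℝ in atTop,
      Real.log (4 * x + 1) + 2 * √(4 * x) * Real.log (4 * x) ≤ 0.3 * x := by
    have hL : Asymptotics.IsLittleO atTop (fun x : ℝ => Real.log x) (fun x => √x) := by
      simpa [Real.sqrt_eq_rpow] using isLittleO_log_rpow_atTop (r := 1 / 2) (by norm_num)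
    have h1 := hL.bound (c := 0.01) (by norm_num)
    have ht : Tendsto (fun x : ℝ => 4 * x) atTop atTop :=
      tendsto_id.const_mul_atTop (by norm_num)
    have ht' : Tendsto (fun x : ℝ => 4 * x + 1) atTop atTop :=
      tendsto_atTop_add_const_right _ _ ht
    filter_upwards [ht.eventually h1, ht'.eventually h1, eventually_ge_atTop 1] with x h2 h3 hx
    rw [Real.norm_of_nonneg (Real.log_nonneg (by linarith)),
      Real.norm_of_nonneg (Real.sqrt_nonneg _)] at h2 h3
    have h4 := Real.mul_self_sqrt (show (0 : ℝ) ≤ 4 * x by linarith)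
    have h5 : √(4 * x + 1) ≤ 4 * x + 1 := by
      rw [Real.sqrt_le_left (by linarith)]
      nlinarith
    have h6 := Real.sqrt_nonneg (4 * x)
    nlinarith
  filter_upwards [tendsto_natCast_atTop_atTop.eventually hsmall, eventually_ge_atTop 4]
    with X h hX
  have hX' : (4 : ℝ) ≤ X := by exact_mod_cast hX
  have h1 : ∑ p ∈ primesIn X, Real.log p ≤ ((primesIn X).card : ℝ) * Real.log ((4 * X : ℕ) : ℝ) := by
    rw [← nsmul_eq_mul]
    refine Finset.sum_le_card_nsmul _ _ _ fun p hp => Real.log_le_log ?_ ?_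
    · exact_mod_cast (mem_primesIn.1 hp).2.pos
    · exact_mod_cast (mem_primesIn.1 hp).1.2
  rw [← theta_sub_theta_eq] at h1
  have h2 := Chebyshev.theta_ge (4 * X)
  have h3 := Chebyshev.theta_le_log4_mul_x (x := (X : ℝ)) (by positivity)
  have h4 : Real.log 4 = 2 * Real.log 2 := by
    rw [show (4 : ℝ) = 2 ^ 2 by norm_num, Real.log_pow]; norm_num
  have h5 := Real.log_two_gt_d9
  have h6 : Real.log (4 * X) ≤ 2 * Real.log X := by
    rw [Real.log_mul (by norm_num) (by positivity)]
    have := Real.log_le_log (by norm_num) hX'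
    linarith
  push_cast at h1 h2
  rw [h4] at h3
  have h7 : ((primesIn X).card : ℝ) * Real.log (4 * X) ≤ (primesIn X).card * (2 * Real.log X) := by
    gcongr
  nlinarith

/-- Primes of size about `X` in a short interval and a fixed residue class. -/
theorem card_mul_log_le_of_primes_congr {X d r : ℕ} {T : Finset ℕ} (hd : 0 < d)
    (hX : 2 ≤ X) (hs : 64 ≤ 2 ^ r * d) (hsX : 2 ^ r * d ≤ 32 * X)
    (hT : T ⊆ primesIn X) (hcong : ∀ y ∈ T, ∀ z ∈ T, y ≡ z [MOD d])
    (hdist : ∀ y ∈ T, ∀ z ∈ T, y ≤ z → 2 ^ r * (z - y) ≤ 32 * X) :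
    (T.card : ℝ) * Real.log X ≤
      64 * X / (2 ^ r * d : ℕ) * Real.log (7 * ((2 ^ r * d : ℕ) : ℝ) ^ 2) := by
  set s := 2 ^ r * d with hsdef
  have hs' : (64 : ℝ) ≤ s := by exact_mod_cast hs
  have hlog : 0 ≤ Real.log (7 * (s : ℝ) ^ 2) := Real.log_nonneg (by nlinarith)
  rcases T.eq_empty_or_nonempty with rfl | hne
  · simp only [Finset.card_empty, Nat.cast_zero, zero_mul]
    positivity
  set c := T.min' hne with hcdef
  have hcT : c ∈ T := T.min'_mem hne
  have hcP := mem_primesIn.1 (hT hcT)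
  set n := 32 * X / s + 1 with hndef
  have hspos : 0 < s := by omega
  have hq1 : s * (32 * X / s) ≤ 32 * X := Nat.mul_div_le _ _
  have hq2 : 32 * X < s * n := Nat.lt_mul_div_succ _ hspos
  have hq3 : 1 ≤ 32 * X / s := (Nat.one_le_div_iff hspos).2 hsX
  have hnX : n ≤ X := by nlinarith
  have hmem : ∀ y ∈ T, y.Prime ∧ n < y ∧ X ≤ y ∧ ∃ k < n, y = c + d * k := by
    intro y hy
    have hyP := mem_primesIn.1 (hT hy)
    have hcy : c ≤ y := T.min'_le y hy
    refine ⟨hyP.2, by omega, by omega, ?_⟩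
    obtain ⟨k, hk⟩ := (Nat.modEq_iff_dvd' hcy).1 (hcong c hcT y hy)
    refine ⟨k, ?_, by omega⟩
    have h1 := hdist c hcT y hy hcy
    rw [hk] at h1
    have : s * k < s * n := by
      calc s * k = 2 ^ r * (d * k) := by rw [hsdef]; ring
        _ ≤ 32 * X := h1
        _ < s * n := hq2
    exact lt_of_mul_lt_mul_left this (Nat.zero_le _)
  have h := card_primes_in_progression_mul_log_le hd hcP.2.pos (by omega : 0 < n)
    (by omega : 0 < X) hmem
  have hXr : (2 : ℝ) ≤ X := by exact_mod_cast hX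
  have hspos' : (0 : ℝ) < s := by linarith
  have hn0 : (0 : ℝ) < n := by positivity
  have hn1 : (n : ℝ) ≤ 64 * X / s := by
    rw [le_div_iff₀ hspos']
    have : n * s ≤ 64 * X := by nlinarith
    exact_mod_cast this
  have hn2 : (32 : ℝ) * X < s * n := by exact_mod_cast hq2
  have hds : (d : ℝ) ≤ s := by
    have : d ≤ s := Nat.le_mul_of_pos_left _ (by positivity)
    exact_mod_cast this
  have hd0 : (0 : ℝ) < d := by exact_mod_cast hd
  have hdn : (d : ℝ) * n ≤ 64 * X := by
    calc (d : ℝ) * n ≤ s * n := by gcongr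
      _ ≤ 64 * X := by rw [le_div_iff₀ hspos'] at hn1; linarith
  have hc4 : (c : ℝ) ≤ 4 * X := by exact_mod_cast hcP.1.2
  have hc0 : (0 : ℝ) < c := by exact_mod_cast hcP.2.pos
  have harg : 3 * (d : ℝ) * (c + d * n) / n ≤ 7 * (s : ℝ) ^ 2 := by
    rw [div_le_iff₀ hn0]
    calc 3 * (d : ℝ) * (c + d * n) ≤ 3 * s * (4 * X + 64 * X) := by gcongr
      _ ≤ 7 * s * (32 * X) := by nlinarith
      _ ≤ 7 * s * (s * n) := by gcongr
      _ = _ := by ring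
  calc (T.card : ℝ) * Real.log X ≤ n * Real.log (3 * d * (c + d * n) / n) := h
    _ ≤ n * Real.log (7 * (s : ℝ) ^ 2) := by
        gcongr
    _ ≤ _ := by gcongr

theorem log_seven_mul_sq_le {s : ℝ} (hs : 1 ≤ s) :
    Real.log (7 * s ^ 2) ≤ 16 * s ^ (1 / 4 : ℝ) := by
  have h0 : (0 : ℝ) < s := by linarith
  rw [Real.log_mul (by norm_num) (by positivity), Real.log_pow]
  have h1 : Real.log s ≤ s ^ (1 / 4 : ℝ) / (1 / 4) := Real.log_le_rpow_div h0.le (by norm_num)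
  have h2 : Real.log 7 ≤ 3 := by
    rw [Real.log_le_iff_le_exp (by norm_num)]
    have : (2 : ℝ) ^ 3 ≤ Real.exp 1 ^ 3 := by
      gcongr
      have := Real.exp_one_gt_d9
      linarith
    rw [Real.exp_one_pow] at this
    norm_num at this ⊢
    linarith
  have h3 : 1 ≤ s ^ (1 / 4 : ℝ) := Real.one_le_rpow hs (by norm_num)
  push_cast
  nlinarith

/-- The absolute value of the minor `p z₂ - q z₁`. -/
def minorAbs (p q : ℕ) (z : ℕ × ℕ) : ℕ := ((p : ℤ) * z.2 - (q : ℤ) * z.1).natAbs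

/-- Pairs of primes in `(X, 4X]` for which the minor with `(p, q)` does not vanish. -/
def minorPairs (X p q : ℕ) : Finset (ℕ × ℕ) :=
  (primesIn X ×ˢ primesIn X).filter fun z => minorAbs p q z ≠ 0

/-- Pairs whose minor is divisible by `d` and at most `16 X² / 2 ^ r`. -/
def smallMinorPairs (X p q d r : ℕ) : Finset (ℕ × ℕ) :=
  (minorPairs X p q).filter fun z => d ∣ minorAbs p q z ∧ 2 ^ r * minorAbs p q z ≤ 16 * X ^ 2

theorem mem_smallMinorPairs {X p q d r : ℕ} {z : ℕ × ℕ} :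
    z ∈ smallMinorPairs X p q d r ↔ (z.1 ∈ primesIn X ∧ z.2 ∈ primesIn X) ∧
      minorAbs p q z ≠ 0 ∧ d ∣ minorAbs p q z ∧ 2 ^ r * minorAbs p q z ≤ 16 * X ^ 2 := by
  simp [smallMinorPairs, minorPairs, and_assoc]

theorem card_smallMinorPairs_le {X p q d r : ℕ} (hd : 0 < d) (hp : p ∈ primesIn X)
    (hq : q ∈ primesIn X) (hpq : p ≠ q) :
    ((smallMinorPairs X p q d r).card : ℝ) ≤ 96 * X ^ 2 / (2 ^ r * d : ℕ) := by
  have hP := mem_primesIn.1 hp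
  have hQ := mem_primesIn.1 hq
  have hX : 0 < X := by
    rcases Nat.eq_zero_or_pos X with rfl | h
    · have := hP.1.2; have := hP.2.pos; omega
    · exact h
  set s := 2 ^ r * d with hs
  have hspos : 0 < s := by positivity
  set N := 16 * X ^ 2 / s with hN
  have hmaps : ∀ z ∈ smallMinorPairs X p q d r,
      (((p : ℤ) * z.2 - (q : ℤ) * z.1) / (d : ℤ), (z.2 - 1) / X) ∈
        ((Finset.Icc (-(N : ℤ)) N).erase 0) ×ˢ Finset.Icc 1 3 := by
    intro z hz
    obtain ⟨⟨_, h2⟩, h3, h4, h5⟩ := mem_smallMinorPairs.1 hz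
    have h2' := mem_primesIn.1 h2
    have hdm : (d : ℤ) ∣ (p : ℤ) * z.2 - (q : ℤ) * z.1 := Int.natCast_dvd.2 h4
    obtain ⟨k, hk⟩ := hdm
    have hkabs : minorAbs p q z = d * k.natAbs := by
      rw [minorAbs, hk, Int.natAbs_mul, Int.natAbs_natCast]
    have hk0 : k.natAbs ≠ 0 := by
      intro h0; rw [hkabs, h0, mul_zero] at h3; exact h3 rfl
    have hkN : k.natAbs ≤ N := by
      rw [hN, Nat.le_div_iff_mul_le hspos]
      calc k.natAbs * s = 2 ^ r * (d * k.natAbs) := by rw [hs]; ring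
        _ ≤ _ := by rw [← hkabs]; exact h5
    rw [hk, Int.mul_ediv_cancel_left _ (by omega), Finset.mem_product]
    constructor
    · rw [Finset.mem_erase, Finset.mem_Icc]
      dsimp only
      omega
    · rw [Finset.mem_Icc]
      dsimp only
      constructor
      · rw [Nat.one_le_div_iff hX]; omega
      · rw [← Nat.lt_succ_iff, Nat.div_lt_iff_lt_mul hX]; omega
  have hinj : Set.InjOn (fun z : ℕ × ℕ =>
      (((p : ℤ) * z.2 - (q : ℤ) * z.1) / (d : ℤ), (z.2 - 1) / X))
      (smallMinorPairs X p q d r : Set (ℕ × ℕ)) := by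
    intro z hz w hw hzw
    have hz' := mem_smallMinorPairs.1 hz
    have hw' := mem_smallMinorPairs.1 hw
    simp only [Prod.mk.injEq] at hzw
    obtain ⟨e1, e2⟩ := hzw
    have hdz : (d : ℤ) ∣ (p : ℤ) * z.2 - (q : ℤ) * z.1 := Int.natCast_dvd.2 hz'.2.2.1
    have hdw : (d : ℤ) ∣ (p : ℤ) * w.2 - (q : ℤ) * w.1 := Int.natCast_dvd.2 hw'.2.2.1
    have e3 : (p : ℤ) * z.2 - (q : ℤ) * z.1 = (p : ℤ) * w.2 - (q : ℤ) * w.1 := by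
      rw [← Int.mul_ediv_cancel' hdz, ← Int.mul_ediv_cancel' hdw, e1]
    have e4 : (q : ℤ) ∣ (z.2 : ℤ) - w.2 := by
      have hcop : IsCoprime (q : ℤ) (p : ℤ) :=
        Nat.isCoprime_iff_coprime.2 ((Nat.coprime_primes hQ.2 hP.2).2 hpq.symm)
      apply hcop.dvd_of_dvd_mul_left
      exact ⟨(z.1 : ℤ) - w.1, by linarith⟩
    have e5 : z.2 = w.2 := by
      have hz2 := (mem_primesIn.1 hz'.1.2).1.1
      have hw2 := (mem_primesIn.1 hw'.1.2).1.1
      have a1 := Nat.div_add_mod (z.2 - 1) X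
      have a2 := Nat.div_add_mod (w.2 - 1) X
      have b1 := Nat.mod_lt (z.2 - 1) hX
      have b2 := Nat.mod_lt (w.2 - 1) hX
      rw [e2] at a1
      have hlt : |(z.2 : ℤ) - w.2| < q := by
        have := hQ.1.1
        rw [abs_lt]
        omega
      have := Int.eq_zero_of_abs_lt_dvd e4 hlt
      omega
    have e6 : z.1 = w.1 := by
      rw [e5] at e3
      have : (q : ℤ) * z.1 = q * w.1 := by linarith
      have hq0 : (q : ℤ) ≠ 0 := by have := hQ.2.pos; omega
      exact_mod_cast mul_left_cancel₀ hq0 this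
    exact Prod.ext e6 e5
  have hcard := Finset.card_le_card_of_injOn _ hmaps hinj
  have hcard2 : (smallMinorPairs X p q d r).card ≤ 2 * N * 3 := by
    refine hcard.trans ?_
    rw [Finset.card_product, Finset.card_erase_of_mem (by simp), Int.card_Icc, Nat.card_Icc]
    apply Nat.mul_le_mul <;> omega
  have hN' : (N : ℝ) ≤ 16 * X ^ 2 / s := by
    have := Nat.cast_div_le (α := ℝ) (m := 16 * X ^ 2) (n := s)
    push_cast at this
    exact this
  calc ((smallMinorPairs X p q d r).card : ℝ) ≤ 2 * N * 3 := by exact_mod_cast hcard2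
    _ ≤ 2 * (16 * X ^ 2 / s) * 3 := by gcongr
    _ = _ := by ring

theorem card_smallMinorPairs_mul_log_sq_le {X p q d r : ℕ} (hd : 0 < d) (hX : 2 ≤ X)
    (hp : p ∈ primesIn X) (hs : 64 ≤ 2 ^ r * d) (hsX : 2 ^ r * d ≤ X) :
    ((smallMinorPairs X p q d r).card : ℝ) * Real.log X ^ 2 ≤
      6 * X * (64 * X / (2 ^ r * d : ℕ) * Real.log (7 * ((2 ^ r * d : ℕ) : ℝ) ^ 2)) := by
  have hP := mem_primesIn.1 hp
  have hX0 : 0 < X := by omega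
  have hds : d ≤ 2 ^ r * d := Nat.le_mul_of_pos_left _ (by positivity)
  have hpd : IsCoprime (d : ℤ) (p : ℤ) := by
    refine Nat.isCoprime_iff_coprime.2 (Nat.Coprime.symm ?_)
    rw [hP.2.coprime_iff_not_dvd]
    intro h
    have := Nat.le_of_dvd hd h
    omega
  set R := 64 * (X : ℝ) / (2 ^ r * d : ℕ) * Real.log (7 * ((2 ^ r * d : ℕ) : ℝ) ^ 2) with hR
  have hlogX : 0 ≤ Real.log X := Real.log_natCast_nonneg _
  have hfib : ∀ x ∈ primesIn X,
      (((smallMinorPairs X p q d r).filter fun z => z.1 = x).card : ℝ) * Real.log X ≤ R := by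
    intro x hx
    set T := ((smallMinorPairs X p q d r).filter fun z => z.1 = x).image Prod.snd with hTdef
    have hTcard : T.card = ((smallMinorPairs X p q d r).filter fun z => z.1 = x).card := by
      apply Finset.card_image_of_injOn
      intro z hz w hw h
      have h1 := (Finset.mem_filter.1 hz).2
      have h2 := (Finset.mem_filter.1 hw).2
      exact Prod.ext (h1.trans h2.symm) h
    have hTmem : ∀ y ∈ T, y ∈ primesIn X ∧ (d : ℤ) ∣ (p : ℤ) * y - q * x ∧
        (2 : ℤ) ^ r * |(p : ℤ) * y - q * x| ≤ 16 * X ^ 2 := by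
      intro y hy
      obtain ⟨z, hz, rfl⟩ := Finset.mem_image.1 hy
      obtain ⟨hz1, rfl⟩ := Finset.mem_filter.1 hz
      obtain ⟨⟨_, h2⟩, _, h4, h5⟩ := mem_smallMinorPairs.1 hz1
      refine ⟨h2, Int.natCast_dvd.2 h4, ?_⟩
      have : ((2 ^ r * minorAbs p q z : ℕ) : ℤ) ≤ ((16 * X ^ 2 : ℕ) : ℤ) := by exact_mod_cast h5
      simpa [minorAbs] using this
    rw [← hTcard]
    refine card_mul_log_le_of_primes_congr hd hX hs (by omega) (fun y hy => (hTmem y hy).1) ?_ ?_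
    · intro y hy z hz
      rw [Nat.modEq_iff_dvd]
      apply hpd.dvd_of_dvd_mul_left
      have := dvd_sub (hTmem z hz).2.1 (hTmem y hy).2.1
      have e : (p : ℤ) * z - q * x - (p * y - q * x) = p * (z - y) := by ring
      rwa [e] at this
    · intro y hy z hz hyz
      have h1 := (hTmem y hy).2.2
      have h2 := (hTmem z hz).2.2
      have h3 : (p : ℤ) * (z - y) ≤ |(p : ℤ) * z - q * x| + |(p : ℤ) * y - q * x| := by
        have a1 := le_abs_self ((p : ℤ) * z - q * x)
        have a2 := neg_abs_le ((p : ℤ) * y - q * x)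
        linarith
      have h4 : (2 : ℤ) ^ r * (p * (z - y)) ≤ 32 * X ^ 2 := by
        calc (2 : ℤ) ^ r * (p * (z - y)) ≤ 2 ^ r * (|(p : ℤ) * z - q * x| + |(p : ℤ) * y - q * x|) := by
              gcongr
          _ ≤ _ := by linarith
      have h5 : (X : ℤ) * (2 ^ r * (z - y)) ≤ X * (32 * X) := by
        have hzy : (0 : ℤ) ≤ (z : ℤ) - y := by omega
        have hpX : (X : ℤ) ≤ p := by exact_mod_cast hP.1.1.le
        calc (X : ℤ) * (2 ^ r * (z - y)) ≤ p * (2 ^ r * (z - y)) := by gcongr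
          _ = 2 ^ r * (p * (z - y)) := by ring
          _ ≤ 32 * X ^ 2 := h4
          _ = _ := by ring
      have h6 := le_of_mul_le_mul_left h5 (by exact_mod_cast hX0)
      have : ((2 ^ r * (z - y) : ℕ) : ℤ) ≤ ((32 * X : ℕ) : ℤ) := by
        push_cast [Nat.cast_sub hyz]
        exact h6
      exact_mod_cast this
  have hsum : (smallMinorPairs X p q d r).card =
      ∑ x ∈ primesIn X, ((smallMinorPairs X p q d r).filter fun z => z.1 = x).card :=
    Finset.card_eq_sum_card_fiberwise fun z hz => (mem_smallMinorPairs.1 hz).1.1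
  have hR0 : 0 ≤ R := by
    have : (64 : ℝ) ≤ (2 ^ r * d : ℕ) := by exact_mod_cast hs
    have := Real.log_nonneg (show 1 ≤ 7 * ((2 ^ r * d : ℕ) : ℝ) ^ 2 by nlinarith)
    positivity
  calc ((smallMinorPairs X p q d r).card : ℝ) * Real.log X ^ 2
      = (∑ x ∈ primesIn X, (((smallMinorPairs X p q d r).filter fun z => z.1 = x).card : ℝ)
          * Real.log X) * Real.log X := by
        rw [hsum, ← Finset.sum_mul]; push_cast; ring
    _ ≤ (∑ x ∈ primesIn X, R) * Real.log X := by
        gcongr with x hx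
        exact hfib x hx
    _ = ((primesIn X).card * Real.log X) * R := by rw [Finset.sum_const, nsmul_eq_mul]; ring
    _ ≤ 6 * X * R := mul_le_mul_of_nonneg_right (card_primesIn_mul_log_le hX0) hR0

theorem eventually_card_smallMinorPairs_le :
    ∀ᶠ X : ℕ in atTop, ∀ p ∈ primesIn X, ∀ q ∈ primesIn X, p ≠ q → ∀ d, 0 < d → ∀ r,
      ((smallMinorPairs X p q d r).card : ℝ) ≤
        6144 * X ^ 2 / Real.log X ^ 2 * ((2 ^ r * d : ℕ) : ℝ) ^ (-(3 / 4) : ℝ) := by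
  have hlog : ∀ᶠ X : ℕ in atTop, Real.log X ^ 8 ≤ X := by
    have h := (Real.isLittleO_pow_log_id_atTop (n := 8)).bound (c := 1) (by norm_num)
    filter_upwards [tendsto_natCast_atTop_atTop.eventually h, eventually_ge_atTop 1] with X hX hX1
    have : 0 ≤ Real.log X := Real.log_natCast_nonneg _
    simpa [abs_of_nonneg this] using hX
  filter_upwards [hlog, eventually_ge_atTop 3] with X hX hX3 p hp q hq hpq d hd r
  set s := 2 ^ r * d with hs
  have hspos : 0 < s := by positivity
  have hs1 : (1 : ℝ) ≤ s := by exact_mod_cast hspos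
  have hs0 : (0 : ℝ) < s := by linarith
  have hX0 : (0 : ℝ) < X := by positivity
  have hL : 1 ≤ Real.log X := by
    rw [Real.le_log_iff_exp_le hX0]
    have : (3 : ℝ) ≤ X := by exact_mod_cast hX3
    linarith [Real.exp_one_lt_three]
  have hsplit : (s : ℝ) ^ (1 / 4 : ℝ) = s * (s : ℝ) ^ (-(3 / 4) : ℝ) := by
    rw [← Real.rpow_one_add' hs0.le (by norm_num)]
    norm_num
  set w := (s : ℝ) ^ (-(3 / 4) : ℝ) with hw
  have hw0 : 0 < w := Real.rpow_pos_of_pos hs0 _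
  rw [div_mul_eq_mul_div, le_div_iff₀ (by positivity)]
  rcases le_or_gt ((s : ℝ)) (Real.log X ^ 8) with h1 | h1
  · rcases le_or_gt 64 s with h2 | h2
    · have hsX : s ≤ X := by
        have : (s : ℝ) ≤ X := h1.trans hX
        exact_mod_cast this
      calc ((smallMinorPairs X p q d r).card : ℝ) * Real.log X ^ 2
          ≤ 6 * X * (64 * X / s * Real.log (7 * (s : ℝ) ^ 2)) :=
            card_smallMinorPairs_mul_log_sq_le hd (by omega) hp h2 hsX
        _ ≤ 6 * X * (64 * X / s * (16 * (s * w))) := by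
            gcongr
            rw [← hsplit]
            exact log_seven_mul_sq_le hs1
        _ = 6144 * X ^ 2 * w := by field_simp; ring
    · have hw64 : 1 ≤ 64 * w := by
        have h3 : 1 ≤ (s : ℝ) ^ (1 / 4 : ℝ) := Real.one_le_rpow hs1 (by norm_num)
        rw [hsplit] at h3
        have h4 : (s : ℝ) ≤ 64 := by exact_mod_cast h2.le
        nlinarith
      have h5 : (smallMinorPairs X p q d r).card ≤ (primesIn X).card * (primesIn X).card := by
        rw [← Finset.card_product]
        apply Finset.card_le_card
        intro z hz
        exact Finset.mem_product.2 (mem_smallMinorPairs.1 hz).1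
      have h6 := card_primesIn_mul_log_le (X := X) (by omega)
      calc ((smallMinorPairs X p q d r).card : ℝ) * Real.log X ^ 2
          ≤ ((primesIn X).card * (primesIn X).card : ℕ) * Real.log X ^ 2 := by gcongr
        _ = ((primesIn X).card * Real.log X) ^ 2 := by push_cast; ring
        _ ≤ (6 * X) ^ 2 := by gcongr
        _ = 36 * X ^ 2 * 1 := by ring
        _ ≤ 36 * X ^ 2 * (64 * w) := by gcongr
        _ ≤ 6144 * X ^ 2 * w := by nlinarith [sq_nonneg (X : ℝ), mul_nonneg (sq_nonneg (X : ℝ)) hw0.le]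
  · have h2 : Real.log X ^ 2 ≤ s * w := by
      rw [← hsplit]
      calc Real.log X ^ 2 = ((Real.log X ^ 8 : ℝ)) ^ (1 / 4 : ℝ) := by
            rw [← Real.rpow_natCast, ← Real.rpow_natCast, ← Real.rpow_mul (by linarith)]
            norm_num
        _ ≤ _ := by gcongr
    calc ((smallMinorPairs X p q d r).card : ℝ) * Real.log X ^ 2
        ≤ 96 * X ^ 2 / s * (s * w) := by
          gcongr
          exact card_smallMinorPairs_le hd hp hq hpq
      _ = 96 * X ^ 2 * w := by field_simp
      _ ≤ _ := by gcongr; norm_num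

theorem exists_sum_rpow_le : ∃ C : ℝ, 0 < C ∧ ∀ R N : ℕ,
    ∑ r ∈ Finset.range R, ∑ d ∈ Finset.Icc 1 N, ((2 ^ r * d : ℕ) : ℝ) ^ (-(5 / 4) : ℝ) ≤ C := by
  have h1 : Summable fun d : ℕ => (d : ℝ) ^ (-(5 / 4) : ℝ) :=
    Real.summable_nat_rpow.2 (by norm_num)
  have hb : (2 : ℝ) ^ (-(5 / 4) : ℝ) < 1 := Real.rpow_lt_one_of_one_lt_of_neg (by norm_num) (by norm_num)
  have hb0 : (0 : ℝ) < (2 : ℝ) ^ (-(5 / 4) : ℝ) := by positivity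
  have h2 : Summable fun r : ℕ => ((2 : ℝ) ^ (-(5 / 4) : ℝ)) ^ r :=
    summable_geometric_of_lt_one hb0.le hb
  refine ⟨(∑' r : ℕ, ((2 : ℝ) ^ (-(5 / 4) : ℝ)) ^ r) * (∑' d : ℕ, (d : ℝ) ^ (-(5 / 4) : ℝ)) + 1,
    ?_, fun R N => ?_⟩
  · have a1 : 0 ≤ ∑' r : ℕ, ((2 : ℝ) ^ (-(5 / 4) : ℝ)) ^ r := tsum_nonneg fun r => by positivity
    have a2 : 0 ≤ ∑' d : ℕ, (d : ℝ) ^ (-(5 / 4) : ℝ) := tsum_nonneg fun d => by positivity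
    positivity
  · calc ∑ r ∈ Finset.range R, ∑ d ∈ Finset.Icc 1 N, ((2 ^ r * d : ℕ) : ℝ) ^ (-(5 / 4) : ℝ)
        = (∑ r ∈ Finset.range R, ((2 : ℝ) ^ (-(5 / 4) : ℝ)) ^ r) *
          ∑ d ∈ Finset.Icc 1 N, (d : ℝ) ^ (-(5 / 4) : ℝ) := by
          rw [Finset.sum_mul_sum]
          refine Finset.sum_congr rfl fun r _ => Finset.sum_congr rfl fun d _ => ?_
          push_cast
          rw [Real.mul_rpow (by positivity) (by positivity), ← Real.rpow_natCast,
            ← Real.rpow_natCast, ← Real.rpow_mul (by norm_num), ← Real.rpow_mul (by norm_num),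
            mul_comm (r : ℝ)]
      _ ≤ (∑' r : ℕ, ((2 : ℝ) ^ (-(5 / 4) : ℝ)) ^ r) * (∑' d : ℕ, (d : ℝ) ^ (-(5 / 4) : ℝ)) := by
          gcongr
          · exact h2.sum_le_tsum _ fun r _ => by positivity
          · exact h1.sum_le_tsum _ fun r _ => by positivity
      _ ≤ _ := by linarith

/-- An integer-valued triple weighted by gcd over maximum, bounded through dyadic ranges and
divisors. -/
theorem exists_sum_gcd_div_sup_le : ∃ C : ℝ, 0 < C ∧ ∀ {α : Type} (U : Finset α) (μ : α → ℕ)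
    (N : ℕ) (G : ℝ), (∀ z ∈ U, 0 < μ z ∧ μ z ≤ N) →
    (∀ d r : ℕ, 0 < d → ((U.filter fun z => d ∣ μ z ∧ 2 ^ r * μ z ≤ N).card : ℝ) ≤
      G * ((2 ^ r * d : ℕ) : ℝ) ^ (-(3 / 4) : ℝ)) →
    ∑ z ∈ Fintype.piFinset fun _ : Fin 3 => U,
      ((Finset.univ.gcd fun j => μ (z j) : ℕ) : ℝ) / (Finset.univ.sup fun j => μ (z j) : ℕ) ≤
      C * G ^ 3 / N := by
  classical
  obtain ⟨C, hC, hsum⟩ := exists_sum_rpow_le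
  refine ⟨2 * C, by positivity, fun U μ N G hU hG => ?_⟩
  have hG0 : 0 ≤ G := by
    have := hG 1 0 one_pos
    simp only [pow_zero, mul_one, Nat.cast_one, Real.one_rpow] at this
    exact le_trans (Nat.cast_nonneg _) this
  have hterm : ∀ z ∈ Fintype.piFinset fun _ : Fin 3 => U,
      ((Finset.univ.gcd fun j => μ (z j) : ℕ) : ℝ) / (Finset.univ.sup fun j => μ (z j) : ℕ) ≤
      ∑ r ∈ Finset.range (N + 1), ∑ d ∈ Finset.Icc 1 N, if (∀ j, d ∣ μ (z j) ∧ 2 ^ r * μ (z j) ≤ N)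
        then (d : ℝ) * 2 ^ (r + 1) / N else 0 := by
    intro z hz
    have hz' := Fintype.mem_piFinset.1 hz
    set h := Finset.univ.gcd fun j => μ (z j) with hh
    set M := Finset.univ.sup fun j => μ (z j) with hM
    have hjM : ∀ j, μ (z j) ≤ M := fun j =>
      Finset.le_sup (f := fun j => μ (z j)) (Finset.mem_univ j)
    have hdj : ∀ j, h ∣ μ (z j) := fun j => Finset.gcd_dvd (Finset.mem_univ j)
    have hMN : M ≤ N := Finset.sup_le fun j _ => (hU _ (hz' j)).2
    have h0pos := (hU _ (hz' 0)).1
    have hM0 : 0 < M := h0pos.trans_le (hjM 0)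
    have hh0 : 0 < h := Nat.pos_of_dvd_of_pos (hdj 0) h0pos
    have hhN : h ≤ N := (Nat.le_of_dvd h0pos (hdj 0)).trans ((hjM 0).trans hMN)
    have hN0 : 0 < N := hM0.trans_le hMN
    set r := Nat.log 2 (N / M) with hr
    have hq0 : N / M ≠ 0 := (Nat.div_pos hMN hM0).ne'
    have hr1 : 2 ^ r * M ≤ N := (Nat.le_div_iff_mul_le hM0).1 (Nat.pow_log_le_self 2 hq0)
    have hr2 : N < 2 ^ (r + 1) * M := (Nat.div_lt_iff_lt_mul hM0).1 (Nat.lt_pow_succ_log_self (by norm_num) _)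
    have hrN : r < N + 1 := by
      have : r < 2 ^ r := Nat.lt_two_pow_self
      nlinarith
    have hcond : ∀ j, h ∣ μ (z j) ∧ 2 ^ r * μ (z j) ≤ N := fun j =>
      ⟨hdj j, (Nat.mul_le_mul_left _ (hjM j)).trans hr1⟩
    have hnn : ∀ r' ∈ Finset.range (N + 1), ∀ d ∈ Finset.Icc 1 N,
        0 ≤ (if (∀ j, d ∣ μ (z j) ∧ 2 ^ r' * μ (z j) ≤ N)
          then (d : ℝ) * 2 ^ (r' + 1) / N else 0) := by
      intro r' _ d _
      split_ifs <;> positivity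
    refine le_trans ?_ (Finset.single_le_sum
      (fun r' hr' => Finset.sum_nonneg (hnn r' hr')) (Finset.mem_range.2 hrN))
    refine le_trans ?_ (Finset.single_le_sum (hnn r (Finset.mem_range.2 hrN))
      (Finset.mem_Icc.2 ⟨hh0, hhN⟩))
    rw [if_pos hcond]
    have hM0' : (0 : ℝ) < M := by exact_mod_cast hM0
    have hN0' : (0 : ℝ) < N := by exact_mod_cast hN0
    have hr2' : (N : ℝ) ≤ 2 ^ (r + 1) * M := by exact_mod_cast hr2.le
    rw [div_le_div_iff₀ hM0' hN0']
    calc (h : ℝ) * N ≤ h * (2 ^ (r + 1) * M) := by gcongr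
      _ = _ := by ring
  have hcount : ∀ d r : ℕ, 0 < d →
      (((Fintype.piFinset fun _ : Fin 3 => U).filter
        fun z => ∀ j, d ∣ μ (z j) ∧ 2 ^ r * μ (z j) ≤ N).card : ℝ) ≤
      G ^ 3 * ((2 ^ r * d : ℕ) : ℝ) ^ (-(9 / 4) : ℝ) := by
    intro d r hd
    have e : ((Fintype.piFinset fun _ : Fin 3 => U).filter
        fun z => ∀ j, d ∣ μ (z j) ∧ 2 ^ r * μ (z j) ≤ N) =
        Fintype.piFinset fun _ : Fin 3 => U.filter fun z => d ∣ μ z ∧ 2 ^ r * μ z ≤ N := by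
      ext z
      simp only [Finset.mem_filter, Fintype.mem_piFinset]
      exact ⟨fun h j => ⟨h.1 j, h.2 j⟩, fun h => ⟨fun j => (h j).1, fun j => (h j).2⟩⟩
    rw [e, Fintype.card_piFinset_const]
    push_cast
    calc _ ≤ (G * ((2 ^ r * d : ℕ) : ℝ) ^ (-(3 / 4) : ℝ)) ^ 3 :=
          pow_le_pow_left₀ (by positivity) (hG d r hd) 3
      _ = _ := by
        rw [mul_pow, ← Real.rpow_natCast (((2 ^ r * d : ℕ) : ℝ) ^ (-(3 / 4) : ℝ)),
          ← Real.rpow_mul (by positivity)]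
        norm_num
  calc _ ≤ ∑ z ∈ Fintype.piFinset fun _ : Fin 3 => U,
        ∑ r ∈ Finset.range (N + 1), ∑ d ∈ Finset.Icc 1 N,
          if (∀ j, d ∣ μ (z j) ∧ 2 ^ r * μ (z j) ≤ N) then (d : ℝ) * 2 ^ (r + 1) / N else 0 :=
        Finset.sum_le_sum hterm
    _ = ∑ r ∈ Finset.range (N + 1), ∑ d ∈ Finset.Icc 1 N,
          (((Fintype.piFinset fun _ : Fin 3 => U).filter
            fun z => ∀ j, d ∣ μ (z j) ∧ 2 ^ r * μ (z j) ≤ N).card : ℝ) *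
            ((d : ℝ) * 2 ^ (r + 1) / N) := by
        rw [Finset.sum_comm]
        refine Finset.sum_congr rfl fun r _ => ?_
        rw [Finset.sum_comm]
        refine Finset.sum_congr rfl fun d _ => ?_
        rw [← Finset.sum_filter, Finset.sum_const, nsmul_eq_mul]
    _ ≤ ∑ r ∈ Finset.range (N + 1), ∑ d ∈ Finset.Icc 1 N,
          2 * G ^ 3 / N * ((2 ^ r * d : ℕ) : ℝ) ^ (-(5 / 4) : ℝ) := by
        refine Finset.sum_le_sum fun r _ => Finset.sum_le_sum fun d hd => ?_
        have hd0 : 0 < d := (Finset.mem_Icc.1 hd).1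
        have hs0 : (0 : ℝ) < ((2 ^ r * d : ℕ) : ℝ) := by positivity
        have hsplit : ((2 ^ r * d : ℕ) : ℝ) ^ (-(5 / 4) : ℝ) =
            ((2 ^ r * d : ℕ) : ℝ) * ((2 ^ r * d : ℕ) : ℝ) ^ (-(9 / 4) : ℝ) := by
          rw [← Real.rpow_one_add' hs0.le (by norm_num)]
          norm_num
        calc _ ≤ G ^ 3 * ((2 ^ r * d : ℕ) : ℝ) ^ (-(9 / 4) : ℝ) * ((d : ℝ) * 2 ^ (r + 1) / N) := by
              gcongr
              exact hcount d r hd0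
          _ = _ := by rw [hsplit]; push_cast; ring
    _ = 2 * G ^ 3 / N * ∑ r ∈ Finset.range (N + 1), ∑ d ∈ Finset.Icc 1 N,
          ((2 ^ r * d : ℕ) : ℝ) ^ (-(5 / 4) : ℝ) := by
        simp_rw [Finset.mul_sum]
    _ ≤ 2 * G ^ 3 / N * C := by
        gcongr
        exact hsum _ _
    _ = _ := by ring

theorem card_mul_le_of_pairwise_dvd_sub {S : Finset ℤ} {Y n : ℕ} (hn : 0 < n) (hnY : n ≤ Y)
    (hS : ∀ a ∈ S, |a| ≤ Y) (hcong : ∀ a ∈ S, ∀ b ∈ S, (n : ℤ) ∣ a - b) :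
    S.card * n ≤ 3 * Y := by
  have hn' : (0 : ℤ) < n := by exact_mod_cast hn
  have hmaps : ∀ a ∈ S, (a + Y) / (n : ℤ) ∈ Finset.Icc (0 : ℤ) ((2 * Y / n : ℕ) : ℤ) := by
    intro a ha
    have := abs_le.1 (hS a ha)
    rw [Finset.mem_Icc]
    refine ⟨Int.ediv_nonneg (by omega) hn'.le, ?_⟩
    push_cast
    exact Int.ediv_le_ediv hn' (by omega)
  have hinj : Set.InjOn (fun a : ℤ => (a + Y) / (n : ℤ)) (S : Set ℤ) := by
    intro a ha b hb hab
    have h1 := Int.ediv_mul_add_emod (a + Y) n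
    have h2 := Int.ediv_mul_add_emod (b + Y) n
    have h3 : (a + Y) % (n : ℤ) = (b + Y) % (n : ℤ) := by
      refine Int.emod_eq_emod_iff_emod_sub_eq_zero.2 (Int.emod_eq_zero_of_dvd ?_)
      rw [show a + (Y : ℤ) - (b + Y) = a - b by ring]
      exact hcong a ha b hb
    dsimp only at hab
    rw [hab, h3] at h1
    linarith
  have hcard := Finset.card_le_card_of_injOn _ hmaps hinj
  rw [Int.card_Icc] at hcard
  have h4 : S.card ≤ 2 * Y / n + 1 := by
    generalize 2 * Y / n = t at hcard ⊢
    omega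
  calc S.card * n ≤ (2 * Y / n + 1) * n := by gcongr
    _ = 2 * Y / n * n + n := by ring
    _ ≤ 2 * Y + n := Nat.add_le_add_right (Nat.div_mul_le_self _ _) _
    _ ≤ 3 * Y := by omega

/-- Integer points in a box on the plane orthogonal to `(m₁, m₂, m₃)`. -/
theorem card_mul_natAbs_le_of_plane {V : Finset (ℤ × ℤ × ℤ)} {Y : ℕ} {m₁ m₂ m₃ : ℤ}
    (hm : m₁ ≠ 0) (hmY : m₁.natAbs ≤ Y)
    (hV : ∀ a ∈ V, |a.1| ≤ Y ∧ |a.2.1| ≤ Y ∧ |a.2.2| ≤ Y ∧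
      m₁ * a.1 + m₂ * a.2.1 + m₃ * a.2.2 = 0) :
    V.card * m₁.natAbs ≤ 9 * Y ^ 2 * Int.gcd (Int.gcd m₁ m₂) m₃ := by
  set e := Int.gcd m₁ m₂ with he
  set h := Int.gcd e m₃ with hh
  have he0 : 0 < e := Int.gcd_pos_of_ne_zero_left _ hm
  have hh0 : 0 < h := Int.gcd_pos_of_ne_zero_left _ (by exact_mod_cast he0.ne')
  obtain ⟨u₁, u₂, hu, e1, e2⟩ := Int.exists_gcd_one he0
  obtain ⟨f, u₃, hf, e3, e4⟩ := Int.exists_gcd_one hh0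
  rw [← he] at e1 e2
  rw [← hh] at e3 e4
  have hu1 : u₁ ≠ 0 := by rintro rfl; simp at e1; exact hm e1
  have hf0 : f ≠ 0 := by rintro rfl; simp at e3; omega
  have hm1 : m₁.natAbs = u₁.natAbs * f.natAbs * h := by
    rw [e1, e3, Int.natAbs_mul, Int.natAbs_mul, Int.natAbs_natCast, mul_assoc]
  have huY : u₁.natAbs ≤ Y := by
    refine le_trans ?_ hmY
    rw [hm1, mul_assoc]
    exact Nat.le_mul_of_pos_right _ (Nat.mul_pos (by omega) hh0)
  have hfY : f.natAbs ≤ Y := by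
    refine le_trans ?_ hmY
    rw [hm1, mul_comm u₁.natAbs, mul_assoc]
    exact Nat.le_mul_of_pos_right _ (Nat.mul_pos (by omega) hh0)
  set T := V.image fun a => a.2.2 with hT
  have hdvd : ∀ c ∈ T, f ∣ c := by
    intro c hc
    obtain ⟨a, ha, rfl⟩ := Finset.mem_image.1 hc
    obtain ⟨_, _, _, h4⟩ := hV a ha
    have hcop : IsCoprime f u₃ := Int.isCoprime_iff_gcd_eq_one.2 hf
    apply hcop.dvd_of_dvd_mul_left
    rw [e1, e2, e4, e3] at h4
    have h5 : (h : ℤ) * (f * (u₁ * a.1 + u₂ * a.2.1) + u₃ * a.2.2) = 0 := by linarith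
    have h6 := (mul_eq_zero.1 h5).resolve_left (by exact_mod_cast hh0.ne')
    exact ⟨-(u₁ * a.1 + u₂ * a.2.1), by linarith⟩
  have hTcard : T.card * f.natAbs ≤ 3 * Y := by
    refine card_mul_le_of_pairwise_dvd_sub (by omega) hfY ?_ ?_
    · intro c hc
      obtain ⟨a, ha, rfl⟩ := Finset.mem_image.1 hc
      exact (hV a ha).2.2.1
    · intro c hc d hd
      rw [Int.natAbs_dvd]
      exact dvd_sub (hdvd c hc) (hdvd d hd)
  have hfib : ∀ c ∈ T, (V.filter fun a => a.2.2 = c).card ≤ 3 * Y / u₁.natAbs := by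
    intro c _
    rw [Nat.le_div_iff_mul_le (by omega)]
    have himg : ((V.filter fun a => a.2.2 = c).image fun a => a.2.1).card =
        (V.filter fun a => a.2.2 = c).card := by
      apply Finset.card_image_of_injOn
      intro a ha b hb hab
      obtain ⟨ha1, ha2⟩ := Finset.mem_filter.1 ha
      obtain ⟨hb1, hb2⟩ := Finset.mem_filter.1 hb
      have h1 := (hV a ha1).2.2.2
      have h2 := (hV b hb1).2.2.2
      dsimp only at hab
      rw [ha2, hab] at h1
      rw [hb2] at h2
      have h3 : m₁ * a.1 = m₁ * b.1 := by linarith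
      exact Prod.ext (mul_left_cancel₀ hm h3) (Prod.ext hab (ha2.trans hb2.symm))
    rw [← himg]
    refine card_mul_le_of_pairwise_dvd_sub (by omega) huY ?_ ?_
    · intro x hx
      obtain ⟨a, ha, rfl⟩ := Finset.mem_image.1 hx
      exact (hV a (Finset.mem_filter.1 ha).1).2.1
    · intro x hx y hy
      obtain ⟨a, ha, rfl⟩ := Finset.mem_image.1 hx
      obtain ⟨b, hb, rfl⟩ := Finset.mem_image.1 hy
      obtain ⟨ha1, ha2⟩ := Finset.mem_filter.1 ha
      obtain ⟨hb1, hb2⟩ := Finset.mem_filter.1 hb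
      have h1 := (hV a ha1).2.2.2
      have h2 := (hV b hb1).2.2.2
      rw [ha2, e1, e2] at h1
      rw [hb2, e1, e2] at h2
      rw [Int.natAbs_dvd]
      have hcop : IsCoprime u₁ u₂ := Int.isCoprime_iff_gcd_eq_one.2 hu
      apply hcop.dvd_of_dvd_mul_left
      have h5 : (e : ℤ) * (u₁ * (a.1 - b.1) + u₂ * (a.2.1 - b.2.1)) = 0 := by linarith
      have h6 := (mul_eq_zero.1 h5).resolve_left (by exact_mod_cast he0.ne')
      exact ⟨-(a.1 - b.1), by linarith⟩
  have hVcard : V.card ≤ T.card * (3 * Y / u₁.natAbs) :=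
    Finset.card_le_mul_card_image _ _ hfib |>.trans_eq (mul_comm _ _)
  calc V.card * m₁.natAbs ≤ T.card * (3 * Y / u₁.natAbs) * (u₁.natAbs * f.natAbs * h) := by
        rw [hm1]; gcongr
    _ = (T.card * f.natAbs) * (3 * Y / u₁.natAbs * u₁.natAbs) * h := by ring
    _ ≤ (3 * Y) * (3 * Y) * h :=
        Nat.mul_le_mul_right _ (Nat.mul_le_mul hTcard (Nat.div_mul_le_self _ _))
    _ = _ := by ring

/-- Integer points in a box orthogonal to two vectors. -/
theorem card_le_of_orthogonal_pair {W : Finset (Fin 4 → ℤ)} {Y : ℕ} {p q : Fin 4 → ℕ} (i : Fin 4)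
    (hpi : p i ≠ 0)
    (hmin : ∀ j : Fin 3, minorAbs (p i) (q i) (p (i.succAbove j), q (i.succAbove j)) ≠ 0 ∧
      minorAbs (p i) (q i) (p (i.succAbove j), q (i.succAbove j)) ≤ Y)
    (hW : ∀ a ∈ W, (∀ k, |a k| ≤ Y) ∧ ∑ k, a k * (p k : ℤ) = 0 ∧ ∑ k, a k * (q k : ℤ) = 0) :
    (W.card : ℝ) ≤ 9 * Y ^ 2 *
      (((Finset.univ.gcd fun j : Fin 3 =>
        minorAbs (p i) (q i) (p (i.succAbove j), q (i.succAbove j)) : ℕ) : ℝ) /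
      (Finset.univ.sup fun j : Fin 3 =>
        minorAbs (p i) (q i) (p (i.succAbove j), q (i.succAbove j)) : ℕ)) := by
  set m : Fin 3 → ℤ := fun j => (p i : ℤ) * q (i.succAbove j) - q i * p (i.succAbove j) with hm
  have hmabs : ∀ j, minorAbs (p i) (q i) (p (i.succAbove j), q (i.succAbove j)) = (m j).natAbs :=
    fun j => rfl
  simp_rw [hmabs] at hmin ⊢
  obtain ⟨j, -, hj⟩ := Finset.exists_mem_eq_sup (Finset.univ : Finset (Fin 3))
    Finset.univ_nonempty fun j => (m j).natAbs
  rw [hj]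
  have hmj : 0 < (m j).natAbs := Nat.pos_of_ne_zero (hmin j).1
  have hrel : ∀ a ∈ W, ∑ k : Fin 3, m k * a (i.succAbove k) = 0 := by
    intro a ha
    obtain ⟨_, h1, h2⟩ := hW a ha
    rw [Fin.sum_univ_succAbove _ i] at h1 h2
    have : ∑ k : Fin 3, m k * a (i.succAbove k) =
        p i * ∑ k : Fin 3, a (i.succAbove k) * (q (i.succAbove k) : ℤ) -
        q i * ∑ k : Fin 3, a (i.succAbove k) * (p (i.succAbove k) : ℤ) := by
      rw [Finset.mul_sum, Finset.mul_sum, ← Finset.sum_sub_distrib]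
      refine Finset.sum_congr rfl fun k _ => ?_
      rw [hm]; ring
    rw [this]
    linear_combination (p i : ℤ) * h2 - (q i : ℤ) * h1
  set φ : (Fin 4 → ℤ) → ℤ × ℤ × ℤ := fun a =>
    (a (i.succAbove j), a (i.succAbove (j.succAbove 0)), a (i.succAbove (j.succAbove 1))) with hφ
  have hinj : Set.InjOn φ (W : Set (Fin 4 → ℤ)) := by
    intro a ha b hb hab
    simp only [hφ, Prod.mk.injEq] at hab
    obtain ⟨h1, h2, h3⟩ := hab
    have hsucc : ∀ k : Fin 3, a (i.succAbove k) = b (i.succAbove k) := by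
      intro k
      rcases Fin.eq_self_or_eq_succAbove j k with rfl | ⟨l, rfl⟩
      · exact h1
      · fin_cases l
        · exact h2
        · exact h3
    have hi : a i = b i := by
      have s1 := (hW a ha).2.1
      have s2 := (hW b hb).2.1
      rw [Fin.sum_univ_succAbove _ i] at s1 s2
      simp_rw [hsucc] at s1
      have : a i * p i = b i * p i := by linarith
      exact mul_right_cancel₀ (by exact_mod_cast hpi) this
    funext k
    rcases Fin.eq_self_or_eq_succAbove i k with rfl | ⟨l, rfl⟩
    · exact hi
    · exact hsucc l
  have hmain := card_mul_natAbs_le_of_plane (V := W.image φ) (m₁ := m j)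
    (m₂ := m (j.succAbove 0)) (m₃ := m (j.succAbove 1)) (Y := Y) (by omega) (hmin j).2 (by
      intro x hx
      obtain ⟨a, ha, rfl⟩ := Finset.mem_image.1 hx
      have h1 := hrel a ha
      rw [Fin.sum_univ_succAbove _ j, Fin.sum_univ_two] at h1
      exact ⟨(hW a ha).1 _, (hW a ha).1 _, (hW a ha).1 _, by rw [← h1]; simp [hφ]; ring⟩)
  rw [Finset.card_image_of_injOn hinj] at hmain
  have hgcd : Int.gcd (Int.gcd (m j) (m (j.succAbove 0))) (m (j.succAbove 1)) ∣
      Finset.univ.gcd fun j => (m j).natAbs := by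
    refine Finset.dvd_gcd fun k _ => ?_
    have d1 : Int.gcd (Int.gcd (m j) (m (j.succAbove 0))) (m (j.succAbove 1)) ∣
        Int.gcd (m j) (m (j.succAbove 0)) := by
      have := Int.gcd_dvd_left ((Int.gcd (m j) (m (j.succAbove 0)) : ℕ) : ℤ) (m (j.succAbove 1))
      exact_mod_cast this
    rcases Fin.eq_self_or_eq_succAbove j k with rfl | ⟨l, rfl⟩
    · exact d1.trans (Int.natCast_dvd.1 (Int.gcd_dvd_left _ _))
    · fin_cases l
      · exact d1.trans (Int.natCast_dvd.1 (Int.gcd_dvd_right _ _))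
      · exact Int.natCast_dvd.1 (Int.gcd_dvd_right _ _)
  have hgpos : 0 < Finset.univ.gcd fun j => (m j).natAbs :=
    Nat.pos_of_dvd_of_pos (Finset.gcd_dvd (Finset.mem_univ j)) hmj
  have hle := Nat.le_of_dvd hgpos hgcd
  have hfin : W.card * (m j).natAbs ≤ 9 * Y ^ 2 * Finset.univ.gcd fun j => (m j).natAbs :=
    hmain.trans (by gcongr)
  have hmj' : (0 : ℝ) < (m j).natAbs := by exact_mod_cast hmj
  rw [← mul_div_assoc, le_div_iff₀ hmj']
  exact_mod_cast hfin

/-- Quadruples of distinct primes in `(X, 4X]`. -/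
def primeTuples (X : ℕ) : Finset (Fin 4 → ℕ) :=
  (Fintype.piFinset fun _ => primesIn X).filter Function.Injective

theorem mem_primeTuples {X : ℕ} {p : Fin 4 → ℕ} :
    p ∈ primeTuples X ↔ (∀ i, p i ∈ primesIn X) ∧ Function.Injective p := by
  simp [primeTuples]

/-- Integer points in `[-Y, Y]⁴` orthogonal to both `p` and `q`. -/
noncomputable def orthPoints (Y : ℕ) (p q : Fin 4 → ℕ) : Finset (Fin 4 → ℤ) :=
  (Fintype.piFinset fun _ => Finset.Icc (-(Y : ℤ)) Y).filter fun a =>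
    ∑ k, a k * (p k : ℤ) = 0 ∧ ∑ k, a k * (q k : ℤ) = 0

theorem minorAbs_ne_zero {p q r s : ℕ} (hp : p.Prime) (hr : r.Prime) (hq : q.Prime) (hpq : p ≠ q)
    (hpr : p ≠ r) : minorAbs p q (r, s) ≠ 0 := by
  intro h
  have h1 : ((p : ℤ) * s - q * r) = 0 := Int.natAbs_eq_zero.1 h
  have h2 : p * s = q * r := by zify; linarith
  have h3 : p ∣ q * r := ⟨s, h2.symm⟩
  rcases hp.dvd_mul.1 h3 with h4 | h4
  · exact hpq ((Nat.prime_dvd_prime_iff_eq hp hq).1 h4)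
  · exact hpr ((Nat.prime_dvd_prime_iff_eq hp hr).1 h4)

theorem minorAbs_le {X p q r s : ℕ} (hp : p ≤ 4 * X) (hq : q ≤ 4 * X) (hr : r ≤ 4 * X)
    (hs : s ≤ 4 * X) : minorAbs p q (r, s) ≤ 16 * X ^ 2 := by
  have h1 : p * s ≤ 16 * X ^ 2 := (Nat.mul_le_mul hp hs).trans_eq (by ring)
  have h2 : q * r ≤ 16 * X ^ 2 := (Nat.mul_le_mul hq hr).trans_eq (by ring)
  unfold minorAbs
  zify at h1 h2 ⊢
  have h3 : (0 : ℤ) ≤ p * s := by positivity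
  have h4 : (0 : ℤ) ≤ q * r := by positivity
  rw [abs_le]
  constructor <;> linarith

/-- The ratio of the gcd to the maximum of the `2 × 2` minors involving column `w`. -/
noncomputable def minorRatio (w : ℕ × ℕ) (z : Fin 3 → ℕ × ℕ) : ℝ :=
  ((Finset.univ.gcd fun j => minorAbs w.1 w.2 (z j) : ℕ) : ℝ) /
    (Finset.univ.sup fun j => minorAbs w.1 w.2 (z j) : ℕ)

theorem minorRatio_nonneg (w : ℕ × ℕ) (z : Fin 3 → ℕ × ℕ) : 0 ≤ minorRatio w z := by
  unfold minorRatio; positivity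

theorem card_orthPoints_le {X Y : ℕ} (hY : 16 * X ^ 2 ≤ Y) {p q : Fin 4 → ℕ}
    (hp : p ∈ primeTuples X) (hq : q ∈ primeTuples X) {i : Fin 4} (hi : p i ≠ q i) :
    ((orthPoints Y p q).card : ℝ) ≤ 9 * Y ^ 2 *
      minorRatio (p i, q i) fun j => (p (i.succAbove j), q (i.succAbove j)) := by
  obtain ⟨hp1, hp2⟩ := mem_primeTuples.1 hp
  obtain ⟨hq1, hq2⟩ := mem_primeTuples.1 hq
  have hp3 := fun i => mem_primesIn.1 (hp1 i)
  have hq3 := fun i => mem_primesIn.1 (hq1 i)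
  refine card_le_of_orthogonal_pair i (hp3 i).2.ne_zero (fun j => ⟨?_, ?_⟩) ?_
  · exact minorAbs_ne_zero (hp3 i).2 (hp3 _).2 (hq3 i).2 hi
      fun h => Fin.succAbove_ne i j (hp2 h).symm
  · exact (minorAbs_le (hp3 _).1.2 (hq3 _).1.2 (hp3 _).1.2 (hq3 _).1.2).trans hY
  · intro a ha
    obtain ⟨h1, h2, h3⟩ := Finset.mem_filter.1 ha
    refine ⟨fun k => ?_, h2, h3⟩
    have := Finset.mem_Icc.1 (Fintype.mem_piFinset.1 h1 k)
    exact abs_le.2 this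

theorem sum_minorRatio_le (X : ℕ) (i : Fin 4) :
    ∑ x ∈ (primeTuples X ×ˢ primeTuples X).filter (fun x => x.1 i ≠ x.2 i),
      minorRatio (x.1 i, x.2 i) (fun j => (x.1 (i.succAbove j), x.2 (i.succAbove j))) ≤
    ∑ w ∈ (primesIn X ×ˢ primesIn X).filter (fun w => w.1 ≠ w.2),
      ∑ z ∈ Fintype.piFinset fun _ : Fin 3 => minorPairs X w.1 w.2, minorRatio w z := by
  rw [Finset.sum_sigma']
  set Φ : (Fin 4 → ℕ) × (Fin 4 → ℕ) → (_ : ℕ × ℕ) × (Fin 3 → ℕ × ℕ) := fun x =>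
    ⟨(x.1 i, x.2 i), fun j => (x.1 (i.succAbove j), x.2 (i.succAbove j))⟩ with hΦ
  have hinj : Function.Injective Φ := by
    intro x y hxy
    simp only [hΦ, Sigma.mk.injEq, Prod.mk.injEq, heq_eq_eq] at hxy
    obtain ⟨⟨h1, h2⟩, h3⟩ := hxy
    have h4 := fun j => Prod.ext_iff.1 (congrFun h3 j)
    refine Prod.ext (funext fun k => ?_) (funext fun k => ?_)
    · rcases Fin.eq_self_or_eq_succAbove i k with rfl | ⟨l, rfl⟩
      exacts [h1, (h4 l).1]
    · rcases Fin.eq_self_or_eq_succAbove i k with rfl | ⟨l, rfl⟩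
      exacts [h2, (h4 l).2]
  have himg := Finset.sum_image (f := fun s : (_ : ℕ × ℕ) × (Fin 3 → ℕ × ℕ) => minorRatio s.1 s.2)
    (s := (primeTuples X ×ˢ primeTuples X).filter (fun x => x.1 i ≠ x.2 i)) hinj.injOn
  refine himg.symm.le.trans ?_
  refine Finset.sum_le_sum_of_subset_of_nonneg ?_ fun s _ _ => minorRatio_nonneg _ _
  intro s hs
  obtain ⟨x, hx, rfl⟩ := Finset.mem_image.1 hs
  obtain ⟨hx1, hx2⟩ := Finset.mem_filter.1 hx
  obtain ⟨hp, hq⟩ := Finset.mem_product.1 hx1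
  obtain ⟨hp1, hp2⟩ := mem_primeTuples.1 hp
  obtain ⟨hq1, hq2⟩ := mem_primeTuples.1 hq
  have hp3 := fun i => (mem_primesIn.1 (hp1 i)).2
  have hq3 := fun i => (mem_primesIn.1 (hq1 i)).2
  rw [Finset.mem_sigma]
  refine ⟨by simp only [hΦ, Finset.mem_filter, Finset.mem_product]; exact ⟨⟨hp1 i, hq1 i⟩, hx2⟩,
    Fintype.mem_piFinset.2 fun j => ?_⟩
  simp only [hΦ, minorPairs, Finset.mem_filter, Finset.mem_product]
  exact ⟨⟨hp1 _, hq1 _⟩, minorAbs_ne_zero (hp3 i) (hp3 _) (hq3 i) hx2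
      fun h => Fin.succAbove_ne i j (hp2 h).symm⟩

theorem exists_sum_card_orthPoints_le : ∃ C : ℝ, 0 < C ∧ ∀ᶠ X : ℕ in atTop, ∀ Y : ℕ,
    16 * X ^ 2 ≤ Y →
    ∑ x ∈ (primeTuples X ×ˢ primeTuples X).filter (fun x => x.1 ≠ x.2),
      ((orthPoints Y x.1 x.2).card : ℝ) ≤ C * Y ^ 2 * X ^ 6 / Real.log X ^ 8 := by
  obtain ⟨C, hC, hsum⟩ := exists_sum_gcd_div_sup_le
  refine ⟨4 * 9 * 36 * (C * 6144 ^ 3 / 16), by positivity, ?_⟩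
  filter_upwards [eventually_card_smallMinorPairs_le, eventually_ge_atTop 2] with X hX hX2 Y hY
  have hX0 : (0 : ℝ) < X := by positivity
  have hlog : 0 < Real.log X := Real.log_pos (by exact_mod_cast hX2)
  set D := (primeTuples X ×ˢ primeTuples X).filter (fun x => x.1 ≠ x.2) with hD
  have hcardP : ((primesIn X).card : ℝ) ≤ 6 * X / Real.log X := by
    rw [le_div_iff₀ hlog]
    exact card_primesIn_mul_log_le (by omega)
  have hpairs : ∀ w ∈ (primesIn X ×ˢ primesIn X).filter (fun w => w.1 ≠ w.2),
      ∑ z ∈ Fintype.piFinset fun _ : Fin 3 => minorPairs X w.1 w.2, minorRatio w z ≤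
        C * (6144 * X ^ 2 / Real.log X ^ 2) ^ 3 / (16 * X ^ 2) := by
    intro w hw
    obtain ⟨hw1, hw2⟩ := Finset.mem_filter.1 hw
    obtain ⟨hp, hq⟩ := Finset.mem_product.1 hw1
    have := hsum (minorPairs X w.1 w.2) (minorAbs w.1 w.2) (16 * X ^ 2)
      (6144 * X ^ 2 / Real.log X ^ 2) (by
        intro z hz
        obtain ⟨hz1, hz2⟩ := Finset.mem_filter.1 hz
        obtain ⟨hr, hs⟩ := Finset.mem_product.1 hz1
        exact ⟨Nat.pos_of_ne_zero hz2, minorAbs_le (mem_primesIn.1 hp).1.2 (mem_primesIn.1 hq).1.2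
          (mem_primesIn.1 hr).1.2 (mem_primesIn.1 hs).1.2⟩)
      (fun d r hd => hX w.1 hp w.2 hq hw2 d hd r)
    push_cast at this
    exact this
  have hi : ∀ i : Fin 4, ∑ x ∈ (primeTuples X ×ˢ primeTuples X).filter (fun x => x.1 i ≠ x.2 i),
      ((orthPoints Y x.1 x.2).card : ℝ) ≤ 9 * Y ^ 2 * ((6 * X / Real.log X) ^ 2 *
        (C * (6144 * X ^ 2 / Real.log X ^ 2) ^ 3 / (16 * X ^ 2))) := by
    intro i
    calc _ ≤ ∑ x ∈ (primeTuples X ×ˢ primeTuples X).filter (fun x => x.1 i ≠ x.2 i),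
          9 * (Y : ℝ) ^ 2 * minorRatio (x.1 i, x.2 i)
            (fun j => (x.1 (i.succAbove j), x.2 (i.succAbove j))) := by
          refine Finset.sum_le_sum fun x hx => ?_
          obtain ⟨hx1, hx2⟩ := Finset.mem_filter.1 hx
          obtain ⟨hp, hq⟩ := Finset.mem_product.1 hx1
          exact card_orthPoints_le hY hp hq hx2
      _ ≤ 9 * (Y : ℝ) ^ 2 * ∑ w ∈ (primesIn X ×ˢ primesIn X).filter (fun w => w.1 ≠ w.2),
            ∑ z ∈ Fintype.piFinset fun _ : Fin 3 => minorPairs X w.1 w.2, minorRatio w z := by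
          rw [← Finset.mul_sum]
          exact mul_le_mul_of_nonneg_left (sum_minorRatio_le X i) (by positivity)
      _ ≤ _ := by
          refine mul_le_mul_of_nonneg_left ?_ (by positivity)
          refine (Finset.sum_le_card_nsmul _ _ _ hpairs).trans ?_
          rw [nsmul_eq_mul]
          refine mul_le_mul_of_nonneg_right ?_ (by positivity)
          have h1 : (((primesIn X ×ˢ primesIn X).filter (fun w => w.1 ≠ w.2)).card : ℝ) ≤
              ((primesIn X).card : ℝ) ^ 2 := by
            rw [sq]
            exact_mod_cast (Finset.card_filter_le _ _).trans_eq (Finset.card_product _ _)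
          exact h1.trans (pow_le_pow_left₀ (by positivity) hcardP 2)
  calc _ ≤ ∑ i : Fin 4, ∑ x ∈ (primeTuples X ×ˢ primeTuples X).filter (fun x => x.1 i ≠ x.2 i),
        ((orthPoints Y x.1 x.2).card : ℝ) := by
        simp_rw [hD, Finset.sum_filter]
        rw [Finset.sum_comm]
        refine Finset.sum_le_sum fun x _ => ?_
        have hnonneg : ∀ i : Fin 4,
            0 ≤ if x.1 i ≠ x.2 i then ((orthPoints Y x.1 x.2).card : ℝ) else 0 := by
          intro i; positivity
        split_ifs with h
        · obtain ⟨i, hi⟩ := Function.ne_iff.1 h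
          refine le_trans ?_ (Finset.single_le_sum (fun i _ => hnonneg i) (Finset.mem_univ i))
          rw [if_pos hi]
        · exact Finset.sum_nonneg fun i _ => hnonneg i
    _ ≤ ∑ _i : Fin 4, 9 * (Y : ℝ) ^ 2 * ((6 * X / Real.log X) ^ 2 *
        (C * (6144 * X ^ 2 / Real.log X ^ 2) ^ 3 / (16 * X ^ 2))) :=
        Finset.sum_le_sum fun i _ => hi i
    _ = _ := by
        rw [Finset.sum_const, Finset.card_univ, Fintype.card_fin, nsmul_eq_mul]
        field_simp
        norm_num [mul_comm]

theorem sum_Icc_two_inv_sq_le {m : ℕ} (hm : 2 ≤ m) :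
    ∑ n ∈ Finset.Icc 2 m, 1 / (n : ℝ) ^ 2 ≤ 3 / 4 - 1 / (m : ℝ) := by
  induction m, hm using Nat.le_induction with
  | base => norm_num
  | succ m hm ih =>
    rw [Finset.sum_Icc_succ_top (by omega)]
    have hm0 : (0 : ℝ) < m := by positivity
    have h : 1 / ((m + 1 : ℕ) : ℝ) ^ 2 ≤ 1 / m - 1 / (m + 1 : ℕ) := by
      push_cast
      rw [div_sub_div _ _ hm0.ne' (by positivity), div_le_div_iff₀ (by positivity) (by positivity)]
      nlinarith
    linarith

theorem card_not_coprime_le (B : ℕ) :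
    (((Finset.Ioc 0 B ×ˢ Finset.Ioc 0 B).filter fun z => ¬ Nat.Coprime z.1 z.2).card : ℝ) ≤
      3 / 4 * B ^ 2 := by
  rcases lt_or_ge B 2 with hB | hB
  · have : (Finset.Ioc 0 B ×ˢ Finset.Ioc 0 B).filter (fun z => ¬ Nat.Coprime z.1 z.2) = ∅ := by
      interval_cases B <;> decide
    rw [this]; simp
  have hsub : (Finset.Ioc 0 B ×ˢ Finset.Ioc 0 B).filter (fun z => ¬ Nat.Coprime z.1 z.2) ⊆
      (Finset.Icc 2 B).biUnion fun n =>
        (Finset.Ioc 0 B).filter (n ∣ ·) ×ˢ (Finset.Ioc 0 B).filter (n ∣ ·) := by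
    intro z hz
    obtain ⟨hz1, hz2⟩ := Finset.mem_filter.1 hz
    obtain ⟨hx, hy⟩ := Finset.mem_product.1 hz1
    have hx' := Finset.mem_Ioc.1 hx
    rw [Finset.mem_biUnion]
    refine ⟨Nat.gcd z.1 z.2, ?_, ?_⟩
    · have h1 : 0 < Nat.gcd z.1 z.2 := Nat.gcd_pos_of_pos_left _ hx'.1
      have h2 := Nat.gcd_le_left z.2 hx'.1
      have h3 : Nat.gcd z.1 z.2 ≠ 1 := hz2
      rw [Finset.mem_Icc]
      omega
    · simp only [Finset.mem_product, Finset.mem_filter]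
      exact ⟨⟨hx, Nat.gcd_dvd_left _ _⟩, hy, Nat.gcd_dvd_right _ _⟩
  have h1 := (Finset.card_le_card hsub).trans Finset.card_biUnion_le
  simp_rw [Finset.card_product, Nat.Ioc_filter_dvd_card_eq_div] at h1
  calc _ ≤ ((∑ n ∈ Finset.Icc 2 B, B / n * (B / n) : ℕ) : ℝ) := by exact_mod_cast h1
    _ ≤ ∑ n ∈ Finset.Icc 2 B, (B : ℝ) ^ 2 * (1 / (n : ℝ) ^ 2) := by
        push_cast
        refine Finset.sum_le_sum fun n _ => ?_
        have h2 : ((B / n : ℕ) : ℝ) ≤ B / n := Nat.cast_div_le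
        calc _ ≤ (B / n : ℝ) * (B / n) := by gcongr
          _ = _ := by ring
    _ = (B : ℝ) ^ 2 * ∑ n ∈ Finset.Icc 2 B, 1 / (n : ℝ) ^ 2 := (Finset.mul_sum _ _ _).symm
    _ ≤ (B : ℝ) ^ 2 * (3 / 4) := by
        have := sum_Icc_two_inv_sq_le hB
        have h3 : (0 : ℝ) ≤ 1 / B := by positivity
        gcongr; linarith
    _ = _ := by ring

/-- Coprime pairs `(x, y)` in `[1, B]²` with `q ∤ x` and `p ∤ y`. -/
def coprimePairs (B p q : ℕ) : Finset (ℕ × ℕ) :=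
  (Finset.Ioc 0 B ×ˢ Finset.Ioc 0 B).filter fun z =>
    Nat.Coprime z.1 z.2 ∧ ¬ q ∣ z.1 ∧ ¬ p ∣ z.2

theorem le_card_coprimePairs {X B p q : ℕ} (hX : 16 ≤ X) (hp : X ≤ p) (hq : X ≤ q) :
    (B : ℝ) ^ 2 / 8 ≤ (coprimePairs B p q).card := by
  set I := Finset.Ioc 0 B with hI
  have hcover : I ×ˢ I ⊆ coprimePairs B p q ∪
      (((I ×ˢ I).filter fun z => ¬ Nat.Coprime z.1 z.2) ∪
        (I.filter (q ∣ ·) ×ˢ I ∪ I ×ˢ I.filter (p ∣ ·))) := by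
    intro z hz
    have hz' := Finset.mem_product.1 hz
    simp only [coprimePairs, Finset.mem_union, Finset.mem_filter, Finset.mem_product, ← hI]
    tauto
  have h1 := (Finset.card_le_card hcover).trans (Finset.card_union_le _ _)
  have h2 := Finset.card_union_le ((I ×ˢ I).filter fun z => ¬ Nat.Coprime z.1 z.2)
    (I.filter (q ∣ ·) ×ˢ I ∪ I ×ˢ I.filter (p ∣ ·))
  have h3 := Finset.card_union_le (I.filter (q ∣ ·) ×ˢ I) (I ×ˢ I.filter (p ∣ ·))
  have h4 := card_not_coprime_le B
  have hIc : I.card = B := by simp [hI]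
  rw [Finset.card_product, Finset.card_product, hIc, Nat.Ioc_filter_dvd_card_eq_div,
    Nat.Ioc_filter_dvd_card_eq_div] at h3
  rw [Finset.card_product, hIc] at h1
  have h5 : ∀ r : ℕ, X ≤ r → ((B / r : ℕ) : ℝ) * B ≤ B ^ 2 / 16 := by
    intro r hr
    have h6 : ((B / r : ℕ) : ℝ) ≤ B / r := Nat.cast_div_le
    have h7 : (16 : ℝ) ≤ r := by exact_mod_cast hX.trans hr
    calc ((B / r : ℕ) : ℝ) * B ≤ (B / r) * B := by gcongr
      _ ≤ (B / 16) * B := by gcongr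
      _ = _ := by ring
  have h8 : ((B * B : ℕ) : ℝ) ≤ (coprimePairs B p q).card +
      (((I ×ˢ I).filter fun z => ¬ Nat.Coprime z.1 z.2).card + (((B / q : ℕ) : ℝ) * B +
        ((B / p : ℕ) : ℝ) * B)) := by
    have : B * B ≤ (coprimePairs B p q).card +
      (((I ×ˢ I).filter fun z => ¬ Nat.Coprime z.1 z.2).card + (B / q * B + B / p * B)) := by
      rw [mul_comm (B / p)]; omega
    exact_mod_cast this
  have h9 := h5 p hp
  have h10 := h5 q hq
  push_cast at h8
  linarith

/-- The coefficient vectors for which `p` will be used as a small prime solution. -/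
noncomputable def goodPoints (B : ℕ) (p : Fin 4 → ℕ) : Finset (Fin 4 → ℤ) :=
  (Fintype.piFinset fun _ => Finset.Icc (-((16 * B : ℕ) : ℤ)) ((16 * B : ℕ) : ℤ)).filter fun a =>
    ∑ k, a k * (p k : ℤ) = 0 ∧ (0 < a 1 ∧ a 1 ≤ B) ∧ (0 < a 2 ∧ a 2 ≤ B) ∧
      (B < a 3 ∧ a 3 ≤ 2 * B) ∧ IsCoprime (a 1) (a 2) ∧ ¬ (p 1 : ℤ) ∣ a 2 ∧ ¬ (p 2 : ℤ) ∣ a 1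

theorem le_card_Ioc_filter_dvd (B n : ℕ) (hn : 0 < n) (m c : ℤ) (hm : IsCoprime m n) :
    B / n ≤ ((Finset.Ioc (B : ℤ) (2 * B)).filter fun x => (n : ℤ) ∣ m * x + c).card := by
  obtain ⟨u, v, huv⟩ := hm
  have hn' : (0 : ℤ) < n := by exact_mod_cast hn
  set r : ℤ := (-(u * c) - (B + 1)) % n with hr
  have hr0 : 0 ≤ r := Int.emod_nonneg _ hn'.ne'
  have hrn : r < n := Int.emod_lt_of_pos _ hn'
  have hmaps : ∀ t ∈ Finset.range (B / n), ((B : ℤ) + 1 + r + n * t) ∈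
      (Finset.Ioc (B : ℤ) (2 * B)).filter fun x => (n : ℤ) ∣ m * x + c := by
    intro t ht
    have ht' : t + 1 ≤ B / n := Finset.mem_range.1 ht
    have h1 : (t + 1) * n ≤ B := (Nat.mul_le_mul_right _ ht').trans (Nat.div_mul_le_self _ _)
    zify at h1
    rw [Finset.mem_filter, Finset.mem_Ioc]
    refine ⟨⟨by nlinarith [mul_nonneg hn'.le (Int.natCast_nonneg t)], by nlinarith⟩, ?_⟩
    have h2 := Int.emod_add_mul_ediv (-(u * c) - (B + 1)) n
    rw [← hr] at h2
    refine ⟨v * c + m * t - m * ((-(u * c) - (B + 1)) / n), ?_⟩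
    linear_combination m * h2 - c * huv
  have := Finset.card_le_card_of_injOn _ hmaps (by
    intro s _ t _ hst
    have h3 : (n : ℤ) * s = n * t := by
      have : (B : ℤ) + 1 + r + n * s = B + 1 + r + n * t := hst
      linarith
    exact_mod_cast mul_left_cancel₀ hn'.ne' h3)
  rwa [Finset.card_range] at this

theorem le_card_goodPoints {X B : ℕ} (hX : 16 ≤ X) (hB : 4 * X ≤ B) {p : Fin 4 → ℕ}
    (hp : p ∈ primeTuples X) : (B : ℝ) ^ 3 / (64 * X) ≤ (goodPoints B p).card := by
  obtain ⟨hp1, hp2⟩ := mem_primeTuples.1 hp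
  have hp3 := fun i => mem_primesIn.1 (hp1 i)
  have hp0 : (0 : ℤ) < p 0 := by have := (hp3 0).1.1; omega
  have hcop : IsCoprime (p 3 : ℤ) (p 0 : ℤ) :=
    Nat.isCoprime_iff_coprime.2 ((Nat.coprime_primes (hp3 3).2 (hp3 0).2).2
      fun h => absurd (hp2 h) (by decide))
  have hfib : ∀ z ∈ coprimePairs B (p 1) (p 2), B / p 0 ≤
      ((goodPoints B p).filter fun a => (a 1, a 2) = ((z.1 : ℤ), (z.2 : ℤ))).card := by
    intro z hz
    obtain ⟨hz1, hz2, hz3, hz4⟩ := Finset.mem_filter.1 hz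
    obtain ⟨hx, hy⟩ := Finset.mem_product.1 hz1
    rw [Finset.mem_Ioc] at hx hy
    refine (le_card_Ioc_filter_dvd B (p 0) (by omega) (p 3) (z.1 * p 1 + z.2 * p 2) hcop).trans ?_
    refine Finset.card_le_card_of_injOn
      (fun x => ![-((p 3 * x + (z.1 * p 1 + z.2 * p 2)) / p 0), z.1, z.2, x]) ?_ ?_
    · intro x hx'
      obtain ⟨hx1, d, hd⟩ := Finset.mem_filter.1 hx'
      rw [Finset.mem_Ioc] at hx1
      simp only [hd, Int.mul_ediv_cancel_left _ hp0.ne', Finset.mem_coe, Finset.mem_filter,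
        goodPoints, Fintype.mem_piFinset]
      have hub : d ≤ 16 * B := by
        have e1 : (p 3 : ℤ) * x ≤ 4 * X * (2 * B) := by
          have := (hp3 3).1.2; zify at this; exact mul_le_mul this hx1.2 (by omega) (by positivity)
        have e2 : (z.1 : ℤ) * p 1 ≤ B * (4 * X) := by
          have := (hp3 1).1.2; zify at this; have := hx.2; gcongr
        have e3 : (z.2 : ℤ) * p 2 ≤ B * (4 * X) := by
          have := (hp3 2).1.2; zify at this; have := hy.2; gcongr
        have e4 : (X : ℤ) < p 0 := by exact_mod_cast (hp3 0).1.1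
        by_contra hcon
        push Not at hcon
        have e5 : (p 0 : ℤ) * d ≤ 16 * B * X := by rw [← hd]; linarith
        have e6 : (X : ℤ) * (16 * B) < p 0 * d := by
          apply mul_lt_mul e4 hcon.le (by omega) (by omega)
        linarith
      have hlb : 0 ≤ d := by
        have : 0 ≤ (p 0 : ℤ) * d := by
          rw [← hd]
          have : 0 ≤ x := by omega
          positivity
        exact nonneg_of_mul_nonneg_right this hp0
      refine ⟨⟨fun i => ?_, ?_, ?_, ?_, ?_, ?_, ?_, ?_⟩, ?_⟩
      · rw [Finset.mem_Icc]
        fin_cases i <;> simp <;> omega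
      · simp [Fin.sum_univ_four]
        linarith
      · simp; omega
      · simp; omega
      · simp; omega
      · simpa using Nat.isCoprime_iff_coprime.2 hz2
      · simpa using by exact_mod_cast hz4
      · simpa using by exact_mod_cast hz3
      · simp
    · intro x _ y _ hxy
      have := congrFun hxy 3
      simpa using this
  have hcard : (coprimePairs B (p 1) (p 2)).card * (B / p 0) ≤ (goodPoints B p).card := by
    have hmaps : Set.MapsTo (fun a : Fin 4 → ℤ => ((a 1).toNat, (a 2).toNat)) (goodPoints B p)
        (coprimePairs B (p 1) (p 2)) := by
      intro a ha
      obtain ⟨_, _, h1, h2, _, h4, h5, h6⟩ := Finset.mem_filter.1 ha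
      obtain ⟨x, hx⟩ := Int.eq_ofNat_of_zero_le h1.1.le
      obtain ⟨y, hy⟩ := Int.eq_ofNat_of_zero_le h2.1.le
      rw [hx] at h1 h4 h6
      rw [hy] at h2 h4 h5
      simp only [hx, hy, Int.toNat_natCast, coprimePairs, Finset.mem_coe, Finset.mem_filter,
        Finset.mem_product, Finset.mem_Ioc]
      exact ⟨⟨by omega, by omega⟩, Nat.isCoprime_iff_coprime.1 h4, by exact_mod_cast h6,
        by exact_mod_cast h5⟩
    rw [Finset.card_eq_sum_card_fiberwise hmaps, ← smul_eq_mul]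
    refine Finset.card_nsmul_le_sum _ _ _ fun z hz => (hfib z hz).trans ?_
    refine Finset.card_le_card fun a ha => ?_
    obtain ⟨h1, h2⟩ := Finset.mem_filter.1 ha
    rw [Prod.mk.injEq] at h2
    rw [Finset.mem_filter]
    exact ⟨h1, by simp [h2.1, h2.2]⟩
  have h1 := le_card_coprimePairs (B := B) hX (hp3 1).1.1.le (hp3 2).1.1.le
  have hX0 : (0 : ℝ) < X := by positivity
  have h2 : (B : ℝ) / (8 * X) ≤ ((B / p 0 : ℕ) : ℝ) := by
    have h3 : 1 ≤ B / p 0 := by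
      rw [Nat.le_div_iff_mul_le (by omega)]; have := (hp3 0).1.2; omega
    have h4 : B < p 0 * (B / p 0 + 1) := Nat.lt_mul_div_succ _ (by omega)
    have h5 : B ≤ 8 * X * (B / p 0) := by
      calc B ≤ p 0 * (B / p 0 + 1) := h4.le
        _ ≤ 4 * X * (B / p 0 + B / p 0) := Nat.mul_le_mul (hp3 0).1.2 (by omega)
        _ = _ := by ring
    rw [div_le_iff₀ (by positivity), mul_comm]
    exact_mod_cast h5
  calc (B : ℝ) ^ 3 / (64 * X) = (B : ℝ) ^ 2 / 8 * (B / (8 * X)) := by field_simp; norm_num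
    _ ≤ (coprimePairs B (p 1) (p 2)).card * ((B / p 0 : ℕ) : ℝ) := by gcongr
    _ ≤ _ := by exact_mod_cast hcard

theorem eventually_le_card_primeTuples :
    ∀ᶠ X : ℕ in atTop, (X : ℝ) ^ 4 / (256 * Real.log X ^ 4) ≤ (primeTuples X).card := by
  have hlim : ∀ᶠ X : ℕ in atTop, 12 * Real.log X ≤ X := by
    have h1 := (Real.isLittleO_log_id_atTop.comp_tendsto tendsto_natCast_atTop_atTop).bound
      (show (0 : ℝ) < 1 / 12 by norm_num)
    filter_upwards [h1, eventually_ge_atTop 1] with X hX hX1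
    have h2 : 0 ≤ Real.log X := Real.log_natCast_nonneg X
    simp only [Function.comp_apply, id_eq, Real.norm_eq_abs, abs_of_nonneg h2, Nat.abs_cast] at hX
    linarith
  filter_upwards [eventually_le_card_primesIn_mul_log, hlim, eventually_ge_atTop 2]
    with X h1 h2 h3
  have hlog : 0 < Real.log X := Real.log_pos (by exact_mod_cast h3)
  set N := (primesIn X).card with hN
  have hN6 : 6 ≤ N := by
    have h4 : 6 * (2 * Real.log X) ≤ N * (2 * Real.log X) := by linarith
    exact_mod_cast le_of_mul_le_mul_right h4 (by positivity)
  have hcard : N.descFactorial 4 ≤ (primeTuples X).card := by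
    have : Fintype.card (Fin 4 ↪ primesIn X) = N.descFactorial 4 := by
      rw [Fintype.card_embedding_eq]; simp [hN]
    rw [← this, ← Finset.card_univ]
    refine Finset.card_le_card_of_injOn (fun e i => (e i : ℕ)) ?_ ?_
    · intro e _
      exact mem_primeTuples.2 ⟨fun i => (e i).2, fun i j h => e.injective (Subtype.ext h)⟩
    · intro e _ f _ h
      exact DFunLike.ext _ _ fun i => Subtype.ext (congrFun h i)
  have h4 := (Nat.pow_sub_le_descFactorial N 4).trans hcard
  have h5 : (N : ℝ) / 2 ≤ ((N + 1 - 4 : ℕ) : ℝ) := by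
    have : N ≤ 2 * (N + 1 - 4) := by omega
    rw [div_le_iff₀ two_pos, mul_comm]
    exact_mod_cast this
  have h6 : X / (2 * Real.log X) ≤ N := by rw [div_le_iff₀ (by positivity)]; linarith
  calc (X : ℝ) ^ 4 / (256 * Real.log X ^ 4) = (X / (2 * Real.log X) / 2) ^ 4 := by
        field_simp; norm_num
    _ ≤ ((N + 1 - 4 : ℕ) : ℝ) ^ 4 := by gcongr; linarith
    _ ≤ _ := by exact_mod_cast h4

theorem exists_units_sum_eq_zero {F : Type*} [Field F] (h2 : (2 : F) ≠ 0) (c : Fin 4 → F)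
    {i j : Fin 4} (hij : i ≠ j) (hi : c i ≠ 0) (hj : c j ≠ 0) :
    ∃ x : Fin 4 → Fˣ, ∑ k, c k * (x k : F) = 0 := by
  set s : F := ∑ k ∈ (Finset.univ.erase j).erase i, c k with hs
  obtain ⟨u, hu⟩ : ∃ u : Fˣ, c i * u + s ≠ 0 := by
    by_cases h : c i + s = 0
    · refine ⟨Units.mk0 2 h2, fun h3 => hi ?_⟩
      rw [Units.val_mk0] at h3
      linear_combination h3 - h
    · exact ⟨1, by simpa using h⟩
  refine ⟨Function.update (Function.update (fun _ => (1 : Fˣ)) i u) j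
    (Units.mk0 (-(c i * u + s) / c j) (div_ne_zero (neg_ne_zero.2 hu) hj)), ?_⟩
  rw [← Finset.add_sum_erase Finset.univ _ (Finset.mem_univ j),
    ← Finset.add_sum_erase (Finset.univ.erase j) _
      (Finset.mem_erase.2 ⟨hij, Finset.mem_univ i⟩)]
  have hrest : ∑ k ∈ (Finset.univ.erase j).erase i, c k *
      ((Function.update (Function.update (fun _ => (1 : Fˣ)) i u) j
        (Units.mk0 (-(c i * u + s) / c j) (div_ne_zero (neg_ne_zero.2 hu) hj)) k : Fˣ) : F) = s := by
    refine Finset.sum_congr rfl fun k hk => ?_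
    have h1 := Finset.mem_erase.1 hk
    have h3 := Finset.mem_erase.1 h1.2
    rw [Function.update_of_ne h3.1, Function.update_of_ne h1.1]
    simp
  rw [hrest, Function.update_self, Function.update_of_ne hij, Function.update_self,
    Units.val_mk0]
  field_simp
  ring

section GoodPoints

variable {X B : ℕ} {p : Fin 4 → ℕ} {a : Fin 4 → ℤ}

theorem goodPoints_apply_zero_neg (hp : p ∈ primeTuples X) (ha : a ∈ goodPoints B p) :
    a 0 < 0 := by
  obtain ⟨_, h0, h1, h2, h3, _⟩ := Finset.mem_filter.1 ha
  have hp3 := fun i => (mem_primesIn.1 ((mem_primeTuples.1 hp).1 i)).2.pos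
  rw [Fin.sum_univ_four] at h0
  have e0 : (0 : ℤ) < p 0 := by exact_mod_cast hp3 0
  have e1 : (0 : ℤ) < p 1 := by exact_mod_cast hp3 1
  have e2 : (0 : ℤ) < p 2 := by exact_mod_cast hp3 2
  have e3 : (0 : ℤ) < p 3 := by exact_mod_cast hp3 3
  have f1 := mul_pos h1.1 e1
  have f2 := mul_pos h2.1 e2
  have f3 := mul_pos (show 0 < a 3 by omega) e3
  exact neg_of_mul_neg_left (by linarith : a 0 * p 0 < 0) e0.le

theorem isPrimitive_of_mem_goodPoints (hp : p ∈ primeTuples X) (ha : a ∈ goodPoints B p) :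
    IsPrimitive a := by
  have h0 := goodPoints_apply_zero_neg hp ha
  obtain ⟨_, _, h1, h2, h3, h4, _⟩ := Finset.mem_filter.1 ha
  refine ⟨fun i => ?_, ?_⟩
  · fin_cases i <;> simp <;> omega
  · have hg1 : Finset.univ.gcd a ∣ a 1 := Finset.gcd_dvd (Finset.mem_univ _)
    have hg2 : Finset.univ.gcd a ∣ a 2 := Finset.gcd_dvd (Finset.mem_univ _)
    have hu := h4.isUnit_of_dvd' hg1 hg2
    rw [← Finset.normalize_gcd]
    exact normalize_eq_one.2 hu

theorem isLocSolv_of_mem_goodPoints (hX : 2 ≤ X) (hp : p ∈ primeTuples X)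
    (ha : a ∈ goodPoints B p) : IsLocSolv a := by
  have h0 := goodPoints_apply_zero_neg hp ha
  have hprim := isPrimitive_of_mem_goodPoints hp ha
  obtain ⟨_, hsum, h1, h2, h3, h4, h5, h6⟩ := Finset.mem_filter.1 ha
  obtain ⟨hp1, hp2⟩ := mem_primeTuples.1 hp
  have hp3 := fun i => mem_primesIn.1 (hp1 i)
  refine ⟨hprim, ?_, fun l hl => ?_⟩
  · rintro (h | h)
    · exact absurd (h 0) (by omega)
    · exact absurd (h 1) (by omega)
  have : Fact l.Prime := ⟨hl⟩
  have hsum' : ∑ k, (a k : ZMod l) * (p k : ZMod l) = 0 := by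
    have := congrArg (Int.cast : ℤ → ZMod l) hsum
    push_cast at this
    exact this
  rcases hl.eq_two_or_odd' with rfl | hodd
  · refine ⟨fun _ => 1, ?_⟩
    rw [← hsum']
    refine Finset.sum_congr rfl fun k _ => ?_
    have hk : Odd (p k) := (hp3 k).2.odd_of_ne_two (by have := (hp3 k).1.1; omega)
    rw [ZMod.natCast_eq_one_iff_odd.2 hk, Units.val_one]
  have h20 : (2 : ZMod l) ≠ 0 := by
    intro h
    have : ((2 : ℕ) : ZMod l) = 0 := by exact_mod_cast h
    rw [ZMod.natCast_eq_zero_iff, Nat.prime_dvd_prime_iff_eq hl Nat.prime_two] at this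
    subst this
    exact absurd hodd (by decide)
  have honly : ∀ i, (∀ k, k ≠ i → (a k : ZMod l) = 0) → (a i : ZMod l) ≠ 0 → l = p i := by
    intro i hi hne
    rw [Finset.sum_eq_single i (fun k _ hk => by rw [hi k hk, zero_mul])
      (fun h => absurd (Finset.mem_univ i) h)] at hsum'
    have := (mul_eq_zero.1 hsum').resolve_left hne
    rw [ZMod.natCast_eq_zero_iff] at this
    exact (Nat.prime_dvd_prime_iff_eq hl (hp3 i).2).1 this
  have hnot : ¬ ((a 1 : ZMod l) = 0 ∧ (a 2 : ZMod l) = 0) := by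
    rintro ⟨e1, e2⟩
    rw [ZMod.intCast_zmod_eq_zero_iff_dvd] at e1 e2
    have := h4.isUnit_of_dvd' e1 e2
    exact (Nat.prime_iff_prime_int.1 hl).not_isUnit this
  obtain ⟨i, hi, hi'⟩ : ∃ i : Fin 4, (a i : ZMod l) ≠ 0 ∧
      ((∀ k, k ≠ i → (a k : ZMod l) = 0) → False) := by
    by_cases e1 : (a 1 : ZMod l) = 0
    · have e2 : (a 2 : ZMod l) ≠ 0 := fun h => hnot ⟨e1, h⟩
      refine ⟨2, e2, fun h => h6 ?_⟩
      rw [← honly 2 h e2]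
      exact (ZMod.intCast_zmod_eq_zero_iff_dvd _ _).1 e1
    · refine ⟨1, e1, fun h => h5 ?_⟩
      rw [← honly 1 h e1]
      exact (ZMod.intCast_zmod_eq_zero_iff_dvd _ _).1 (h 2 (by decide))
  obtain ⟨j, hj⟩ := not_forall.1 hi'
  obtain ⟨hij, hj'⟩ := Classical.not_imp.1 hj
  exact exists_units_sum_eq_zero h20 _ hij hj' hi

theorem le_snorm_of_mem_goodPoints (ha : a ∈ goodPoints B p) : B ≤ snorm a := by
  obtain ⟨_, _, _, _, h3, _⟩ := Finset.mem_filter.1 ha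
  have := Finset.le_sup (f := fun i => (a i).natAbs) (Finset.mem_univ (3 : Fin 4))
  unfold snorm
  omega

theorem znorm_le_of_mem_goodPoints (ha : a ∈ goodPoints B p) : znorm a ≤ 64 * B := by
  have h := Fintype.mem_piFinset.1 (Finset.mem_filter.1 ha).1
  refine Real.sqrt_le_iff.2 ⟨by positivity, ?_⟩
  have h1 : ∀ i, (a i : ℝ) ^ 2 ≤ (16 * B) ^ 2 := by
    intro i
    have h2 := Finset.mem_Icc.1 (h i)
    have h3 : |(a i : ℝ)| ≤ 16 * B := by
      have := abs_le.2 h2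
      exact_mod_cast this
    exact sq_le_sq' (abs_le.1 h3).1 (abs_le.1 h3).2
  refine (Finset.sum_le_card_nsmul _ _ _ fun i _ => h1 i).trans ?_
  simp
  nlinarith [sq_nonneg (B : ℝ)]

theorem mfrak_le_of_mem_goodPoints (hp : p ∈ primeTuples X) (ha : a ∈ goodPoints B p) :
    mfrak a ≤ (4 * X : ℕ) := by
  have hp3 := fun i => mem_primesIn.1 ((mem_primeTuples.1 hp).1 i)
  refine (iInf₂_le p ⟨fun i => (hp3 i).2, (Finset.mem_filter.1 ha).2.1⟩).trans ?_
  exact_mod_cast Finset.sup_le fun i _ => (hp3 i).1.2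

end GoodPoints

theorem sq_sum_card_le_card_biUnion_mul {ι α : Type*} [DecidableEq α] (S : Finset ι)
    (E : ι → Finset α) :
    (∑ p ∈ S, (E p).card) ^ 2 ≤
      (S.biUnion E).card * ∑ x ∈ S ×ˢ S, (E x.1 ∩ E x.2).card := by
  set U := S.biUnion E with hU
  have hcard : ∀ F : Finset α, F ⊆ U → ∑ a ∈ U, (if a ∈ F then 1 else 0) = F.card := by
    intro F hF
    rw [← Finset.sum_filter, Finset.sum_const, smul_eq_mul, mul_one,
      Finset.filter_mem_eq_inter, Finset.inter_eq_right.2 hF]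
  have hE : ∀ p ∈ S, E p ⊆ U := fun p hp => Finset.subset_biUnion_of_mem E hp
  have h1 : ∑ p ∈ S, (E p).card = ∑ a ∈ U, ∑ p ∈ S, if a ∈ E p then 1 else 0 := by
    rw [Finset.sum_comm]
    exact Finset.sum_congr rfl fun p hp => (hcard _ (hE p hp)).symm
  have h2 : ∑ x ∈ S ×ˢ S, (E x.1 ∩ E x.2).card =
      ∑ a ∈ U, (∑ p ∈ S, if a ∈ E p then 1 else 0) ^ 2 := by
    simp_rw [sq, Finset.sum_mul_sum, ← Finset.sum_product' S S]
    rw [Finset.sum_comm]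
    refine Finset.sum_congr rfl fun x hx => ?_
    rw [← hcard _ (Finset.inter_subset_left.trans (hE x.1 (Finset.mem_product.1 hx).1))]
    refine Finset.sum_congr rfl fun a _ => ?_
    by_cases e1 : a ∈ E x.1 <;> by_cases e2 : a ∈ E x.2 <;> simp [e1, e2]
  rw [h1, h2]
  exact sq_sum_le_card_mul_sum_sq

theorem inter_goodPoints_subset (B : ℕ) (p q : Fin 4 → ℕ) :
    goodPoints B p ∩ goodPoints B q ⊆ orthPoints (16 * B) p q := by
  intro a ha
  obtain ⟨h1, h2⟩ := Finset.mem_inter.1 ha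
  obtain ⟨e1, e2, _⟩ := Finset.mem_filter.1 h1
  obtain ⟨_, f2, _⟩ := Finset.mem_filter.1 h2
  exact Finset.mem_filter.2 ⟨e1, e2, f2⟩

theorem eventually_log_pow_four_le : ∀ᶠ X : ℕ in atTop, Real.log X ^ 4 ≤ X := by
  have h1 := ((Real.isLittleO_pow_log_id_atTop (n := 4)).comp_tendsto
    tendsto_natCast_atTop_atTop).bound one_pos
  filter_upwards [h1] with X hX
  simp only [Function.comp_apply, id_eq, Real.norm_eq_abs, Nat.abs_cast, one_mul] at hX
  exact (le_abs_self _).trans hX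

theorem exists_le_card_biUnion_goodPoints : ∃ c : ℝ, 0 < c ∧ ∀ᶠ X : ℕ in atTop, ∀ B : ℕ,
    (X : ℝ) ^ 3 ≤ B * Real.log X ^ 4 → (B : ℝ) * Real.log X ^ 4 ≤ 8 * X ^ 3 →
    c * (B : ℝ) ^ 4 ≤ ((primeTuples X).biUnion (goodPoints B)).card := by
  obtain ⟨C, hC, hoff⟩ := exists_sum_card_orthPoints_le
  set K : ℝ := 256 * 16384 * C with hK
  refine ⟨1 / (131072 * (1 + K)), by positivity, ?_⟩
  filter_upwards [hoff, eventually_log_pow_four_le, eventually_le_card_primeTuples, eventually_ge_atTop 16]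
    with X hoff hlim hS hX16 B hB1 hB2
  have hX0 : (0 : ℝ) < X := by positivity
  have hlog : 0 < Real.log X := Real.log_pos (by exact_mod_cast (by omega : 1 < X))
  have hXB : X ^ 2 ≤ B := by
    have h1 : (X : ℝ) ^ 2 * X ≤ B * X := by
      calc (X : ℝ) ^ 2 * X = X ^ 3 := by ring
        _ ≤ B * Real.log X ^ 4 := hB1
        _ ≤ B * X := by gcongr
    exact_mod_cast le_of_mul_le_mul_right h1 hX0
  have h4B : 4 * X ≤ B := by nlinarith
  have hB0 : (0 : ℝ) < B := by exact_mod_cast (by omega : 0 < B)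
  set S := primeTuples X with hSdef
  set M : ℝ := ((∑ p ∈ S, (goodPoints B p).card : ℕ) : ℝ) with hM
  have hMlow : (X : ℝ) ^ 3 * B ^ 3 / (16384 * Real.log X ^ 4) ≤ M := by
    have h1 : S.card • ((B : ℝ) ^ 3 / (64 * X)) ≤ ∑ p ∈ S, ((goodPoints B p).card : ℝ) :=
      Finset.card_nsmul_le_sum _ _ _ fun p hp => le_card_goodPoints hX16 h4B hp
    rw [nsmul_eq_mul] at h1
    calc (X : ℝ) ^ 3 * B ^ 3 / (16384 * Real.log X ^ 4)
        = (X : ℝ) ^ 4 / (256 * Real.log X ^ 4) * ((B : ℝ) ^ 3 / (64 * X)) := by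
          field_simp; norm_num
      _ ≤ S.card * ((B : ℝ) ^ 3 / (64 * X)) := by gcongr
      _ ≤ M := by rw [hM]; push_cast; exact h1
  have hMpos : 0 < M := lt_of_lt_of_le (by positivity) hMlow
  have hsq := sq_sum_card_le_card_biUnion_mul S (goodPoints B)
  have hsecond : ((∑ x ∈ S ×ˢ S, (goodPoints B x.1 ∩ goodPoints B x.2).card : ℕ) : ℝ) ≤
      (1 + K) * M := by
    rw [← Finset.sum_filter_add_sum_filter_not (S ×ˢ S) (fun x => x.1 = x.2)]
    have hdiag : ∑ x ∈ (S ×ˢ S).filter (fun x => x.1 = x.2),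
        (goodPoints B x.1 ∩ goodPoints B x.2).card = ∑ p ∈ S, (goodPoints B p).card := by
      rw [Finset.sum_filter, Finset.sum_product]
      refine Finset.sum_congr rfl fun p hp => ?_
      simp [Finset.sum_ite_eq, hp]
    have hrest : ((∑ x ∈ (S ×ˢ S).filter (fun x => ¬ x.1 = x.2),
        (goodPoints B x.1 ∩ goodPoints B x.2).card : ℕ) : ℝ) ≤ K * M := by
      have h1 := hoff (16 * B) (by omega)
      push_cast at h1 ⊢
      calc _ ≤ ∑ x ∈ (S ×ˢ S).filter (fun x => ¬ x.1 = x.2),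
            ((orthPoints (16 * B) x.1 x.2).card : ℝ) :=
            Finset.sum_le_sum fun x _ => by
              exact_mod_cast Finset.card_le_card (inter_goodPoints_subset B x.1 x.2)
        _ ≤ C * (16 * B) ^ 2 * X ^ 6 / Real.log X ^ 8 := h1
        _ = C * 256 * B ^ 2 * X ^ 3 / Real.log X ^ 8 * X ^ 3 := by ring
        _ ≤ C * 256 * B ^ 2 * X ^ 3 / Real.log X ^ 8 * (B * Real.log X ^ 4) := by gcongr
        _ = K * ((X : ℝ) ^ 3 * B ^ 3 / (16384 * Real.log X ^ 4)) := by
            rw [hK]; field_simp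
        _ ≤ K * M := by gcongr
    rw [hdiag]
    push_cast at hrest ⊢
    rw [hM]
    push_cast
    rw [hM] at hrest
    push_cast at hrest
    linarith
  set U := S.biUnion (goodPoints B) with hU
  have hfin : M ≤ U.card * (1 + K) := by
    have h1 : M ^ 2 ≤ U.card * ((1 + K) * M) := by
      refine le_trans ?_ (mul_le_mul_of_nonneg_left hsecond (Nat.cast_nonneg _))
      rw [hM]
      exact_mod_cast hsq
    have h2 : M * M ≤ U.card * (1 + K) * M := by linarith
    exact le_of_mul_le_mul_right h2 hMpos
  have hMB : (B : ℝ) ^ 4 / 131072 ≤ M := by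
    refine le_trans ?_ hMlow
    rw [div_le_div_iff₀ (by norm_num) (by positivity)]
    calc (B : ℝ) ^ 4 * (16384 * Real.log X ^ 4) = 16384 * (B : ℝ) ^ 3 * (B * Real.log X ^ 4) := by ring
      _ ≤ 16384 * (B : ℝ) ^ 3 * (8 * X ^ 3) := by gcongr
      _ = _ := by ring
  rw [div_mul_eq_mul_div, one_mul, div_le_iff₀ (by positivity)]
  rw [div_le_iff₀ (by norm_num)] at hMB
  linarith

open Classical in
/-- The largest `X ≤ B` with `X³ ≤ B (log X)⁴`. -/
noncomputable def primeScale (B : ℕ) : ℕ :=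
  Nat.findGreatest (fun X : ℕ => (X : ℝ) ^ 3 ≤ B * Real.log X ^ 4) B

theorem primeScale_le (B : ℕ) : primeScale B ≤ B := Nat.findGreatest_le _

theorem primeScale_pow_le (B : ℕ) :
    (primeScale B : ℝ) ^ 3 ≤ B * Real.log (primeScale B) ^ 4 := by
  classical
  exact Nat.findGreatest_spec (P := fun X : ℕ => (X : ℝ) ^ 3 ≤ B * Real.log X ^ 4)
    (Nat.zero_le B) (by simp)

theorem tendsto_primeScale : Tendsto primeScale atTop atTop := by
  classical
  refine tendsto_atTop.2 fun K => ?_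
  have hlog : 0 < Real.log (K + 2 : ℕ) := Real.log_pos (by exact_mod_cast (by omega : 1 < K + 2))
  filter_upwards [eventually_ge_atTop (K + 2),
    (tendsto_natCast_atTop_atTop (R := ℝ)).eventually_ge_atTop
      (((K + 2 : ℕ) : ℝ) ^ 3 / Real.log (K + 2 : ℕ) ^ 4)] with B hB1 hB2
  rw [div_le_iff₀ (by positivity)] at hB2
  have : K + 2 ≤ primeScale B := Nat.le_findGreatest hB1 hB2
  omega

theorem eventually_mul_log_primeScale_le :
    ∀ᶠ B : ℕ in atTop, (B : ℝ) * Real.log (primeScale B) ^ 4 ≤ 8 * (primeScale B : ℝ) ^ 3 := by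
  classical
  filter_upwards [tendsto_primeScale.eventually eventually_log_pow_four_le,
    tendsto_primeScale.eventually_ge_atTop 2] with B h1 h2
  have hP := primeScale_pow_le B
  set X := primeScale B with hX
  have hX0 : (0 : ℝ) < X := by positivity
  have hXB : X ^ 2 ≤ B := by
    have h3 : (X : ℝ) ^ 2 * X ≤ B * X := by
      calc (X : ℝ) ^ 2 * X = X ^ 3 := by ring
        _ ≤ B * Real.log X ^ 4 := hP
        _ ≤ B * X := by gcongr
    exact_mod_cast le_of_mul_le_mul_right h3 hX0
  have hlt : X + 1 ≤ B := by nlinarith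
  have hnot : ¬ (((X + 1 : ℕ) : ℝ) ^ 3 ≤ B * Real.log (X + 1 : ℕ) ^ 4) :=
    Nat.findGreatest_is_greatest (P := fun X : ℕ => (X : ℝ) ^ 3 ≤ B * Real.log X ^ 4)
      (Nat.lt_succ_self X) hlt
  rw [not_le] at hnot
  have hlog0 : 0 ≤ Real.log X := Real.log_natCast_nonneg X
  have hlog : Real.log X ≤ Real.log (X + 1 : ℕ) :=
    Real.log_le_log hX0 (by push_cast; linarith)
  calc (B : ℝ) * Real.log X ^ 4 ≤ B * Real.log (X + 1 : ℕ) ^ 4 := by gcongr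
    _ ≤ ((X + 1 : ℕ) : ℝ) ^ 3 := hnot.le
    _ ≤ ((2 * X : ℕ) : ℝ) ^ 3 := by gcongr; omega
    _ = _ := by push_cast; ring

theorem smallSol_of_mfrak_le {X B : ℕ} {a : Fin 4 → ℤ} (hX : 0 < X) (hXB : X ≤ B)
    (hpow : (X : ℝ) ^ 3 ≤ B * Real.log X ^ 4) (hB : Real.exp (Real.exp 64) ≤ B)
    (hs : B ≤ snorm a) (hm : mfrak a ≤ (4 * X : ℕ)) : SmallSol a := by
  unfold SmallSol
  have hXr : (0 : ℝ) < X := by exact_mod_cast hX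
  have hXB' : (X : ℝ) ≤ B := by exact_mod_cast hXB
  have hs' : (B : ℝ) ≤ snorm a := by exact_mod_cast hs
  have hB0 : (0 : ℝ) < B := hXr.trans_le hXB'
  have hlogX : 0 ≤ Real.log X := Real.log_natCast_nonneg X
  have h1 : Real.log X ≤ Real.log (snorm a) := Real.log_le_log hXr (hXB'.trans hs')
  have h2 : Real.exp 64 ≤ Real.log (snorm a) :=
    (Real.le_log_iff_exp_le (hB0.trans_le hs')).2 (hB.trans hs')
  have h3 : 64 ≤ Real.log (Real.log (snorm a)) :=
    (Real.le_log_iff_exp_le ((Real.exp_pos _).trans_le h2)).2 h2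
  have h4 : ((64 * X ^ 3 : ℕ) : ℝ) ≤ (snorm a : ℝ) * Real.log (snorm a) ^ 4 *
      Real.log (Real.log (snorm a)) := by
    push_cast
    calc (64 : ℝ) * X ^ 3 ≤ 64 * (B * Real.log X ^ 4) := by gcongr
      _ = B * Real.log X ^ 4 * 64 := by ring
      _ ≤ _ := by gcongr
  calc mfrak a ^ 3 ≤ ((4 * X : ℕ) : ℝ≥0∞) ^ 3 := by gcongr
    _ = ((64 * X ^ 3 : ℕ) : ℝ≥0∞) := by rw [← Nat.cast_pow]; congr 1; ring
    _ = ENNReal.ofReal ((64 * X ^ 3 : ℕ) : ℝ) := (ENNReal.ofReal_natCast _).symm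
    _ ≤ _ := ENNReal.ofReal_le_ofReal h4

theorem abs_le_znorm (a : Fin 4 → ℤ) (i : Fin 4) : |(a i : ℝ)| ≤ znorm a := by
  refine Real.abs_le_sqrt ?_
  exact Finset.single_le_sum (f := fun i => ((a i : ℝ)) ^ 2) (fun i _ => sq_nonneg _)
    (Finset.mem_univ i)

theorem LSet_subset_box (A : ℝ) :
    LSet A ⊆ (Fintype.piFinset fun _ : Fin 4 => Finset.Icc (-(⌊A⌋₊ : ℤ)) ⌊A⌋₊ :
      Finset (Fin 4 → ℤ)) := by
  intro a ha
  rw [Finset.mem_coe, Fintype.mem_piFinset]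
  intro i
  have h1 := (abs_le_znorm a i).trans ha.2
  rw [Finset.mem_Icc, ← abs_le]
  have h2 : (((a i).natAbs : ℕ) : ℝ) ≤ A := by
    rw [Nat.cast_natAbs]; push_cast; exact h1
  rw [Int.abs_eq_natAbs]
  exact_mod_cast Nat.le_floor h2

theorem finite_LSet (A : ℝ) : (LSet A).Finite :=
  (Finset.finite_toSet _).subset (LSet_subset_box A)

theorem ncard_LSet_le {A : ℝ} (hA : 1 ≤ A) : ((LSet A).ncard : ℝ) ≤ 81 * A ^ 4 := by
  have h1 := Set.ncard_le_ncard (LSet_subset_box A) (Finset.finite_toSet _)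
  rw [Set.ncard_coe_finset, Fintype.card_piFinset_const, Int.card_Icc] at h1
  have h2 : ((⌊A⌋₊ : ℤ) + 1 - -(⌊A⌋₊ : ℤ)).toNat = 2 * ⌊A⌋₊ + 1 := by omega
  rw [h2] at h1
  have h3 : (⌊A⌋₊ : ℝ) ≤ A := Nat.floor_le (by linarith)
  calc ((LSet A).ncard : ℝ) ≤ ((2 * ⌊A⌋₊ + 1) ^ 4 : ℕ) := by exact_mod_cast h1
    _ = (2 * (⌊A⌋₊ : ℝ) + 1) ^ 4 := by push_cast; ring
    _ ≤ (3 * A) ^ 4 := by gcongr; linarith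
    _ = _ := by ring

/-- Corollary: a positive proportion of `a ∈ 𝕃(A)` are locally solvable with a small
prime solution. -/
theorem small_solutions_positive_proportion :
    0 < Filter.liminf
      (fun A : ℝ =>
        (Set.ncard {a | a ∈ LlocSet A ∧ SmallSol a} : ℝ) / (Set.ncard (LSet A) : ℝ))
      Filter.atTop := by
  obtain ⟨c, hc, hcount⟩ := exists_le_card_biUnion_goodPoints
  have hsub : ∀ A : ℝ, {a | a ∈ LlocSet A ∧ SmallSol a} ⊆ LSet A :=
    fun A a ha => ⟨ha.1.1.1, ha.1.2⟩
  have hbdd : IsBoundedUnder (· ≤ ·) atTop (fun A : ℝ =>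
      (Set.ncard {a | a ∈ LlocSet A ∧ SmallSol a} : ℝ) / (Set.ncard (LSet A) : ℝ)) := by
    refine isBoundedUnder_of ⟨1, fun A => div_le_one_of_le₀ ?_ (Nat.cast_nonneg _)⟩
    exact_mod_cast Set.ncard_le_ncard (hsub A) (finite_LSet A)
  refine lt_of_lt_of_le (show 0 < c / (81 * 128 ^ 4) by positivity)
    (le_liminf_of_le hbdd.isCoboundedUnder_ge ?_)
  have hfloor : Tendsto (fun A : ℝ => ⌊A / 64⌋₊) atTop atTop :=
    tendsto_nat_floor_atTop.comp (tendsto_id.atTop_div_const (by norm_num))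
  filter_upwards [hfloor.eventually (tendsto_primeScale.eventually hcount),
    hfloor.eventually eventually_mul_log_primeScale_le,
    hfloor.eventually (tendsto_primeScale.eventually_ge_atTop 2),
    hfloor.eventually ((tendsto_natCast_atTop_atTop (R := ℝ)).eventually_ge_atTop
      (Real.exp (Real.exp 64))),
    eventually_ge_atTop 128] with A h1 h2 h3 h4 h5
  set B := ⌊A / 64⌋₊ with hB
  have hBA : 64 * (B : ℝ) ≤ A := by
    have := Nat.floor_le (show 0 ≤ A / 64 by positivity)
    rw [← hB] at this
    linarith
  have hAB : A / 128 ≤ B := by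
    have := Nat.lt_floor_add_one (A / 64)
    rw [← hB] at this
    linarith
  set U := (primeTuples (primeScale B)).biUnion (goodPoints B) with hU
  have hUsub : (U : Set (Fin 4 → ℤ)) ⊆ {a | a ∈ LlocSet A ∧ SmallSol a} := by
    intro a ha
    obtain ⟨p, hp, hap⟩ := Finset.mem_biUnion.1 ha
    exact ⟨⟨isLocSolv_of_mem_goodPoints h3 hp hap, (znorm_le_of_mem_goodPoints hap).trans hBA⟩,
      smallSol_of_mfrak_le (by omega) (primeScale_le B) (primeScale_pow_le B) h4
        (le_snorm_of_mem_goodPoints hap) (mfrak_le_of_mem_goodPoints hp hap)⟩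
  have hlow : c * (B : ℝ) ^ 4 ≤ Set.ncard {a | a ∈ LlocSet A ∧ SmallSol a} := by
    refine (h1 B (primeScale_pow_le B) h2).trans ?_
    have := Set.ncard_le_ncard hUsub ((finite_LSet A).subset (hsub A))
    rw [Set.ncard_coe_finset] at this
    exact_mod_cast this
  have hA0 : 0 < A := by linarith
  have hpos : (0 : ℝ) < Set.ncard (LSet A) := by
    have hle : (Set.ncard {a | a ∈ LlocSet A ∧ SmallSol a} : ℝ) ≤ Set.ncard (LSet A) := by
      exact_mod_cast Set.ncard_le_ncard (hsub A) (finite_LSet A)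
    have hB0 : (0 : ℝ) < B := lt_of_lt_of_le (by positivity) hAB
    exact lt_of_lt_of_le (by positivity) (hlow.trans hle)
  rw [le_div_iff₀ hpos]
  calc c / (81 * 128 ^ 4) * Set.ncard (LSet A) ≤ c / (81 * 128 ^ 4) * (81 * A ^ 4) := by
        gcongr
        exact ncard_LSet_le (by linarith)
    _ = c * (A / 128) ^ 4 := by ring
    _ ≤ c * (B : ℝ) ^ 4 := by gcongr
    _ ≤ _ := hlow
end

section
/- Let N ≥ 1 be an integer and R ∈ {2,…,N}. Let Λ ⊂ ℝ^N be a primitive integral lattice of rank R and let Y ≥ λ_R(Λ). Then for all real T ≥ Y, #(Λ ∩ ℤ^N_prim ∩ 𝓑_N(T)) = (V_R/ζ(R))·T^R/det(Λ)·(1 + O(Y·log T/T)) + O(T), where the implied constants depend only on R. -/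
open MeasureTheory

noncomputable section

/-- Euclidean norm on `ℝ^N`. -/
def rnorm {N : ℕ} (x : Fin N → ℝ) : ℝ := Real.sqrt (∑ k, x k ^ 2)

/-- Coordinatewise cast of an integer vector to a real vector. -/
def intCast' {N : ℕ} (v : Fin N → ℤ) : Fin N → ℝ := fun k => (v k : ℝ)

/-- The `i`-th successive minimum of the integral lattice spanned by `b`:
`λ_i(Λ) = inf{u > 0 : dim Span_ℝ(Λ ∩ 𝓑_N(u)) ≥ i}`. -/
def succMin (N R : ℕ) (b : Fin R → (Fin N → ℤ)) (i : ℕ) : ℝ :=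
  sInf {u : ℝ | 0 < u ∧ i ≤ Module.finrank ℝ (Submodule.span ℝ
    {x : Fin N → ℝ | (∃ v ∈ Submodule.span ℤ (Set.range b), x = intCast' v) ∧ rnorm x < u})}

/-- The determinant `√(det(BᵀB))` of the lattice with basis matrix `B` (columns `b i`);
this is independent of the choice of basis of the lattice. -/
def latDet (N R : ℕ) (b : Fin R → (Fin N → ℤ)) : ℝ :=
  Real.sqrt (Matrix.det (Matrix.of fun i j : Fin R => ∑ k, (b i k : ℝ) * (b j k : ℝ)))

/-- `V_R`: the volume of the unit ball in `ℝ^R`. -/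
def VR (R : ℕ) : ℝ := (volume (Metric.ball (0 : EuclideanSpace ℝ (Fin R)) 1)).toReal

/-- `ζ(R)` for an integer `R ≥ 2`. -/
def zetaVal (R : ℕ) : ℝ := ∑' n : ℕ, (1 : ℝ) / (n + 1) ^ R

open Finset in
lemma summable_moebius_div_pow {R : ℕ} (hR : 2 ≤ R) :
    Summable fun d : ℕ => (ArithmeticFunction.moebius d : ℝ) / (d : ℝ) ^ R := by
  refine Summable.of_norm_bounded (Real.summable_one_div_nat_pow.2 (by lia : 1 < R)) fun d => ?_
  rw [norm_div, Real.norm_eq_abs, Real.norm_eq_abs, abs_of_nonneg (by positivity : 0 ≤ (d : ℝ) ^ R)]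
  gcongr
  exact_mod_cast ArithmeticFunction.abs_moebius_le_one

lemma ofReal_zetaVal {R : ℕ} (hR : 2 ≤ R) : ((zetaVal R : ℝ) : ℂ) = riemannZeta R := by
  have h := zeta_eq_tsum_one_div_nat_add_one_cpow (s := (R : ℂ)) (by simp; lia)
  rw [h, zetaVal, Complex.ofReal_tsum]
  simp

lemma zetaVal_pos {R : ℕ} (hR : 2 ≤ R) : 0 < zetaVal R := by
  have h : Summable fun n : ℕ => (1 : ℝ) / (n + 1) ^ R := by
    have := (summable_nat_add_iff 1).2 (Real.summable_one_div_nat_pow.2 (by lia : 1 < R))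
    simpa using this
  exact h.tsum_pos (fun n => by positivity) 0 (by simp)

lemma tsum_moebius_div_pow {R : ℕ} (hR : 2 ≤ R) :
    ∑' d : ℕ, (ArithmeticFunction.moebius d : ℝ) / (d : ℝ) ^ R = 1 / zetaVal R := by
  have hre : 1 < (R : ℂ).re := by simp; lia
  have h := ArithmeticFunction.LSeries_zeta_mul_Lseries_moebius hre
  rw [ArithmeticFunction.LSeries_zeta_eq_riemannZeta hre, ← ofReal_zetaVal hR] at h
  have h2 : LSeries (fun n => ((ArithmeticFunction.moebius n : ℤ) : ℂ)) R =
      ((∑' d : ℕ, (ArithmeticFunction.moebius d : ℝ) / (d : ℝ) ^ R : ℝ) : ℂ) := by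
    rw [LSeries, Complex.ofReal_tsum]
    refine tsum_congr fun d => ?_
    rcases eq_or_ne d 0 with rfl | hd
    · simp
    · rw [LSeries.term_of_ne_zero hd]; simp
  rw [h2] at h
  rw [eq_div_iff (zetaVal_pos hR).ne', mul_comm]
  exact_mod_cast h

open Finset in
lemma abs_sum_moebius_div_pow_sub_le {R : ℕ} (hR : 2 ≤ R) (M : ℕ) :
    |∑ d ∈ Icc 1 M, (ArithmeticFunction.moebius d : ℝ) / (d : ℝ) ^ R - 1 / zetaVal R| ≤
      2 / (M + 1) := by
  have hs : ∑ d ∈ Icc 1 M, (ArithmeticFunction.moebius d : ℝ) / (d : ℝ) ^ R =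
      ∑ d ∈ range (M + 1), (ArithmeticFunction.moebius d : ℝ) / (d : ℝ) ^ R := by
    refine sum_subset (fun d hd => by simp at hd ⊢; lia) fun d hd hd' => ?_
    have : d = 0 := by simp at hd hd'; lia
    simp [this]
  have ht := (summable_moebius_div_pow hR).hasSum.tendsto_sum_nat
  rw [tsum_moebius_div_pow hR] at ht
  rw [hs]
  refine le_of_tendsto (ht.const_sub _).abs ?_
  filter_upwards [Filter.eventually_ge_atTop (M + 1)] with n hn
  rw [abs_sub_comm, ← sum_range_add_sum_Ico _ hn, add_sub_cancel_left]
  refine (abs_sum_le_sum_abs _ _).trans ((sum_le_sum fun d hd => ?_).trans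
    (sum_Ioo_inv_sq_le (α := ℝ) M n))
  have hd1 : (1 : ℝ) ≤ d := by
    have : 1 ≤ d := by simp at hd; lia
    exact_mod_cast this
  rw [abs_div, abs_of_nonneg (by positivity : 0 ≤ (d : ℝ) ^ R), inv_eq_one_div]
  have hmu : |(ArithmeticFunction.moebius d : ℝ)| ≤ 1 := by
    exact_mod_cast ArithmeticFunction.abs_moebius_le_one
  gcongr

open Finset in
lemma sum_moebius_of_dvd {g M : ℕ} (hg : g ≠ 0) (hM : g ≤ M) :
    ∑ d ∈ Icc 1 M, (if d ∣ g then (ArithmeticFunction.moebius d : ℝ) else 0) =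
      if g = 1 then 1 else 0 := by
  rw [← sum_filter]
  have hf : (Icc 1 M).filter (· ∣ g) = g.divisors := by
    ext d
    simp only [mem_filter, mem_Icc, Nat.mem_divisors]
    constructor
    · rintro ⟨-, h⟩; exact ⟨h, hg⟩
    · rintro ⟨h, -⟩
      exact ⟨⟨Nat.pos_of_dvd_of_pos h (by lia), (Nat.le_of_dvd (by lia) h).trans hM⟩, h⟩
  have h := congrArg (fun f : ArithmeticFunction ℤ => f g) ArithmeticFunction.moebius_mul_coe_zeta
  simp only [ArithmeticFunction.coe_mul_zeta_apply, ArithmeticFunction.one_apply] at h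
  rw [hf]
  exact_mod_cast h

lemma sum_inv_le_one_add_log {T : ℝ} (hT : 1 ≤ T) :
    ∑ d ∈ Finset.Icc 1 ⌊T⌋₊, ((d : ℝ))⁻¹ ≤ 1 + Real.log T := by
  have h := harmonic_le_one_add_log ⌊T⌋₊
  rw [harmonic_eq_sum_Icc] at h
  push_cast at h
  have h1 : (0 : ℝ) < ⌊T⌋₊ := by exact_mod_cast Nat.floor_pos.2 hT
  have := Real.log_le_log h1 (Nat.floor_le (by linarith))
  linarith

/-- The number of points `n` of `ℤ^R` with `q n < t`. -/
def latCount {R : ℕ} (q : Seminorm ℝ (Fin R → ℝ)) (t : ℝ) : ℕ :=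
  Set.ncard {n : Fin R → ℤ | q (intCast' n) < t}

lemma intCast'_add {R : ℕ} (m n : Fin R → ℤ) : intCast' (m + n) = intCast' m + intCast' n := by
  ext k; simp [intCast']

lemma intCast'_sub {R : ℕ} (m n : Fin R → ℤ) : intCast' (m - n) = intCast' m - intCast' n := by
  ext k; simp [intCast']

lemma intCast'_smul {R : ℕ} (c : ℤ) (n : Fin R → ℤ) : intCast' (c • n) = (c : ℝ) • intCast' n := by
  ext k; simp [intCast']

lemma volume_eq_lintegral_tsum_indicator {R : ℕ} {s : Set (Fin R → ℝ)} (hs : MeasurableSet s) :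
    volume s = ∫⁻ z in Set.univ.pi fun _ => Set.Ico (0 : ℝ) 1,
      ∑' n : Fin R → ℤ, s.indicator (1 : (Fin R → ℝ) → ENNReal) (z + intCast' n) := by
  set C : Set (Fin R → ℝ) := Set.univ.pi fun _ => Set.Ico (0 : ℝ) 1 with hC
  have hCm : MeasurableSet C := MeasurableSet.univ_pi fun _ => measurableSet_Ico
  have hmeas : ∀ n : Fin R → ℤ, Measurable fun z : Fin R → ℝ =>
      s.indicator (1 : (Fin R → ℝ) → ENNReal) (z + intCast' n) := fun n =>
    (measurable_one.indicator hs).comp (measurable_id.add_const _)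
  have hfl : ∀ (n : Fin R → ℤ) (y : Fin R → ℝ), y - intCast' n ∈ C ↔ (fun k => ⌊y k⌋) = n := by
    intro n y
    simp only [hC, Set.mem_univ_pi, Set.mem_Ico, Pi.sub_apply, intCast', funext_iff,
      Int.floor_eq_iff]
    refine forall_congr' fun k => ?_
    constructor <;> rintro ⟨h1, h2⟩ <;> constructor <;> linarith
  rw [lintegral_tsum fun n => (hmeas n).aemeasurable]
  have hU : s = ⋃ n : Fin R → ℤ, s ∩ (fun y => y + intCast' (-n)) ⁻¹' C := by
    ext y
    simp only [Set.mem_iUnion, Set.mem_inter_iff, Set.mem_preimage, exists_and_left]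
    refine ⟨fun h => ⟨h, fun k => ⌊y k⌋, ?_⟩, fun h => h.1⟩
    have := (hfl (fun k => ⌊y k⌋) y).2 rfl
    rwa [sub_eq_add_neg, show -intCast' (fun k => ⌊y k⌋) = intCast' (-fun k => ⌊y k⌋) from by
      ext k; simp [intCast']] at this
  have hneg : ∀ n : Fin R → ℤ, intCast' (-n) = -intCast' n := fun n => by ext k; simp [intCast']
  conv_lhs => rw [hU]
  rw [measure_iUnion]
  · refine tsum_congr fun n => ?_
    have h1 : ∀ z : Fin R → ℝ, s.indicator (1 : (Fin R → ℝ) → ENNReal) (z + intCast' n) =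
        ((fun z => z + intCast' n) ⁻¹' s).indicator 1 z := fun z => rfl
    simp_rw [h1]
    have hms : MeasurableSet ((fun z => z + intCast' n) ⁻¹' s) := measurable_id.add_const _ hs
    rw [lintegral_indicator_one hms, Measure.restrict_apply hms,
      ← measure_preimage_add_right volume (intCast' n)
        (s ∩ (fun y => y + intCast' (-n)) ⁻¹' C)]
    congr 1
    ext z
    simp [hneg]
  · intro m n hmn
    refine Set.disjoint_left.2 fun y hy hy' => hmn ?_
    simp only [Set.mem_inter_iff, Set.mem_preimage, hneg, ← sub_eq_add_neg] at hy hy'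
    rw [← (hfl m y).1 hy.2, (hfl n y).1 hy'.2]
  · intro n
    exact hs.inter (measurable_id.add_const _ hCm)

lemma tsum_indicator_eq_ncard {α : Type*} {s : Set α} (hs : s.Finite) :
    ∑' n : α, s.indicator (1 : α → ENNReal) n = (s.ncard : ENNReal) := by
  rw [← tsum_subtype s (1 : α → ENNReal)]
  simp only [Pi.one_apply, ENNReal.tsum_one]
  rw [ENat.card_coe_set_eq, ← hs.cast_ncard_eq]
  simp

lemma indicator_one_le_indicator_one {α β : Type*} {s : Set α} {t : Set β} {a : α} {b : β}
    (h : a ∈ s → b ∈ t) :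
    s.indicator (1 : α → ENNReal) a ≤ t.indicator (1 : β → ENNReal) b := by
  by_cases ha : a ∈ s
  · simp [ha, h ha]
  · simp [ha]

lemma latCount_le_volume_le_latCount {R : ℕ} {q : Seminorm ℝ (Fin R → ℝ)} (hq : Continuous q)
    (hfin : ∀ t, {n : Fin R → ℤ | q (intCast' n) < t}.Finite) {D : ℝ}
    (hD : ∀ y : Fin R → ℝ, ∃ n : Fin R → ℤ, q (y - intCast' n) ≤ D) (t : ℝ) :
    (latCount q (t - D) : ENNReal) ≤ volume {y | q y < t} ∧
      volume {y | q y < t} ≤ latCount q (t + D) := by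
  have hs : MeasurableSet {y | q y < t} := (isOpen_lt hq continuous_const).measurableSet
  have hvol : volume (Set.univ.pi fun _ : Fin R => Set.Ico (0 : ℝ) 1) = 1 := by
    simp [volume_pi_pi]
  have hconst : ∀ c : ENNReal,
      c = ∫⁻ _ in Set.univ.pi fun _ : Fin R => Set.Ico (0 : ℝ) 1, c := fun c => by
    rw [lintegral_const, Measure.restrict_apply_univ, hvol, mul_one]
  have key : ∀ z : Fin R → ℝ,
      (latCount q (t - D) : ENNReal) ≤ ∑' n : Fin R → ℤ,
        {y | q y < t}.indicator (1 : (Fin R → ℝ) → ENNReal) (z + intCast' n) ∧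
      ∑' n : Fin R → ℤ, {y | q y < t}.indicator (1 : (Fin R → ℝ) → ENNReal) (z + intCast' n) ≤
        latCount q (t + D) := by
    intro z
    obtain ⟨m, hm⟩ := hD z
    rw [← (Equiv.subRight m).tsum_eq, latCount, latCount, ← tsum_indicator_eq_ncard (hfin _),
      ← tsum_indicator_eq_ncard (hfin _)]
    simp only [Equiv.subRight_apply, intCast'_sub]
    constructor
    · refine ENNReal.tsum_le_tsum fun n => indicator_one_le_indicator_one fun hn => ?_
      have := map_add_le_add q (intCast' n) (z - intCast' m)
      rw [show intCast' n + (z - intCast' m) = z + (intCast' n - intCast' m) by abel] at this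
      simp only [Set.mem_ofPred_eq] at hn ⊢
      linarith
    · refine ENNReal.tsum_le_tsum fun n => indicator_one_le_indicator_one fun hn => ?_
      have := map_sub_le_add q (z + (intCast' n - intCast' m)) (z - intCast' m)
      rw [show z + (intCast' n - intCast' m) - (z - intCast' m) = intCast' n by abel] at this
      simp only [Set.mem_ofPred_eq] at hn ⊢
      linarith
  rw [volume_eq_lintegral_tsum_indicator hs]
  constructor
  · rw [hconst (latCount q (t - D))]
    exact lintegral_mono fun z => (key z).1
  · rw [hconst (latCount q (t + D))]
    exact lintegral_mono fun z => (key z).2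

lemma add_one_mul_latCount_le {R : ℕ} {q : Seminorm ℝ (Fin R → ℝ)}
    (hfin : ∀ t, {n : Fin R → ℤ | q (intCast' n) < t}.Finite) {t : ℝ} {x : Fin R → ℤ}
    (hx : 0 < q (intCast' x)) (hxt : q (intCast' x) < t) (K : ℕ) :
    (K + 1) * latCount q t ≤ latCount q ((4 * K + 1) * t) := by
  have ht : 0 < t := hx.trans hxt
  obtain ⟨z, hz1, hz2⟩ : ∃ z : Fin R → ℤ, t ≤ 2 * q (intCast' z) ∧ q (intCast' z) < t := by
    set a := q (intCast' x)
    have h1 : 1 < t / a := (one_lt_div hx).2 hxt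
    have hc := Int.ceil_lt_add_one (t / a)
    have hc' := Int.le_ceil (t / a)
    have hc2 : (1 : ℤ) + 1 ≤ ⌈t / a⌉ := Int.lt_ceil.2 (by simpa using h1)
    have hc3 : (2 : ℝ) ≤ ⌈t / a⌉ := by exact_mod_cast hc2
    refine ⟨(⌈t / a⌉ - 1) • x, ?_, ?_⟩ <;>
      rw [intCast'_smul, map_smul_eq_mul, Real.norm_eq_abs] <;> push_cast <;>
      rw [abs_of_nonneg (by linarith)]
    · have : t / a ≤ 2 * (⌈t / a⌉ - 1) := by linarith
      rw [div_le_iff₀ hx] at this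
      linarith
    · rw [← lt_div_iff₀ hx]; linarith
  have hcard : ((Set.univ : Set (Fin (K + 1))) ×ˢ {n : Fin R → ℤ | q (intCast' n) < t}).ncard =
      (K + 1) * latCount q t := by
    rw [Set.ncard_prod, Set.ncard_univ, Nat.card_fin, latCount]
  rw [← hcard]
  refine Set.ncard_le_ncard_of_injOn (fun p => p.2 + (4 * (p.1 : ℕ) : ℤ) • z) ?_ ?_ (hfin _)
  · rintro ⟨k, y⟩ ⟨-, hy⟩
    simp only [Set.mem_ofPred_eq] at hy ⊢
    have h := map_add_le_add q (intCast' y) (intCast' ((4 * (k : ℕ) : ℤ) • z))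
    rw [← intCast'_add] at h
    refine h.trans_lt ?_
    rw [intCast'_smul, map_smul_eq_mul, Real.norm_eq_abs]
    push_cast
    rw [abs_of_nonneg (by positivity)]
    have hk : ((k : ℕ) : ℝ) ≤ K := by exact_mod_cast Nat.lt_succ_iff.1 k.2
    have hk0 : (0 : ℝ) ≤ (k : ℕ) := by positivity
    have : (4 * (k : ℕ) : ℝ) * q (intCast' z) ≤ 4 * K * t := by
      gcongr
    linarith
  · rintro ⟨k, y⟩ ⟨-, hy⟩ ⟨k', y'⟩ ⟨-, hy'⟩ h
    simp only [Set.mem_ofPred_eq] at hy hy' h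
    have h1 : y - y' = (4 * ((k' : ℕ) - (k : ℕ) : ℤ)) • z := by
      rw [sub_eq_iff_eq_add, mul_sub, sub_smul, sub_add_eq_add_sub, eq_sub_iff_add_eq, h, add_comm]
    have h2 := map_sub_le_add q (intCast' y) (intCast' y')
    rw [← intCast'_sub, h1, intCast'_smul, map_smul_eq_mul, Real.norm_eq_abs] at h2
    have hkk : (k : ℕ) = k' := by
      by_contra hne
      have h3 : (1 : ℤ) ≤ |((k' : ℕ) : ℤ) - (k : ℕ)| := Int.one_le_abs (by lia)
      have h4 : (1 : ℝ) ≤ |((k' : ℕ) : ℝ) - (k : ℕ)| := by exact_mod_cast h3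
      push_cast at h2
      rw [abs_mul, abs_of_pos (by norm_num : (0 : ℝ) < 4)] at h2
      have h5 : 4 * 1 * q (intCast' z) ≤ 4 * |((k' : ℕ) : ℝ) - (k : ℕ)| * q (intCast' z) := by
        gcongr
      linarith
    have : k = k' := Fin.ext hkk
    subst this
    simpa using h

lemma pow_succ_sub_pow_succ_le {a b : ℝ} (ha : 0 ≤ a) (hab : a ≤ b) (n : ℕ) :
    b ^ (n + 1) - a ^ (n + 1) ≤ (n + 1) * (b - a) * b ^ n := by
  induction n with
  | zero => simp
  | succ n ih =>
    have h1 : a ^ (n + 1) ≤ b ^ (n + 1) := by gcongr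
    have h2 := mul_le_mul_of_nonneg_left ih (ha.trans hab)
    have h3 := mul_le_mul_of_nonneg_left h1 (sub_nonneg.2 hab)
    push_cast
    calc b ^ (n + 1 + 1) - a ^ (n + 1 + 1)
        = b * (b ^ (n + 1) - a ^ (n + 1)) + (b - a) * a ^ (n + 1) := by ring
      _ ≤ b * ((n + 1) * (b - a) * b ^ n) + (b - a) * b ^ (n + 1) := by gcongr
      _ = (n + 1 + 1) * (b - a) * b ^ (n + 1) := by ring

lemma latCount_le_and_le {R : ℕ} {q : Seminorm ℝ (Fin R → ℝ)} (hq : Continuous q)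
    (hfin : ∀ t, {n : Fin R → ℤ | q (intCast' n) < t}.Finite) {D κ : ℝ} (hκ : 0 ≤ κ)
    (hD0 : 0 ≤ D) (hD : ∀ y : Fin R → ℝ, ∃ n : Fin R → ℤ, q (y - intCast' n) ≤ D)
    (hvol : ∀ t, 0 ≤ t → volume {y | q y < t} = ENNReal.ofReal (κ * t ^ R)) {t : ℝ} (ht : 0 ≤ t) :
    latCount q t ≤ κ * (t + D) ^ R ∧ (D ≤ t → κ * (t - D) ^ R ≤ latCount q t) := by
  constructor
  · have h := (latCount_le_volume_le_latCount hq hfin hD (t + D)).1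
    rw [hvol _ (by positivity), add_sub_cancel_right, ← ENNReal.ofReal_natCast,
      ENNReal.ofReal_le_ofReal_iff (by positivity)] at h
    exact h
  · intro htD
    have h := (latCount_le_volume_le_latCount hq hfin hD (t - D)).2
    rw [hvol _ (by linarith), sub_add_cancel, ← ENNReal.ofReal_natCast,
      ENNReal.ofReal_le_ofReal_iff (by positivity)] at h
    exact h

lemma abs_latCount_sub_le_of_le {r : ℕ} {q : Seminorm ℝ (Fin (r + 2) → ℝ)} (hq : Continuous q)
    (hfin : ∀ t, {n : Fin (r + 2) → ℤ | q (intCast' n) < t}.Finite) {c Y κ : ℝ} (hκ : 0 ≤ κ)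
    (hc : 0 ≤ c) (hY : 0 < Y)
    (hD : ∀ y : Fin (r + 2) → ℝ, ∃ n : Fin (r + 2) → ℤ, q (y - intCast' n) ≤ c * Y)
    (hvol : ∀ t, 0 ≤ t → volume {y | q y < t} = ENNReal.ofReal (κ * t ^ (r + 2)))
    {t : ℝ} (ht : Y ≤ t) :
    |latCount q t - κ * t ^ (r + 2)| ≤ (r + 2) * c * (1 + c) ^ (r + 1) * κ * (t ^ (r + 1) * Y) := by
  have ht0 : 0 < t := hY.trans_le ht
  have hcY : 0 ≤ c * Y := by positivity
  obtain ⟨h1, h2⟩ := latCount_le_and_le hq hfin hκ hcY hD hvol ht0.le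
  have hone : (1 : ℝ) ≤ (1 + c) ^ (r + 1) := one_le_pow₀ (by linarith)
  rw [abs_sub_le_iff]
  constructor
  · have h3 := pow_succ_sub_pow_succ_le ht0.le (by linarith : t ≤ t + c * Y) (r + 1)
    have h4 : (t + c * Y) ^ (r + 1) ≤ ((1 + c) * t) ^ (r + 1) := by
      gcongr
      nlinarith
    push_cast at h3
    calc (latCount q t : ℝ) - κ * t ^ (r + 2)
        ≤ κ * ((t + c * Y) ^ (r + 2) - t ^ (r + 2)) := by linarith
      _ ≤ κ * ((r + 1 + 1) * (t + c * Y - t) * ((1 + c) * t) ^ (r + 1)) := by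
          gcongr
          refine h3.trans ?_
          rw [add_sub_cancel_left]
          gcongr
      _ = _ := by rw [mul_pow]; ring
  · have h5 : t ^ (r + 2) - (if c * Y ≤ t then (t - c * Y) ^ (r + 2) else 0) ≤
        (r + 2) * (c * Y) * t ^ (r + 1) := by
      split_ifs with h
      · have h3 := pow_succ_sub_pow_succ_le (sub_nonneg.2 h) (by linarith : t - c * Y ≤ t) (r + 1)
        push_cast at h3
        rw [sub_sub_cancel] at h3
        linarith
      · push Not at h
        have : t * t ^ (r + 1) ≤ (c * Y) * t ^ (r + 1) := by gcongr
        have h6 : 0 ≤ (r + 1) * ((c * Y) * t ^ (r + 1)) := by positivity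
        rw [sub_zero, pow_succ']
        linarith
    have h6 : κ * (if c * Y ≤ t then (t - c * Y) ^ (r + 2) else 0) ≤ latCount q t := by
      split_ifs with h
      · exact h2 h
      · simp
    have h7 := mul_le_mul_of_nonneg_left h5 hκ
    have h8 : κ * ((r + 2) * (c * Y) * t ^ (r + 1)) * 1 ≤
        κ * ((r + 2) * (c * Y) * t ^ (r + 1)) * (1 + c) ^ (r + 1) := by gcongr
    linarith

lemma abs_latCount_sub_le_of_lt {r : ℕ} {q : Seminorm ℝ (Fin (r + 2) → ℝ)} (hq : Continuous q)
    (hfin : ∀ t, {n : Fin (r + 2) → ℤ | q (intCast' n) < t}.Finite)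
    (hpos : ∀ n : Fin (r + 2) → ℤ, n ≠ 0 → 0 < q (intCast' n)) {c Y κ : ℝ} (hκ : 0 ≤ κ)
    (hc : 0 ≤ c) (hD : ∀ y : Fin (r + 2) → ℝ, ∃ n : Fin (r + 2) → ℤ, q (y - intCast' n) ≤ c * Y)
    (hvol : ∀ t, 0 ≤ t → volume {y | q y < t} = ENNReal.ofReal (κ * t ^ (r + 2)))
    {t : ℝ} (ht0 : 0 < t) (ht : t < Y) :
    |latCount q t - κ * t ^ (r + 2)| ≤ 1 + 5 * (1 + c) ^ (r + 2) * κ * (t * Y ^ (r + 1)) := by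
  have hY : 0 < Y := ht0.trans ht
  have hone : (1 : ℝ) ≤ (1 + c) ^ (r + 2) := one_le_pow₀ (by linarith)
  have hmain : κ * t ^ (r + 2) ≤ 5 * (1 + c) ^ (r + 2) * κ * (t * Y ^ (r + 1)) := by
    have h1 : t ^ (r + 1) ≤ Y ^ (r + 1) := by gcongr
    calc κ * t ^ (r + 2) = 1 * 1 * κ * (t * t ^ (r + 1)) := by ring
      _ ≤ _ := by gcongr; norm_num
  have hup : (latCount q t : ℝ) ≤ 1 + 5 * (1 + c) ^ (r + 2) * κ * (t * Y ^ (r + 1)) := by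
    by_cases hex : ∃ x : Fin (r + 2) → ℤ, x ≠ 0 ∧ q (intCast' x) < t
    · obtain ⟨x, hx0, hxt⟩ := hex
      set K := ⌊(Y / t - 1) / 4⌋₊ with hK
      have h1t : 1 < Y / t := (one_lt_div ht0).2 ht
      have hK1 : (K : ℝ) ≤ (Y / t - 1) / 4 := Nat.floor_le (by linarith)
      have hK2 : (Y / t - 1) / 4 < K + 1 := Nat.lt_floor_add_one _
      have hK3 : Y / t ≤ 5 * (K + 1) := by
        have : (0 : ℝ) ≤ K := by positivity
        linarith
      have hK4 : (4 * K + 1) * t ≤ Y := by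
        rw [← le_div_iff₀ ht0]; linarith
      have hd := add_one_mul_latCount_le hfin (hpos x hx0) hxt K
      have hmono : latCount q ((4 * K + 1) * t) ≤ latCount q Y :=
        Set.ncard_le_ncard (fun n hn => lt_of_lt_of_le hn hK4) (hfin _)
      have hd' : ((K : ℝ) + 1) * latCount q t ≤ latCount q Y := by exact_mod_cast hd.trans hmono
      have hYc := (latCount_le_and_le hq hfin hκ (by positivity) hD hvol hY.le).1
      have hfin1 : Y / t * latCount q t ≤ 5 * (κ * (Y + c * Y) ^ (r + 2)) :=
        calc Y / t * latCount q t ≤ 5 * (K + 1) * latCount q t := by gcongr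
          _ ≤ _ := by linarith
      rw [div_mul_eq_mul_div, div_le_iff₀ ht0] at hfin1
      have : Y * latCount q t ≤ Y * (5 * (1 + c) ^ (r + 2) * κ * (t * Y ^ (r + 1))) := by
        refine hfin1.trans_eq ?_
        rw [show Y + c * Y = (1 + c) * Y by ring, mul_pow]; ring
      have := le_of_mul_le_mul_left this hY
      linarith
    · push Not at hex
      have hsub : {n : Fin (r + 2) → ℤ | q (intCast' n) < t} ⊆ {0} := fun n hn => by
        by_contra h
        exact absurd (hex n h) (not_le.2 hn)
      have h1 : latCount q t ≤ 1 := (Set.ncard_le_ncard hsub).trans (by simp)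
      have h2 : (latCount q t : ℝ) ≤ 1 := by exact_mod_cast h1
      have : 0 ≤ 5 * (1 + c) ^ (r + 2) * κ * (t * Y ^ (r + 1)) := by positivity
      linarith
  rw [abs_sub_le_iff]
  constructor
  · have : 0 ≤ κ * t ^ (r + 2) := by positivity
    linarith
  · have : (0 : ℝ) ≤ latCount q t := by positivity
    linarith

lemma abs_latCount_div_sub_le {r : ℕ} {q : Seminorm ℝ (Fin (r + 2) → ℝ)} (hq : Continuous q)
    (hfin : ∀ t, {n : Fin (r + 2) → ℤ | q (intCast' n) < t}.Finite)
    (hpos : ∀ n : Fin (r + 2) → ℤ, n ≠ 0 → 0 < q (intCast' n)) {c Y κ : ℝ} (hκ : 0 ≤ κ)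
    (hc : 0 ≤ c) (hY : 0 < Y)
    (hD : ∀ y : Fin (r + 2) → ℝ, ∃ n : Fin (r + 2) → ℤ, q (y - intCast' n) ≤ c * Y)
    (hvol : ∀ t, 0 ≤ t → volume {y | q y < t} = ENNReal.ofReal (κ * t ^ (r + 2)))
    {T : ℝ} (hT : Y ≤ T) {d : ℝ} (hd : 1 ≤ d) :
    |latCount q (T / d) - κ * (T / d) ^ (r + 2)| ≤
      1 + ((r + 2) * c * (1 + c) ^ (r + 1) + 5 * (1 + c) ^ (r + 2)) * κ *
        (T ^ (r + 1) * Y * d⁻¹) := by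
  have hT0 : 0 < T := hY.trans_le hT
  have hd0 : 0 < d := by linarith
  have ha : 0 ≤ (r + 2) * c * (1 + c) ^ (r + 1) * κ * (T ^ (r + 1) * Y * d⁻¹) := by positivity
  have hb : 0 ≤ 5 * (1 + c) ^ (r + 2) * κ * (T ^ (r + 1) * Y * d⁻¹) := by positivity
  rcases le_or_gt Y (T / d) with h | h
  · refine (abs_latCount_sub_le_of_le hq hfin hκ hc hY hD hvol h).trans ?_
    have h1 : (T / d) ^ (r + 1) ≤ T ^ (r + 1) * d⁻¹ := by
      rw [div_pow, div_eq_mul_inv]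
      gcongr
      exact le_self_pow₀ hd (by lia)
    have h2 : (r + 2) * c * (1 + c) ^ (r + 1) * κ * ((T / d) ^ (r + 1) * Y) ≤
        (r + 2) * c * (1 + c) ^ (r + 1) * κ * (T ^ (r + 1) * d⁻¹ * Y) := by gcongr
    linarith
  · refine (abs_latCount_sub_le_of_lt hq hfin hpos hκ hc hD hvol (by positivity) h).trans ?_
    have h1 : T / d * Y ^ (r + 1) ≤ T ^ (r + 1) * Y * d⁻¹ := by
      have : Y ^ r ≤ T ^ r := by gcongr
      calc T / d * Y ^ (r + 1) = T * Y * d⁻¹ * Y ^ r := by rw [div_eq_mul_inv]; ring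
        _ ≤ T * Y * d⁻¹ * T ^ r := by gcongr
        _ = _ := by ring
    have h2 : 5 * (1 + c) ^ (r + 2) * κ * (T / d * Y ^ (r + 1)) ≤
        5 * (1 + c) ^ (r + 2) * κ * (T ^ (r + 1) * Y * d⁻¹) := by gcongr
    linarith

open Finset in
lemma card_filter_dvd_gcd {R : ℕ} {q : Seminorm ℝ (Fin R → ℝ)}
    (hfin : ∀ t, {n : Fin R → ℤ | q (intCast' n) < t}.Finite) {T : ℝ} (hT : 0 < T) {d : ℕ}
    (hd : 0 < d) :
    (#{n ∈ (hfin T).toFinset.erase 0 | d ∣ (univ.gcd n).natAbs} : ℝ) =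
      latCount q (T / d) - 1 := by
  have hd0 : (0 : ℝ) < d := by exact_mod_cast hd
  have hinj : Function.Injective fun m : Fin R → ℤ => (d : ℤ) • m :=
    smul_right_injective _ (by lia)
  have himg : {n ∈ (hfin T).toFinset.erase 0 | d ∣ (univ.gcd n).natAbs} =
      ((hfin (T / d)).toFinset.erase 0).image fun m : Fin R → ℤ => (d : ℤ) • m := by
    have hmem : ∀ m : Fin R → ℤ, q (intCast' ((d : ℤ) • m)) < T ↔ q (intCast' m) < T / d := by
      intro m
      rw [intCast'_smul, map_smul_eq_mul, Real.norm_eq_abs, lt_div_iff₀ hd0, mul_comm]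
      simp
    ext n
    simp only [mem_filter, mem_erase, Set.Finite.mem_toFinset, Set.mem_ofPred_eq, mem_image]
    constructor
    · rintro ⟨⟨h0, hn⟩, hdvd⟩
      have hk : ∀ k, (d : ℤ) ∣ n k := fun k =>
        (Int.natCast_dvd.2 hdvd).trans (Finset.gcd_dvd (mem_univ k))
      choose m hm using hk
      have hnm : n = (d : ℤ) • m := funext fun k => by simpa using hm k
      refine ⟨m, ⟨?_, ?_⟩, hnm.symm⟩
      · rintro rfl; simp [hnm] at h0
      · rwa [← hmem, ← hnm]
    · rintro ⟨m, ⟨h0, hm⟩, rfl⟩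
      refine ⟨⟨?_, (hmem m).2 hm⟩, Int.natCast_dvd.1 (Finset.dvd_gcd fun k _ => by simp)⟩
      exact smul_ne_zero (by lia) h0
  have h0 : (0 : Fin R → ℤ) ∈ (hfin (T / d)).toFinset := by
    simp only [Set.Finite.mem_toFinset, Set.mem_ofPred_eq]
    rw [show intCast' (0 : Fin R → ℤ) = 0 by ext; simp [intCast'], map_zero]
    positivity
  rw [himg, card_image_of_injective _ hinj, cast_card_erase_of_mem h0, latCount,
    Set.ncard_eq_toFinset_card _ (hfin _)]

open Finset in
lemma ncard_primitive_eq_sum {R : ℕ} {q : Seminorm ℝ (Fin R → ℝ)}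
    (hfin : ∀ t, {n : Fin R → ℤ | q (intCast' n) < t}.Finite)
    (hone : ∀ n : Fin R → ℤ, n ≠ 0 → 1 ≤ q (intCast' n)) {T : ℝ} (hT : 0 < T) :
    (Set.ncard {n : Fin R → ℤ | univ.gcd n = 1 ∧ q (intCast' n) < T} : ℝ) =
      ∑ d ∈ Icc 1 ⌊T⌋₊, (ArithmeticFunction.moebius d : ℝ) * (latCount q (T / d) - 1) := by
  have hset : {n : Fin R → ℤ | univ.gcd n = 1 ∧ q (intCast' n) < T} =
      ({n ∈ (hfin T).toFinset.erase 0 | (univ.gcd n).natAbs = 1} : Finset (Fin R → ℤ)) := by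
    ext n
    have hnn : 0 ≤ univ.gcd n := by
      rw [← Finset.normalize_gcd]; exact Int.nonneg_of_normalize_eq_self (by simp)
    simp only [coe_filter, mem_erase, Set.Finite.mem_toFinset, Set.mem_ofPred_eq]
    constructor
    · rintro ⟨h1, h2⟩
      refine ⟨⟨?_, h2⟩, by rw [h1]; rfl⟩
      rintro rfl
      rw [Finset.gcd_eq_zero_iff.2 (by simp)] at h1
      exact zero_ne_one h1
    · rintro ⟨⟨-, h2⟩, h1⟩
      exact ⟨by lia, h2⟩
  rw [hset, Set.ncard_coe_finset, card_filter]
  push_cast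
  have hterm : ∀ n ∈ (hfin T).toFinset.erase 0,
      (if (univ.gcd n).natAbs = 1 then (1 : ℝ) else 0) = ∑ d ∈ Icc 1 ⌊T⌋₊,
        if d ∣ (univ.gcd n).natAbs then (ArithmeticFunction.moebius d : ℝ) else 0 := by
    intro n hn
    simp only [mem_erase, Set.Finite.mem_toFinset, Set.mem_ofPred_eq] at hn
    have hg0 : (univ.gcd n).natAbs ≠ 0 := fun h => hn.1 <| funext fun k =>
      Finset.gcd_eq_zero_iff.1 (Int.natAbs_eq_zero.1 h) k (mem_univ k)
    refine (sum_moebius_of_dvd hg0 (Nat.le_floor ?_)).symm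
    have hk : ∀ k, univ.gcd n ∣ n k := fun k => Finset.gcd_dvd (mem_univ k)
    choose m hm using hk
    have hnm : n = (univ.gcd n) • m := funext fun k => by simpa using hm k
    have hm0 : m ≠ 0 := by
      rintro rfl
      exact hn.1 (by rw [hnm]; simp)
    have h1 := hn.2
    rw [hnm, intCast'_smul, map_smul_eq_mul, Real.norm_eq_abs] at h1
    have h2 := mul_le_mul_of_nonneg_left (hone m hm0) (abs_nonneg ((univ.gcd n : ℤ) : ℝ))
    rw [Nat.cast_natAbs, Int.cast_abs]
    linarith
  rw [sum_congr rfl hterm, sum_comm]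
  refine sum_congr rfl fun d hd => ?_
  rw [← card_filter_dvd_gcd hfin hT (mem_Icc.1 hd).1, ← sum_filter, sum_const, nsmul_eq_mul,
    mul_comm]

open Finset in
lemma abs_ncard_primitive_sub_le {r : ℕ} {q : Seminorm ℝ (Fin (r + 2) → ℝ)} (hq : Continuous q)
    (hfin : ∀ t, {n : Fin (r + 2) → ℤ | q (intCast' n) < t}.Finite)
    (hone : ∀ n : Fin (r + 2) → ℤ, n ≠ 0 → 1 ≤ q (intCast' n)) {c Y κ : ℝ} (hκ : 0 ≤ κ)
    (hc : 0 ≤ c) (hY : 1 ≤ Y)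
    (hD : ∀ y : Fin (r + 2) → ℝ, ∃ n : Fin (r + 2) → ℤ, q (y - intCast' n) ≤ c * Y)
    (hvol : ∀ t, 0 ≤ t → volume {y | q y < t} = ENNReal.ofReal (κ * t ^ (r + 2)))
    {T : ℝ} (hT : Y ≤ T) :
    |(Set.ncard {n : Fin (r + 2) → ℤ | univ.gcd n = 1 ∧ q (intCast' n) < T} : ℝ) -
        κ / zetaVal (r + 2) * T ^ (r + 2)| ≤
      2 * T + ((r + 2) * c * (1 + c) ^ (r + 1) + 5 * (1 + c) ^ (r + 2) + 2) *
        (κ * T ^ (r + 1) * Y * (1 + Real.log T)) := by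
  have hT1 : 1 ≤ T := hY.trans hT
  have hT0 : 0 < T := by linarith
  have hlog : 0 ≤ Real.log T := Real.log_nonneg hT1
  rw [ncard_primitive_eq_sum hfin hone hT0]
  set C := (r + 2) * c * (1 + c) ^ (r + 1) + 5 * (1 + c) ^ (r + 2) with hC
  have hC0 : 0 ≤ C := by positivity
  have hsplit : ∑ d ∈ Icc 1 ⌊T⌋₊, (ArithmeticFunction.moebius d : ℝ) * (latCount q (T / d) - 1) -
        κ / zetaVal (r + 2) * T ^ (r + 2) =
      ∑ d ∈ Icc 1 ⌊T⌋₊, (ArithmeticFunction.moebius d : ℝ) *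
        (latCount q (T / d) - κ * (T / d) ^ (r + 2) - 1) +
      κ * T ^ (r + 2) * (∑ d ∈ Icc 1 ⌊T⌋₊, (ArithmeticFunction.moebius d : ℝ) / (d : ℝ) ^ (r + 2) -
        1 / zetaVal (r + 2)) := by
    rw [mul_sub, mul_sum, ← add_sub_assoc, ← sum_add_distrib]
    congr 1
    · refine sum_congr rfl fun d _ => ?_
      rw [div_pow]; ring
    · ring
  have hfirst : |∑ d ∈ Icc 1 ⌊T⌋₊, (ArithmeticFunction.moebius d : ℝ) *
      (latCount q (T / d) - κ * (T / d) ^ (r + 2) - 1)| ≤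
      2 * T + C * κ * (T ^ (r + 1) * Y) * (1 + Real.log T) := by
    calc _ ≤ ∑ d ∈ Icc 1 ⌊T⌋₊, (2 + C * κ * (T ^ (r + 1) * Y) * (d : ℝ)⁻¹) := by
          refine (abs_sum_le_sum_abs _ _).trans (sum_le_sum fun d hd => ?_)
          have hd1 : (1 : ℝ) ≤ d := by exact_mod_cast (mem_Icc.1 hd).1
          have hmu : |(ArithmeticFunction.moebius d : ℝ)| ≤ 1 := by
            exact_mod_cast ArithmeticFunction.abs_moebius_le_one
          have h1 := abs_latCount_div_sub_le hq hfin
            (fun n hn => zero_lt_one.trans_le (hone n hn)) hκ hc (by linarith) hD hvol hT hd1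
          have h2 := abs_sub (latCount q (T / d) - κ * (T / d) ^ (r + 2)) 1
          rw [abs_one] at h2
          rw [abs_mul]
          refine (mul_le_of_le_one_left (abs_nonneg _) hmu).trans ?_
          linarith
      _ = 2 * ⌊T⌋₊ + C * κ * (T ^ (r + 1) * Y) * ∑ d ∈ Icc 1 ⌊T⌋₊, (d : ℝ)⁻¹ := by
          rw [sum_add_distrib, ← mul_sum]; simp [mul_comm]
      _ ≤ _ := by
          have := sum_inv_le_one_add_log hT1
          have := Nat.floor_le hT0.le
          gcongr
  have hsecond : |κ * T ^ (r + 2) * (∑ d ∈ Icc 1 ⌊T⌋₊, (ArithmeticFunction.moebius d : ℝ) /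
      (d : ℝ) ^ (r + 2) - 1 / zetaVal (r + 2))| ≤ 2 * (κ * T ^ (r + 1) * Y * (1 + Real.log T)) := by
    rw [abs_mul, abs_of_nonneg (by positivity : 0 ≤ κ * T ^ (r + 2))]
    have h1 := abs_sum_moebius_div_pow_sub_le (by lia : 2 ≤ r + 2) ⌊T⌋₊
    have h2 : 2 / ((⌊T⌋₊ : ℝ) + 1) ≤ 2 / T := by
      have := (Nat.lt_floor_add_one T).le
      gcongr
    calc _ ≤ κ * T ^ (r + 2) * (2 / T) := by gcongr; exact h1.trans h2
      _ = 2 * (κ * T ^ (r + 1) * 1 * (1 + 0)) := by field_simp; ring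
      _ ≤ _ := by gcongr
  rw [hsplit]
  refine (abs_add_le _ _).trans ((add_le_add hfirst hsecond).trans (le_of_eq (by ring)))

lemma one_add_log_bound {r : ℕ} {κ W Y T : ℝ} (hκ : 0 ≤ κ) (hκW : κ ≤ W) (hY : 1 ≤ Y)
    (hT : Y ≤ T) :
    κ * T ^ (r + 1) * Y * (1 + Real.log T) ≤
      3 * (κ * T ^ (r + 1) * Y * Real.log T) + W * 2 ^ (r + 2) * T := by
  have hT1 : 1 ≤ T := hY.trans hT
  have hW : 0 ≤ W := hκ.trans hκW
  have hlog : 0 ≤ Real.log T := Real.log_nonneg hT1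
  rcases le_or_gt 2 T with h | h
  · have h1 := Real.log_le_log (by norm_num) h
    have h2 := Real.log_two_gt_d9
    have h3 : κ * T ^ (r + 1) * Y * (1 + Real.log T) ≤ κ * T ^ (r + 1) * Y * (3 * Real.log T) := by
      gcongr
      linarith
    have : 0 ≤ W * 2 ^ (r + 2) * T := by positivity
    linarith
  · have h1 : Real.log T ≤ 1 := (Real.log_le_sub_one_of_pos (by linarith)).trans (by linarith)
    have h2 : κ * T ^ (r + 1) * Y * (1 + Real.log T) ≤ W * 2 ^ (r + 1) * T * (1 + 1) := by
      gcongr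
    have : 0 ≤ 3 * (κ * T ^ (r + 1) * Y * Real.log T) := by positivity
    calc _ ≤ W * 2 ^ (r + 1) * T * (1 + 1) := h2
      _ = W * 2 ^ (r + 2) * T := by ring
      _ ≤ _ := by linarith

lemma abs_le_rnorm {N : ℕ} (x : Fin N → ℝ) (k : Fin N) : |x k| ≤ rnorm x :=
  Real.abs_le_sqrt (Finset.single_le_sum (f := fun k => x k ^ 2) (fun _ _ => sq_nonneg _)
    (Finset.mem_univ k))

lemma rnorm_eq_norm {N : ℕ} (x : Fin N → ℝ) : rnorm x = ‖WithLp.toLp 2 x‖ := by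
  simp [rnorm, EuclideanSpace.norm_eq]

lemma rnorm_sq {N : ℕ} (x : Fin N → ℝ) : rnorm x ^ 2 = x ⬝ᵥ x := by
  rw [rnorm, Real.sq_sqrt (Finset.sum_nonneg fun _ _ => sq_nonneg _)]
  simp [dotProduct, sq]

lemma one_le_rnorm_intCast' {N : ℕ} {v : Fin N → ℤ} (hv : v ≠ 0) : 1 ≤ rnorm (intCast' v) := by
  obtain ⟨k, hk⟩ := Function.ne_iff.1 hv
  refine le_trans ?_ (abs_le_rnorm _ k)
  have h : (1 : ℝ) ≤ |(v k : ℝ)| := by exact_mod_cast Int.one_le_abs hk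
  exact h

lemma finite_rnorm_lt (N : ℕ) (t : ℝ) : {v : Fin N → ℤ | rnorm (intCast' v) < t}.Finite := by
  refine (Set.finite_Icc (fun _ : Fin N => -⌈t⌉) (fun _ => ⌈t⌉)).subset fun v hv => ?_
  have h : ∀ k, |v k| ≤ ⌈t⌉ := fun k => by
    have h1 := (abs_le_rnorm (intCast' v) k).trans (le_of_lt hv)
    have h2 : ((|v k| : ℤ) : ℝ) ≤ ⌈t⌉ := by
      push_cast
      exact h1.trans (Int.le_ceil t)
    exact_mod_cast h2
  exact ⟨fun k => (abs_le.1 (h k)).1, fun k => (abs_le.1 (h k)).2⟩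

/-- The coordinate matrix of a family of integer vectors, one vector in each row. -/
def basisMatrix {N R : ℕ} (b : Fin R → (Fin N → ℤ)) : Matrix (Fin R) (Fin N) ℝ :=
  Matrix.of fun i k => (b i k : ℝ)

/-- The Euclidean norm of `∑ i, c i • b i` as a seminorm in the coordinates `c`. -/
def latNorm {N R : ℕ} (b : Fin R → (Fin N → ℤ)) : Seminorm ℝ (Fin R → ℝ) :=
  (normSeminorm ℝ (EuclideanSpace ℝ (Fin N))).comp
    ((WithLp.linearEquiv 2 ℝ (Fin N → ℝ)).symm.toLinearMap ∘ₗ (basisMatrix b).vecMulLinear)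

open scoped Matrix in
lemma latNorm_apply {N R : ℕ} (b : Fin R → (Fin N → ℤ)) (c : Fin R → ℝ) :
    latNorm b c = rnorm (c ᵥ* basisMatrix b) := by
  rw [rnorm_eq_norm]; rfl

lemma continuous_latNorm {N R : ℕ} (b : Fin R → (Fin N → ℤ)) : Continuous (latNorm b) := by
  have : Continuous ((WithLp.linearEquiv 2 ℝ (Fin N → ℝ)).symm.toLinearMap ∘ₗ
    (basisMatrix b).vecMulLinear) := LinearMap.continuous_of_finiteDimensional _
  exact continuous_norm.comp this

open scoped Matrix in
lemma intCast'_vecMul {N R : ℕ} (b : Fin R → (Fin N → ℤ)) (n : Fin R → ℤ) :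
    intCast' n ᵥ* basisMatrix b = intCast' (∑ i, n i • b i) := by
  ext k
  simp [Matrix.vecMul, dotProduct, intCast', basisMatrix]

lemma latNorm_intCast' {N R : ℕ} (b : Fin R → (Fin N → ℤ)) (n : Fin R → ℤ) :
    latNorm b (intCast' n) = rnorm (intCast' (∑ i, n i • b i)) := by
  rw [latNorm_apply, intCast'_vecMul]

lemma latNorm_sq {N R : ℕ} (b : Fin R → (Fin N → ℤ)) (c : Fin R → ℝ) :
    latNorm b c ^ 2 = c ⬝ᵥ (basisMatrix b * (basisMatrix b).transpose).mulVec c := by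
  rw [latNorm_apply, rnorm_sq, ← Matrix.mulVec_mulVec, Matrix.mulVec_transpose,
    Matrix.dotProduct_mulVec]

lemma latDet_eq {N R : ℕ} (b : Fin R → (Fin N → ℤ)) :
    latDet N R b = √(basisMatrix b * (basisMatrix b).transpose).det := rfl

lemma posSemidef_gram {N R : ℕ} (b : Fin R → (Fin N → ℤ)) :
    (basisMatrix b * (basisMatrix b).transpose).PosSemidef := by
  have := Matrix.posSemidef_self_mul_conjTranspose (basisMatrix b)
  rwa [Matrix.conjTranspose_eq_transpose_of_trivial] at this

lemma sum_smul_injective {N R : ℕ} {b : Fin R → (Fin N → ℤ)} (hb : LinearIndependent ℤ b) :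
    Function.Injective fun n : Fin R → ℤ => ∑ i, n i • b i := by
  intro m n h
  have := Fintype.linearIndependent_iff.1 hb (m - n) (by
    simp only [Pi.sub_apply, sub_smul, Finset.sum_sub_distrib]
    exact sub_eq_zero.2 h)
  exact funext fun i => sub_eq_zero.1 (this i)

lemma one_le_latNorm_intCast' {N R : ℕ} {b : Fin R → (Fin N → ℤ)} (hb : LinearIndependent ℤ b)
    {n : Fin R → ℤ} (hn : n ≠ 0) : 1 ≤ latNorm b (intCast' n) := by
  rw [latNorm_intCast']
  refine one_le_rnorm_intCast' fun h => hn (sum_smul_injective hb ?_)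
  simpa using h

lemma finite_latNorm_lt {N R : ℕ} {b : Fin R → (Fin N → ℤ)} (hb : LinearIndependent ℤ b) (t : ℝ) :
    {n : Fin R → ℤ | latNorm b (intCast' n) < t}.Finite := by
  simp_rw [latNorm_intCast']
  exact (finite_rnorm_lt N t).preimage (sum_smul_injective hb).injOn

lemma one_le_det_gram {N R : ℕ} {b : Fin R → (Fin N → ℤ)} (hb : LinearIndependent ℤ b) :
    1 ≤ (basisMatrix b * (basisMatrix b).transpose).det := by
  set Gz : Matrix (Fin R) (Fin R) ℤ := Matrix.of b * (Matrix.of b).transpose with hGz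
  have hG : basisMatrix b * (basisMatrix b).transpose = (Int.castRingHom ℝ).mapMatrix Gz := by
    ext i j
    simp [hGz, basisMatrix, Matrix.mul_apply]
  have hne : Gz.det ≠ 0 := fun h => by
    obtain ⟨n, hn0, hn⟩ := Matrix.exists_mulVec_eq_zero_iff.2 h
    have h1 : latNorm b (intCast' n) ^ 2 = 0 := by
      rw [latNorm_sq, hG]
      have : ((Int.castRingHom ℝ).mapMatrix Gz).mulVec (intCast' n) = 0 := by
        ext k
        have := congrFun hn k
        simp only [Matrix.mulVec, dotProduct, Pi.zero_apply] at this
        simpa [Matrix.mulVec, dotProduct, intCast'] using congrArg (Int.cast : ℤ → ℝ) this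
      rw [this, dotProduct_zero]
    have h2 := one_le_latNorm_intCast' hb hn0
    nlinarith
  have hnn := (posSemidef_gram b).det_nonneg
  rw [hG, ← RingHom.map_det] at hnn ⊢
  have h1 : 0 ≤ Gz.det := by simpa using hnn
  have h2 : 1 ≤ Gz.det := by lia
  simpa using (by exact_mod_cast h2 : (1 : ℝ) ≤ (Gz.det : ℝ))

lemma one_le_latDet {N R : ℕ} {b : Fin R → (Fin N → ℤ)} (hb : LinearIndependent ℤ b) :
    1 ≤ latDet N R b := by
  rw [latDet_eq]
  exact Real.one_le_sqrt.2 (one_le_det_gram hb)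

lemma vecMul_basisMatrix_injective {N R : ℕ} {b : Fin R → (Fin N → ℤ)}
    (hb : LinearIndependent ℤ b) :
    Function.Injective (basisMatrix b).vecMulLinear := by
  rw [injective_iff_map_eq_zero]
  intro c hc
  by_contra hne
  have hdet := one_le_det_gram hb
  have : (basisMatrix b * (basisMatrix b).transpose).mulVec c = 0 := by
    rw [← Matrix.mulVec_mulVec, Matrix.mulVec_transpose, ← Matrix.vecMulLinear_apply, hc,
      Matrix.mulVec_zero]
  rw [Matrix.exists_mulVec_eq_zero_iff.1 ⟨c, hne, this⟩] at hdet
  linarith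

open scoped MatrixOrder in
lemma volume_latNorm_lt {N R : ℕ} (hR : 0 < R) {b : Fin R → (Fin N → ℤ)}
    (hb : LinearIndependent ℤ b) {t : ℝ} (ht : 0 ≤ t) :
    volume {y | latNorm b y < t} = ENNReal.ofReal (VR R / latDet N R b * t ^ R) := by
  obtain ⟨A, hA⟩ := CStarAlgebra.nonneg_iff_eq_star_mul_self.1 (posSemidef_gram b).nonneg
  rw [Matrix.star_eq_conjTranspose, Matrix.conjTranspose_eq_transpose_of_trivial] at hA
  have hnorm : ∀ c, latNorm b c = ‖WithLp.toLp 2 (A.toLin' c)‖ := fun c => by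
    rw [← rnorm_eq_norm, ← sq_eq_sq₀ (apply_nonneg _ _) (by exact Real.sqrt_nonneg _), latNorm_sq, hA,
      rnorm_sq, Matrix.toLin'_apply, ← Matrix.mulVec_mulVec, Matrix.dotProduct_mulVec,
      Matrix.vecMul_transpose]
  have hdet : latDet N R b = |A.det| := by
    rw [latDet_eq, hA, Matrix.det_mul, Matrix.det_transpose, Real.sqrt_mul_self_eq_abs]
  have hdet1 := one_le_latDet hb
  have hdet0 : LinearMap.det A.toLin' ≠ 0 := by
    rw [LinearMap.det_toLin']
    intro h
    rw [hdet, h, abs_zero] at hdet1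
    linarith
  have hset : {y | latNorm b y < t} =
      A.toLin' ⁻¹' (WithLp.toLp 2 ⁻¹' Metric.ball (0 : EuclideanSpace ℝ (Fin R)) t) := by
    ext y
    simp [hnorm]
  have : Nonempty (Fin R) := ⟨⟨0, hR⟩⟩
  rw [hset, Measure.addHaar_preimage_linearMap _ hdet0,
    (PiLp.volume_preserving_toLp (Fin R)).measure_preimage measurableSet_ball.nullMeasurableSet,
    Measure.addHaar_ball _ _ ht, LinearMap.det_toLin', abs_inv, ← hdet, finrank_euclideanSpace,
    Fintype.card_fin, VR,
    ← ENNReal.ofReal_toReal (measure_ball_lt_top (μ := volume)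
      (x := (0 : EuclideanSpace ℝ (Fin R))) (r := 1)).ne,
    ← ENNReal.ofReal_mul (by positivity), ← ENNReal.ofReal_mul (by positivity),
    ENNReal.toReal_ofReal ENNReal.toReal_nonneg]
  congr 1
  ring

lemma mem_span_int_range_iff {N R : ℕ} {b : Fin R → (Fin N → ℤ)} {v : Fin N → ℤ} :
    v ∈ Submodule.span ℤ (Set.range b) ↔ ∃ n : Fin R → ℤ, ∑ i, n i • b i = v :=
  Submodule.mem_span_range_iff_exists_fun ℤ

lemma le_of_mem_succMin_set {N R : ℕ} (hR : 0 < R) (b : Fin R → (Fin N → ℤ)) {u : ℝ}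
    (hu : R ≤ Module.finrank ℝ (Submodule.span ℝ
      {x : Fin N → ℝ | (∃ v ∈ Submodule.span ℤ (Set.range b), x = intCast' v) ∧ rnorm x < u})) :
    1 ≤ u := by
  by_contra! hu1
  have hsub : {x : Fin N → ℝ | (∃ v ∈ Submodule.span ℤ (Set.range b), x = intCast' v) ∧
      rnorm x < u} ⊆ {0} := by
    rintro x ⟨⟨v, -, rfl⟩, hx⟩
    by_contra hv
    have hv0 : v ≠ 0 := by
      rintro rfl
      exact hv (by ext; simp [intCast'])
    linarith [one_le_rnorm_intCast' hv0]
  rw [Submodule.span_eq_bot.2 fun x hx => hsub hx, finrank_bot] at hu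
  lia

lemma succMin_set_nonempty {N R : ℕ} {b : Fin R → (Fin N → ℤ)} (hb : LinearIndependent ℤ b) :
    {u : ℝ | 0 < u ∧ R ≤ Module.finrank ℝ (Submodule.span ℝ
      {x : Fin N → ℝ | (∃ v ∈ Submodule.span ℤ (Set.range b), x = intCast' v) ∧
        rnorm x < u})}.Nonempty := by
  have hnn : ∀ i ∈ Finset.univ, 0 ≤ rnorm (intCast' (b i)) := fun i _ => Real.sqrt_nonneg _
  refine ⟨1 + ∑ i, rnorm (intCast' (b i)), by linarith [Finset.sum_nonneg hnn], ?_⟩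
  have h := LinearMap.finrank_range_of_inj (vecMul_basisMatrix_injective hb)
  rw [Module.finrank_fin_fun] at h
  refine h.ge.trans (Submodule.finrank_mono ?_)
  rintro - ⟨c, rfl⟩
  rw [Matrix.vecMulLinear_apply, Matrix.vecMul_eq_sum]
  refine Submodule.sum_mem _ fun i _ => Submodule.smul_mem _ _ (Submodule.subset_span ?_)
  refine ⟨⟨b i, Submodule.subset_span ⟨i, rfl⟩, rfl⟩, ?_⟩
  have := Finset.single_le_sum hnn (Finset.mem_univ i)
  exact this.trans_lt (by linarith)

lemma one_le_succMin {N R : ℕ} (hR : 0 < R) {b : Fin R → (Fin N → ℤ)}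
    (hb : LinearIndependent ℤ b) : 1 ≤ succMin N R b R :=
  le_csInf (succMin_set_nonempty hb) fun _ hu => le_of_mem_succMin_set hR b hu.2

lemma exists_latNorm_sub_le {N R : ℕ} (hR : 0 < R) {b : Fin R → (Fin N → ℤ)}
    (hb : LinearIndependent ℤ b) {Y : ℝ} (hY : succMin N R b R ≤ Y) (y : Fin R → ℝ) :
    ∃ n : Fin R → ℤ, latNorm b (y - intCast' n) ≤ 2 * R * Y := by
  have hY1 : 1 ≤ Y := (one_le_succMin hR hb).trans hY
  obtain ⟨u, ⟨-, hu⟩, huY⟩ := exists_lt_of_csInf_lt (succMin_set_nonempty hb)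
    (show succMin N R b R < 2 * Y by linarith)
  set P : Set (Fin R → ℝ) := {c | ∃ n : Fin R → ℤ, c = intCast' n ∧ latNorm b c < u}
  have hrank : R ≤ Module.finrank ℝ (Submodule.span ℝ P) := by
    refine hu.trans (le_trans (Submodule.finrank_mono ?_)
      (Submodule.finrank_map_le (basisMatrix b).vecMulLinear _))
    rw [Submodule.map_span]
    refine Submodule.span_mono ?_
    rintro x ⟨⟨v, hv, rfl⟩, hx⟩
    obtain ⟨n, rfl⟩ := mem_span_int_range_iff.1 hv
    exact ⟨intCast' n, ⟨n, rfl, by rwa [latNorm_intCast']⟩, intCast'_vecMul b n⟩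
  have htop : Submodule.span ℝ P = ⊤ := Submodule.eq_top_of_finrank_eq
    (le_antisymm (Submodule.finrank_le _) (by rwa [Module.finrank_fin_fun]))
  obtain ⟨f, hfP, hfspan, -⟩ := Submodule.exists_fun_fin_finrank_span_eq ℝ P
  choose m hm hmu using hfP
  have hy : y ∈ Submodule.span ℝ (Set.range f) := by
    rw [hfspan, htop]; trivial
  obtain ⟨c, rfl⟩ := (Submodule.mem_span_range_iff_exists_fun ℝ).1 hy
  refine ⟨∑ i, ⌊c i⌋ • m i, ?_⟩
  have hcast : intCast' (∑ i, ⌊c i⌋ • m i) = ∑ i, (⌊c i⌋ : ℝ) • f i := by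
    simp_rw [hm]
    ext k
    simp [intCast']
  rw [hcast, ← Finset.sum_sub_distrib]
  simp_rw [← sub_smul]
  calc latNorm b (∑ i, (c i - ⌊c i⌋) • f i)
      ≤ ∑ i, latNorm b ((c i - ⌊c i⌋) • f i) :=
        Finset.le_sum_of_subadditive _ (map_zero _).le (map_add_le_add _) _ _
    _ ≤ ∑ _i : Fin (Module.finrank ℝ (Submodule.span ℝ P)), 2 * Y := by
        refine Finset.sum_le_sum fun i _ => ?_
        rw [map_smul_eq_mul, Real.norm_eq_abs, Int.self_sub_floor, abs_of_nonneg (Int.fract_nonneg _)]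
        exact (mul_le_of_le_one_left (apply_nonneg _ _) (Int.fract_lt_one _).le).trans
          ((hmu i).le.trans huY.le)
    _ = 2 * R * Y := by
        rw [Finset.sum_const, Finset.card_univ, Fintype.card_fin, htop, finrank_top,
          Module.finrank_fin_fun, nsmul_eq_mul]
        ring

lemma dvd_sum_smul_iff {N R : ℕ} {b : Fin R → (Fin N → ℤ)} (hb : LinearIndependent ℤ b)
    (hprim : ∀ v : Fin N → ℤ,
      intCast' v ∈ Submodule.span ℝ (Set.range fun i => intCast' (b i)) →
      v ∈ Submodule.span ℤ (Set.range b)) (n : Fin R → ℤ) (d : ℤ) :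
    (∀ k, d ∣ (∑ i, n i • b i) k) ↔ ∀ i, d ∣ n i := by
  constructor
  · intro h
    choose w hw using h
    have hdw : ∑ i, n i • b i = d • w := funext fun k => by simpa using hw k
    rcases eq_or_ne d 0 with rfl | hd
    · have : n = 0 := sum_smul_injective hb (by simpa using hdw)
      simp [this]
    · have hd' : (d : ℝ) ≠ 0 := by exact_mod_cast hd
      have hspan : intCast' w ∈ Submodule.span ℝ (Set.range fun i => intCast' (b i)) := by
        have h1 : intCast' w = (d : ℝ)⁻¹ • ∑ i, (n i : ℝ) • intCast' (b i) := by
          rw [eq_inv_smul_iff₀ hd', ← intCast'_smul, ← hdw]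
          ext k
          simp [intCast']
        rw [h1]
        exact Submodule.smul_mem _ _ (Submodule.sum_mem _ fun i _ =>
          Submodule.smul_mem _ _ (Submodule.subset_span ⟨i, rfl⟩))
      obtain ⟨m, rfl⟩ := mem_span_int_range_iff.1 (hprim w hspan)
      have : n = d • m := sum_smul_injective hb (by
        simp only [hdw, Finset.smul_sum, Pi.smul_apply, smul_assoc])
      intro i
      exact ⟨m i, by simp [this]⟩
  · intro h k
    rw [Finset.sum_apply]
    exact Finset.dvd_sum fun i _ => by
      simpa using Dvd.dvd.mul_right (h i) (b i k)

lemma gcd_sum_smul {N R : ℕ} {b : Fin R → (Fin N → ℤ)} (hb : LinearIndependent ℤ b)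
    (hprim : ∀ v : Fin N → ℤ,
      intCast' v ∈ Submodule.span ℝ (Set.range fun i => intCast' (b i)) →
      v ∈ Submodule.span ℤ (Set.range b)) (n : Fin R → ℤ) :
    Finset.univ.gcd (∑ i, n i • b i) = Finset.univ.gcd n := by
  refine dvd_antisymm_of_normalize_eq Finset.normalize_gcd Finset.normalize_gcd ?_ ?_
  · exact Finset.dvd_gcd fun i _ => (dvd_sum_smul_iff hb hprim n _).1
      (fun k => Finset.gcd_dvd (Finset.mem_univ k)) i
  · exact Finset.dvd_gcd fun k _ => (dvd_sum_smul_iff hb hprim n _).2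
      (fun i => Finset.gcd_dvd (Finset.mem_univ i)) k

lemma ncard_primitive_lattice_eq {N R : ℕ} {b : Fin R → (Fin N → ℤ)}
    (hb : LinearIndependent ℤ b) (hprim : ∀ v : Fin N → ℤ,
      intCast' v ∈ Submodule.span ℝ (Set.range fun i => intCast' (b i)) →
      v ∈ Submodule.span ℤ (Set.range b)) (T : ℝ) :
    Set.ncard {v : Fin N → ℤ | v ∈ Submodule.span ℤ (Set.range b) ∧
        Finset.univ.gcd v = 1 ∧ rnorm (intCast' v) < T} =
      Set.ncard {n : Fin R → ℤ | Finset.univ.gcd n = 1 ∧ latNorm b (intCast' n) < T} := by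
  rw [← Set.ncard_image_of_injective _ (sum_smul_injective hb)]
  congr 1
  ext v
  simp only [Set.mem_ofPred_eq, Set.mem_image, mem_span_int_range_iff, latNorm_intCast']
  constructor
  · rintro ⟨⟨n, rfl⟩, h1, h2⟩
    exact ⟨n, ⟨by rwa [gcd_sum_smul hb hprim] at h1, h2⟩, rfl⟩
  · rintro ⟨n, ⟨h1, h2⟩, rfl⟩
    exact ⟨⟨n, rfl⟩, by rwa [gcd_sum_smul hb hprim], h2⟩

/-- Lemma 3.4 (counting primitive points of a primitive integral lattice in balls):
a rank-`R` primitive integral lattice `Λ ⊆ ℤ^N` is given by a `ℤ`-linearly independent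
family `b : Fin R → ℤ^N` spanning it; primitivity says `Span_ℝ(Λ) ∩ ℤ^N = Λ`.
For `T ≥ Y ≥ λ_R(Λ)`,
`#(Λ ∩ ℤ^N_prim ∩ 𝓑_N(T)) = (V_R/ζ(R))·T^R/det(Λ)·(1 + O(Y log T/T)) + O(T)`,
with implied constants depending only on `R`. -/
theorem primitive_lattice_point_count :
    ∀ R : ℕ, 2 ≤ R → ∃ K₁ > (0 : ℝ), ∃ K₂ > (0 : ℝ),
    ∀ N : ℕ, 1 ≤ N → R ≤ N →
    ∀ b : Fin R → (Fin N → ℤ), LinearIndependent ℤ b →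
    (∀ v : Fin N → ℤ,
        intCast' v ∈ Submodule.span ℝ (Set.range fun i => intCast' (b i)) →
        v ∈ Submodule.span ℤ (Set.range b)) →
    ∀ Y T : ℝ, succMin N R b R ≤ Y → Y ≤ T →
    |(Set.ncard {v : Fin N → ℤ | v ∈ Submodule.span ℤ (Set.range b) ∧
        Finset.univ.gcd v = 1 ∧ rnorm (intCast' v) < T} : ℝ) -
          VR R / zetaVal R * T ^ R / latDet N R b| ≤
      K₁ * (VR R / zetaVal R * T ^ R / latDet N R b) * (Y * Real.log T / T) + K₂ * T := by
  intro R hR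
  obtain ⟨r, rfl⟩ := Nat.exists_eq_add_of_le' hR
  set C : ℝ := (r + 2) * (2 * (r + 2)) * (1 + 2 * (r + 2)) ^ (r + 1) +
    5 * (1 + 2 * (r + 2)) ^ (r + 2) + 2 with hC
  have hC0 : 0 < C := by positivity
  have hζ := zetaVal_pos hR
  have hV : 0 ≤ VR (r + 2) := ENNReal.toReal_nonneg
  refine ⟨3 * C * zetaVal (r + 2), by positivity, 2 + C * (VR (r + 2) * 2 ^ (r + 2)),
    by positivity, ?_⟩
  intro N _ _ b hb hprim Y T hY hT
  have hR0 : 0 < r + 2 := by lia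
  have hY1 : 1 ≤ Y := (one_le_succMin hR0 hb).trans hY
  have hT0 : 0 < T := by linarith
  have hdet := one_le_latDet hb
  have hmain := abs_ncard_primitive_sub_le (continuous_latNorm b) (finite_latNorm_lt hb)
    (fun n hn => one_le_latNorm_intCast' hb hn) (c := 2 * (r + 2)) (Y := Y)
    (κ := VR (r + 2) / latDet N (r + 2) b) (by positivity) (by positivity) hY1
    (fun y => by simpa using exists_latNorm_sub_le hR0 hb hY y)
    (fun t ht => volume_latNorm_lt hR0 hb ht) hT
  have hlog := one_add_log_bound (r := r) (κ := VR (r + 2) / latDet N (r + 2) b)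
    (W := VR (r + 2)) (by positivity) (div_le_self hV hdet) hY1 hT
  rw [ncard_primitive_lattice_eq hb hprim, show VR (r + 2) / zetaVal (r + 2) * T ^ (r + 2) /
    latDet N (r + 2) b = VR (r + 2) / latDet N (r + 2) b / zetaVal (r + 2) * T ^ (r + 2) by ring]
  refine hmain.trans ((add_le_add_right (mul_le_mul_of_nonneg_left hlog hC0.le) _).trans
    (le_of_eq ?_))
  field_simp
  ring

end
end
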